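/- arXiv:2507.07529 — 5 statements merged into one kernel-verified Lean document; each statement's English description precedes it below -/
import Mathlib

section
/- Let G be a finite group and P a normal subgroup of G of odd order and of index 2. Let t ∈ G be an involution and suppose the commutator subgroup V = [P, ⟨t⟩] is abelian. If x ∈ P with x ∉ V, then ⟨x·x^t⟩ ∩ V = 1 and x·x^t commutes with some involution of G. -/
/-- An involution `t` inverts `[P, ⟨t⟩]` when the latter is abelian. -/
theorem conj_eq_inv_of_mem_commutator_zpowers {G : Type*} [Group G] (P : Subgroup G) {t : G}
    (ht : t * t = 1)
    (hab : ∀ u ∈ ⁅P, Subgroup.zpowers t⁆, ∀ v ∈ ⁅P, Subgroup.zpowers t⁆, u * v = v * u)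
    {v : G} (hv : v ∈ ⁅P, Subgroup.zpowers t⁆) : t * v * t⁻¹ = v⁻¹ := by
  have hti : t⁻¹ = t := inv_eq_of_mul_eq_one_left ht
  rw [Subgroup.commutator_def] at hv hab
  induction hv using Subgroup.closure_induction with
  | mem u hu =>
    obtain ⟨p, -, s, hs, rfl⟩ := hu
    obtain ⟨k, rfl⟩ := Subgroup.mem_zpowers_iff.mp hs
    obtain ⟨m, rfl | rfl⟩ := Int.even_or_odd' k
    · have h : t ^ (2 * m) = 1 := by rw [zpow_mul, zpow_ofNat, pow_two, ht, one_zpow]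
      simp [h]
    · have h : t ^ (2 * m + 1) = t := by
        rw [zpow_add, zpow_mul, zpow_ofNat, pow_two, ht, one_zpow, zpow_one, one_mul]
      rw [h, commutatorElement_inv, commutatorElement_def, commutatorElement_def, hti]
      simp only [mul_assoc, ht, mul_one]
  | one => simp
  | mul a b ha hb iha ihb =>
    rw [← conj_mul, iha, ihb, hab a ha b hb, mul_inv_rev]
  | inv a ha iha => rw [← conj_inv, iha]

/-- Two involutions `t`, `z` whose product lies in a subgroup `P` of odd order are conjugate in `P`,
so that `z * t` is a commutator. -/
theorem mul_mem_commutator_zpowers_of_odd {G : Type*} [Group G] (P : Subgroup G)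
    (hodd : Odd (Nat.card P)) {t z : G} (ht : t * t = 1) (hz : z * z = 1) (hmem : t * z ∈ P) :
    z * t ∈ ⁅P, Subgroup.zpowers t⁆ := by
  obtain ⟨m, hm⟩ := hodd
  have hti : t⁻¹ = t := inv_eq_of_mul_eq_one_left ht
  have hzi : z⁻¹ = z := inv_eq_of_mul_eq_one_left hz
  have hd : (t * z) ^ (2 * m + 1) = 1 := by
    have h := pow_card_eq_one' (x := (⟨t * z, hmem⟩ : P))
    rw [hm] at h
    simpa using congrArg Subtype.val h
  have hconj : t * (t * z) ^ (m + 1) * t⁻¹ = ((t * z) ^ (m + 1))⁻¹ := by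
    rw [← conj_pow, ← inv_pow, mul_inv_rev, hzi, hti, ← mul_assoc t t z, ht, one_mul]
  have hsq : (t * z) ^ (m + 1) * (t * z) ^ (m + 1) = t * z := by
    rw [← pow_add, show m + 1 + (m + 1) = 2 * m + 1 + 1 by ring, pow_succ, hd, one_mul]
  have hkey : ((t * z) ^ (m + 1))⁻¹ * t * ((t * z) ^ (m + 1))⁻¹⁻¹ * t⁻¹ = z * t := by
    rw [inv_inv, ← hconj, hti]
    calc t * (t * z) ^ (m + 1) * t * t * (t * z) ^ (m + 1) * t
        = t * (t * z) ^ (m + 1) * (t * t) * (t * z) ^ (m + 1) * t := by simp only [mul_assoc]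
      _ = t * ((t * z) ^ (m + 1) * (t * z) ^ (m + 1)) * t := by
        rw [ht, mul_one]; simp only [mul_assoc]
      _ = z * t := by rw [hsq, ← mul_assoc t t z, ht, one_mul]
  rw [← hkey]
  exact Subgroup.commutator_mem_commutator (P.inv_mem (P.pow_mem hmem _))
    (Subgroup.mem_zpowers t)

/-- **Lemma 2.2.**  Let `G` be finite, `P = O_{2'}(G)` normal of odd order and index `2`,
`t` an involution with `V = [P, ⟨t⟩]` abelian.  If `x ∈ P \ V` then `⟨x x^t⟩ ∩ V = 1` and
`x x^t` centralizes an involution of `G`. -/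
theorem stmt5 {G : Type*} [Group G] [Fintype G] (P : Subgroup G) [P.Normal]
    (hPodd : Odd (Nat.card P)) (hPindex : P.index = 2)
    (t : G) (ht : orderOf t = 2)
    (V : Subgroup G) (hV : V = ⁅P, Subgroup.zpowers t⁆)
    (hVab : ∀ u ∈ V, ∀ v ∈ V, u * v = v * u)
    (x : G) (hx : x ∈ P) (hxV : x ∉ V) :
    Subgroup.zpowers (x * (t⁻¹ * x * t)) ⊓ V = ⊥ ∧
      ∃ z : G, orderOf z = 2 ∧ Commute (x * (t⁻¹ * x * t)) z := by
  subst hV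
  have htt : t * t = 1 := by rw [← pow_two, ← ht, pow_orderOf_eq_one]
  have hti : t⁻¹ = t := inv_eq_of_mul_eq_one_left htt
  have hodd_order : ∀ {g : G}, g ∈ P → g ^ Nat.card P = 1 := fun {g} hg => by
    exact congrArg Subtype.val (pow_card_eq_one' (x := (⟨g, hg⟩ : P)))
  have eq_one_of_sq : ∀ {g : G}, g ∈ P → g * g = 1 → g = 1 := fun {g} hg hgg => by
    obtain ⟨m, hm⟩ := hPodd
    have h := hodd_order hg
    rwa [hm, pow_succ, pow_mul, pow_two, hgg, one_pow, one_mul] at h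
  have htP : t ∉ P := fun h => by
    simp [eq_one_of_sq h htt] at ht
  have hxtP : x * t ∉ P := fun h => htP ((P.mul_mem_cancel_left hx).mp h)
  have hy : x * (t⁻¹ * x * t) = (x * t) ^ 2 := by rw [hti, pow_two]; simp only [mul_assoc]
  have hyP : (x * t) ^ 2 ∈ P := by
    rw [pow_two]; exact Subgroup.mul_self_mem_of_index_two hPindex _
  rw [hy]
  set z := (x * t) ^ Nat.card P with hz
  have hzz : z * z = 1 := by
    rw [hz, ← pow_two, ← pow_mul, mul_comm, pow_mul]
    exact hodd_order hyP
  have hzP : z ∉ P := by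
    obtain ⟨m, hm⟩ := hPodd
    rw [hz, hm, pow_succ, pow_mul]
    exact fun h => hxtP ((P.mul_mem_cancel_left (P.pow_mem hyP m)).mp h)
  have hcomm : Commute ((x * t) ^ 2) z := (Commute.refl (x * t)).pow_pow _ _
  refine ⟨?_, z, orderOf_eq_prime (by rw [pow_two, hzz]) fun h => hzP (h ▸ P.one_mem), hcomm⟩
  have htz : t * z ∈ P := (Subgroup.mul_mem_iff_of_index_two hPindex).mpr (by simp [htP, hzP])
  have hztV := mul_mem_commutator_zpowers_of_odd P hPodd htt hzz htz
  rw [eq_bot_iff]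
  rintro v ⟨hvy, hvV⟩
  obtain ⟨k, rfl⟩ := Subgroup.mem_zpowers_iff.mp hvy
  set v := ((x * t) ^ 2) ^ k
  have hvP : v ∈ P := P.zpow_mem hyP k
  have hzv : Commute z v := (hcomm.zpow_left k).symm
  have htv : Commute t v := by
    have h : Commute (z⁻¹ * (z * t)) v := hzv.inv_left.mul_left (hVab _ hztV _ hvV)
    rwa [inv_mul_cancel_left] at h
  have hinv := conj_eq_inv_of_mem_commutator_zpowers P htt hVab hvV
  rw [htv.eq, mul_inv_cancel_right] at hinv
  exact eq_one_of_sq hvP (mul_eq_one_iff_eq_inv.mpr hinv)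
end

section
/- Let p be a prime, S a finite p-group, and Q an abelian normal subgroup of S. If w ∈ S is such that S is generated by Q together with w, then the conjugacy class w^S of w in S equals the coset wS′, where S′ is the derived (commutator) subgroup of S. -/
section AbelianNormal

variable {S : Type*} [Group S]

/-- The commutators `[w, q]` with `q` in an abelian normal subgroup `Q` form a subgroup. -/
def commutatorsWith (Q : Subgroup S) [hQ : Q.Normal]
    (hQab : ∀ u ∈ Q, ∀ v ∈ Q, u * v = v * u) (w : S) : Subgroup S where
  carrier := {x | ∃ q ∈ Q, x = w⁻¹ * q⁻¹ * w * q}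
  one_mem' := ⟨1, Q.one_mem, by group⟩
  mul_mem' := by
    rintro _ _ ⟨a, ha, rfl⟩ ⟨b, hb, rfl⟩
    refine ⟨b * a, Q.mul_mem hb ha, ?_⟩
    have hb' : w⁻¹ * b⁻¹ * w * b ∈ Q :=
      Q.mul_mem (hQ.conj_mem' _ (Q.inv_mem hb) w) hb
    calc w⁻¹ * a⁻¹ * w * a * (w⁻¹ * b⁻¹ * w * b)
        = w⁻¹ * a⁻¹ * w * (a * (w⁻¹ * b⁻¹ * w * b)) := by group
      _ = w⁻¹ * a⁻¹ * w * ((w⁻¹ * b⁻¹ * w * b) * a) := by rw [hQab a ha _ hb']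
      _ = w⁻¹ * (b * a)⁻¹ * w * (b * a) := by group
  inv_mem' := by
    rintro _ ⟨a, ha, rfl⟩
    refine ⟨a⁻¹, Q.inv_mem ha, ?_⟩
    calc (w⁻¹ * a⁻¹ * w * a)⁻¹ = a⁻¹ * (w⁻¹ * a * w) := by group
      _ = (w⁻¹ * a * w) * a⁻¹ := hQab _ (Q.inv_mem ha) _ (hQ.conj_mem' _ ha w)
      _ = w⁻¹ * a⁻¹⁻¹ * w * a⁻¹ := by group

variable (Q : Subgroup S) [hQ : Q.Normal] (hQab : ∀ u ∈ Q, ∀ v ∈ Q, u * v = v * u) (w : S)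

theorem commutatorsWith_le : commutatorsWith Q hQab w ≤ Q := by
  rintro _ ⟨q, hq, rfl⟩
  exact Q.mul_mem (hQ.conj_mem' _ (Q.inv_mem hq) w) hq

theorem commutatorsWith_normal (hgen : Subgroup.closure ((Q : Set S) ∪ {w}) = ⊤) :
    (commutatorsWith Q hQab w).Normal := by
  rw [← Subgroup.normalizer_eq_top_iff, eq_top_iff, ← hgen, Subgroup.closure_le]
  rintro g (hg | rfl)
  · refine Subgroup.mem_normalizer_iff.2 fun k => ?_
    have key : ∀ u ∈ Q, g * u * g⁻¹ = u := fun u hu => by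
      rw [hQab g hg u hu, mul_inv_cancel_right]
    constructor
    · intro hk
      rwa [key k (commutatorsWith_le Q hQab w hk)]
    · intro hk
      have hkQ : k ∈ Q := by
        simpa [mul_assoc] using hQ.conj_mem' _ (commutatorsWith_le Q hQab w hk) g
      rwa [key k hkQ] at hk
  · refine Subgroup.mem_normalizer_iff.2 fun k => ⟨?_, ?_⟩
    · rintro ⟨q, hq, rfl⟩
      exact ⟨g * q * g⁻¹, hQ.conj_mem _ hq g, by group⟩
    · rintro ⟨q, hq, hk⟩
      refine ⟨g⁻¹ * q * g, hQ.conj_mem' _ hq g, ?_⟩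
      calc k = g⁻¹ * (g * k * g⁻¹) * g := by group
        _ = _ := by rw [hk]; group

theorem commutator_le_commutatorsWith (hgen : Subgroup.closure ((Q : Set S) ∪ {w}) = ⊤) :
    commutator S ≤ commutatorsWith Q hQab w := by
  have hN := commutatorsWith_normal Q hQab w hgen
  have hw : ∀ q ∈ Q, Commute (q : S ⧸ commutatorsWith Q hQab w) w := fun q hq => by
    refine QuotientGroup.eq.2 ⟨q, hq, by group⟩
  have hcomm : ∀ x y : S, Commute (x : S ⧸ commutatorsWith Q hQab w) y := fun x y => by
    have hx : x ∈ Subgroup.closure ((Q : Set S) ∪ {w}) := hgen ▸ Subgroup.mem_top x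
    have hy : y ∈ Subgroup.closure ((Q : Set S) ∪ {w}) := hgen ▸ Subgroup.mem_top y
    induction hx, hy using Subgroup.closure_induction₂ with
    | mem a b ha hb =>
      rcases ha with ha | rfl <;> rcases hb with hb | rfl
      · exact congrArg _ (hQab a ha b hb)
      · exact hw a ha
      · exact (hw b hb).symm
      · exact Commute.refl _
    | one_left => exact Commute.one_left _
    | one_right => exact Commute.one_right _
    | mul_left _ _ _ _ _ _ h₁ h₂ => exact h₁.mul_left h₂
    | mul_right _ _ _ _ _ _ h₁ h₂ => exact h₁.mul_right h₂
    | inv_left _ _ _ _ h => exact h.inv_left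
    | inv_right _ _ _ _ h => exact h.inv_right
  rw [commutator_def, Subgroup.commutator_le]
  intro x _ y _
  rw [← QuotientGroup.eq_one_iff]
  exact commutatorElement_eq_one_iff_commute.2 (hcomm x y)

end AbelianNormal


/-- **Lemma 2.7.**  Let `S` be a finite `p`-group and `Q` an abelian normal subgroup of
`S`.  If `w ∈ S` and `S = Q⟨w⟩`, then `w^S = wS'`. -/
theorem stmt9 {p : ℕ} (hp : p.Prime) {S : Type*} [Group S] [Fintype S]
    (hpS : IsPGroup p S) (Q : Subgroup S) [Q.Normal]
    (hQab : ∀ u ∈ Q, ∀ v ∈ Q, u * v = v * u)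
    (w : S) (hgen : Subgroup.closure ((Q : Set S) ∪ {w}) = ⊤) :
    {x : S | ∃ g : S, x = g⁻¹ * w * g} = {x : S | ∃ v ∈ commutator S, x = w * v} := by
  ext x
  constructor
  · rintro ⟨g, rfl⟩
    exact ⟨_, Subgroup.commutator_mem_commutator (Subgroup.mem_top w⁻¹) (Subgroup.mem_top g⁻¹),
      by rw [commutatorElement_def]; group⟩
  · rintro ⟨v, hv, rfl⟩
    obtain ⟨q, -, rfl⟩ := commutator_le_commutatorsWith Q hQab w hgen hv
    exact ⟨q, by group⟩
end

section
/- Let n ≥ 1, let p be a prime, and let G be a finite group with Sylow p-subgroup S. Suppose Q is a normal elementary abelian p-subgroup of G contained in S which contains every normal p-subgroup of G (so Q = O_p(G)), and that S/Q is cyclic of order pⁿ. Suppose further that there is a normal subgroup K of G with Q ≤ K such that K/Q is abelian of order coprime to p and G = KS (so K/Q is an abelian normal p-complement in G/Q). Assume that for every nontrivial subgroup X of C_Q(S), the centralizer C_G(X) equals S. If w ∈ S has order p^{n+1}, then the set (w^G)² = {uv : u, v ∈ w^G} of products of two G-conjugates of w contains an element whose order is not p^{n+1}. -/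
section NormSums

open Finset Function

variable {H M : Type*} [Group H] [AddCommGroup M] [DistribMulAction H M] {p : ℕ}

theorem exists_fixed_of_smul_mem (hp : p.Prime) (hM : ∀ x : M, p • x = 0) {k : ℕ} {g : H}
    (hg : g ^ p ^ k = 1) {F : AddSubgroup M} (hF : ∀ y ∈ F, g • y ∈ F) {y : M} (hy : y ∈ F)
    (hy0 : y ≠ 0) : ∃ x ∈ F, x ≠ 0 ∧ g • x = x := by
  classical
  let T : AddMonoid.End M := DistribMulAction.toAddMonoidEnd H M g
  let U : AddMonoid.End M := T - 1
  have hU : ∀ x, U x = g • x - x := fun x => rfl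
  have hex : ∃ j, (U ^ j) y = 0 := by
    refine ⟨p ^ k, ?_⟩
    obtain ⟨R, hR⟩ := (Commute.one_right U).exists_add_pow_prime_pow_eq hp k
    have hT : (U + 1) ^ p ^ k = 1 := by
      simp only [U, sub_add_cancel, T, ← map_pow, hg, map_one]
    rw [hT, one_pow, mul_one, mul_assoc] at hR
    have := congrArg (fun f : AddMonoid.End M => f y) hR
    have h2 : (((p : ℕ) : AddMonoid.End M) * (U * R)) y = 0 := by
      rw [← nsmul_eq_mul]
      exact hM ((U * R) y)
    have h3 : (1 : AddMonoid.End M) y = (U ^ p ^ k) y + (1 : AddMonoid.End M) y +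
      (((p : ℕ) : AddMonoid.End M) * (U * R)) y := this
    rw [h2] at h3
    simpa using h3
  have hmem : ∀ j, (U ^ j) y ∈ F := by
    intro j
    induction j with
    | zero => simpa using hy
    | succ j ih =>
      rw [pow_succ']
      exact F.sub_mem (hF _ ih) ih
  have hpos : Nat.find hex ≠ 0 := by
    intro h0
    have := Nat.find_spec hex
    rw [h0] at this
    exact hy0 (by simpa using this)
  obtain ⟨j, hj⟩ := Nat.exists_eq_succ_of_ne_zero hpos
  refine ⟨(U ^ j) y, hmem j, Nat.find_min hex (by omega), ?_⟩
  have := Nat.find_spec hex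
  rw [hj, Nat.succ_eq_add_one, pow_succ'] at this
  exact sub_eq_zero.mp this

theorem sum_smul_eq_zero (hp : p.Prime) (hM : ∀ x : M, p • x = 0) {k : ℕ} {g : H}
    (hg : g ^ p ^ k = 1) (D : Subgroup H) [Fintype D] (hD : ∀ d ∈ D, g⁻¹ * d * g ∈ D)
    (hD1 : D ≠ ⊥) (hfree : ∀ x : M, x ≠ 0 → g • x = x → ∀ d ∈ D, d • x = x → d = 1) (y : M) :
    ∑ d : D, (d : H) • y = 0 := by
  by_contra hne
  let F : AddSubgroup M :=
    { carrier := {x | ∀ d ∈ D, d • x = x}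
      zero_mem' := fun d _ => smul_zero d
      add_mem' := fun {a b} ha hb d hd => by rw [smul_add, ha d hd, hb d hd]
      neg_mem' := fun {a} ha d hd => by rw [smul_neg, ha d hd] }
  have hF : ∀ y ∈ F, g • y ∈ F := by
    intro y hy d hd
    have := hy _ (hD d hd)
    rw [mul_smul, mul_smul, inv_smul_eq_iff] at this
    exact this
  have hmem : ∑ d : D, (d : H) • y ∈ F := by
    intro d hd
    rw [Finset.smul_sum]
    exact Fintype.sum_equiv (Equiv.mulLeft (⟨d, hd⟩ : D)) _ _ (fun x => by simp [mul_smul])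
  obtain ⟨x, hxF, hx0, hgx⟩ := exists_fixed_of_smul_mem hp hM hg hF hmem hne
  exact hD1 ((Subgroup.eq_bot_iff_forall _).mpr fun d hd => hfree x hx0 hgx d hd (hxF d hd))

theorem exists_sum_eq_sum_pow_smul {α : Type*} {f : α → α} {F : α → M} {g : H}
    (hF : ∀ b, F (f b) = g • F b) {N : ℕ} (hN : 0 < N) (T : Finset α) (hT : ∀ b ∈ T, f b ∈ T)
    (hper : ∀ b ∈ T, minimalPeriod f b = N) :
    ∃ m : M, ∑ b ∈ T, F b = ∑ i ∈ range N, g ^ i • m := by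
  classical
  induction T using Finset.strongInduction with
  | H T ih =>
  rcases T.eq_empty_or_nonempty with rfl | ⟨b, hb⟩
  · exact ⟨0, by simp⟩
  set O := (range N).image (fun i => f^[i] b) with hO
  have hOall : ∀ j, f^[j] b ∈ O := by
    intro j
    rw [← iterate_mod_minimalPeriod_eq, hper b hb]
    exact mem_image_of_mem (fun i => f^[i] b) (mem_range.mpr (Nat.mod_lt _ hN))
  have hOT : O ⊆ T := by
    intro t ht
    obtain ⟨i, -, rfl⟩ := mem_image.mp ht
    clear ht
    induction i with
    | zero => exact hb
    | succ i hi =>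
      rw [iterate_succ_apply']
      exact hT _ hi
  have hsub : T \ O ⊂ T := by
    refine (ssubset_iff_of_subset sdiff_subset).mpr ⟨b, hb, ?_⟩
    simpa using fun _ => hOall 0
  obtain ⟨m, hm⟩ := ih (T \ O) hsub (by
    intro t ht
    rw [mem_sdiff] at ht ⊢
    refine ⟨hT t ht.1, fun hmem => ht.2 ?_⟩
    obtain ⟨i, -, hi⟩ := mem_image.mp hmem
    have : f^[N] t = t := by
      rw [← hper t ht.1]; exact iterate_minimalPeriod
    obtain ⟨N', rfl⟩ := Nat.exists_eq_succ_of_ne_zero hN.ne'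
    rw [Nat.succ_eq_add_one, iterate_succ_apply, ← hi, ← iterate_add_apply] at this
    rw [← this]
    exact hOall _) (fun t ht => hper t (mem_sdiff.mp ht).1)
  refine ⟨m + F b, ?_⟩
  rw [← sum_sdiff hOT, hm, hO, sum_image]
  · simp only [smul_add, sum_add_distrib]
    congr 1
    refine sum_congr rfl fun i hi => ?_
    clear hi
    induction i with
    | zero => simp
    | succ i hi => rw [iterate_succ_apply', hF, hi, pow_succ', mul_smul]
  · have := iterate_injOn_Iio_minimalPeriod (f := f) (x := b)
    rw [hper b hb] at this
    simpa using! this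

variable [Finite H]

theorem exists_eq_sum_pow_smul (hp : p.Prime) (hM : ∀ x : M, p • x = 0) {k : ℕ} {g : H}
    (hg : g ^ p ^ (k + 1) = 1) (A : Subgroup H) [A.Normal] (hA : ∀ a ∈ A, ∀ b ∈ A, a * b = b * a)
    (hcop : (Nat.card A).Coprime p)
    (hfree : ∀ x : M, x ≠ 0 → g • x = x → ∀ a ∈ A, a • x = x → a = 1)
    (hfaith : ∃ a ∈ A, g ^ p ^ k * a ≠ a * g ^ p ^ k) {x : M} (hx : g • x = x) :
    ∃ m : M, x = ∑ i ∈ range (p ^ (k + 1)), g ^ i • m := by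
  classical
  have := Fintype.ofFinite H
  set t := g ^ p ^ k with ht
  have htp : t ^ p = 1 := by rw [ht, ← pow_mul, ← pow_succ, hg]
  have htA : ∀ a ∈ A, t * a * t⁻¹ ∈ A := fun a ha => Subgroup.Normal.conj_mem ‹_› a ha t
  have hgt : Commute g t := (Commute.refl g).pow_right _
  let B : Subgroup H :=
    { carrier := {b | ∃ a ∈ A, b = a * (t * a * t⁻¹)⁻¹}
      one_mem' := ⟨1, A.one_mem, by simp⟩
      mul_mem' := by
        rintro _ _ ⟨a, ha, rfl⟩ ⟨b, hb, rfl⟩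
        refine ⟨a * b, A.mul_mem ha hb, ?_⟩
        have h1 := hA _ (A.inv_mem (htA a ha)) b hb
        have h2 := hA _ (A.inv_mem (htA a ha)) _ (A.inv_mem (htA b hb))
        calc a * (t * a * t⁻¹)⁻¹ * (b * (t * b * t⁻¹)⁻¹)
            = a * ((t * a * t⁻¹)⁻¹ * b) * (t * b * t⁻¹)⁻¹ := by group
          _ = a * b * ((t * a * t⁻¹)⁻¹ * (t * b * t⁻¹)⁻¹) := by rw [h1]; group
          _ = _ := by rw [h2]; group
      inv_mem' := by
        rintro _ ⟨a, ha, rfl⟩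
        refine ⟨a⁻¹, A.inv_mem ha, ?_⟩
        have h1 := hA _ (htA a ha) _ (A.inv_mem ha)
        calc (a * (t * a * t⁻¹)⁻¹)⁻¹ = t * a * t⁻¹ * a⁻¹ := by group
          _ = _ := by rw [h1]; group }
  have hBA : B ≤ A := by
    rintro _ ⟨a, ha, rfl⟩
    exact A.mul_mem ha (A.inv_mem (htA a ha))
  have hBconj : ∀ {u : H}, Commute u t → ∀ b ∈ B, u * b * u⁻¹ ∈ B := by
    rintro u hu _ ⟨a, ha, rfl⟩
    refine ⟨u * a * u⁻¹, Subgroup.Normal.conj_mem ‹_› a ha u, ?_⟩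
    have h1 : u * t = t * u := hu
    have h2 : u * t * u⁻¹ = t := by rw [h1]; group
    calc u * (a * (t * a * t⁻¹)⁻¹) * u⁻¹
        = (u * a * u⁻¹) * ((u * t * u⁻¹) * (u * a * u⁻¹) * (u * t * u⁻¹)⁻¹)⁻¹ := by group
      _ = _ := by rw [h2]
  have hB1 : B ≠ ⊥ := by
    obtain ⟨a, ha, hne⟩ := hfaith
    intro hbot
    have : a * (t * a * t⁻¹)⁻¹ ∈ B := ⟨a, ha, rfl⟩
    rw [hbot, Subgroup.mem_bot, mul_inv_eq_one] at this
    apply hne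
    nth_rw 2 [this]
    group
  have hBfix : ∀ b ∈ B, t * b * t⁻¹ = b → b = 1 := by
    rintro b hbB hb
    obtain ⟨a, ha, hba⟩ := hbB
    have hcomm : Commute t b := by
      rw [mul_inv_eq_iff_eq_mul] at hb
      exact hb
    have hiter : ∀ j : ℕ, t ^ j * a * (t ^ j)⁻¹ = (b ^ j)⁻¹ * a := by
      intro j
      induction j with
      | zero => simp
      | succ j ih =>
        have h1 : t * (b ^ j)⁻¹ = (b ^ j)⁻¹ * t := (hcomm.pow_right j).inv_right
        have h2 : t * a * t⁻¹ = b⁻¹ * a := by rw [hba]; group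
        calc t ^ (j + 1) * a * (t ^ (j + 1))⁻¹
            = t * (t ^ j * a * (t ^ j)⁻¹) * t⁻¹ := by rw [pow_succ']; group
          _ = (t * (b ^ j)⁻¹) * a * t⁻¹ := by rw [ih]; group
          _ = (b ^ j)⁻¹ * (t * a * t⁻¹) := by rw [h1]; group
          _ = _ := by rw [h2, pow_succ']; group
    have hbp : b ^ p = 1 := by
      have := hiter p
      rw [htp] at this
      simpa using this
    have hbA : b ∈ A := hba ▸ A.mul_mem ha (A.inv_mem (htA a ha))
    exact orderOf_eq_one_iff.mp
      (Nat.eq_one_of_dvd_coprimes hcop (A.orderOf_dvd_natCard hbA) (orderOf_dvd_of_pow_eq_one hbp))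
  have hsum := sum_smul_eq_zero hp hM hg B
    (fun d hd => by simpa using hBconj hgt.inv_left d hd) hB1
    (fun x hx hgx d hd => hfree x hx hgx d (hBA hd)) x
  let f : H → H := fun b => g * b * g⁻¹
  have hf : ∀ j b, f^[j] b = g ^ j * b * (g ^ j)⁻¹ := by
    intro j b
    induction j with
    | zero => simp
    | succ j ih =>
      rw [iterate_succ_apply', ih, pow_succ']
      simp only [f]
      group
  have : Fact p.Prime := ⟨hp⟩
  obtain ⟨m, hm⟩ := exists_sum_eq_sum_pow_smul (f := f) (F := fun b : H => b • x) (g := g)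
    (fun b => by simp only [f, mul_smul, inv_smul_eq_iff.mpr hx.symm])
    (pow_pos hp.pos (k + 1)) ((univ.filter (· ∈ B)).erase 1)
    (by
      intro b hb
      simp only [mem_erase, mem_filter, mem_univ, true_and, f] at hb ⊢
      refine ⟨fun h => hb.1 ?_, hBconj hgt b hb.2⟩
      rwa [conj_eq_one_iff] at h)
    (by
      intro b hb
      simp only [mem_erase, mem_filter, mem_univ, true_and] at hb
      refine minimalPeriod_eq_prime_pow (fun h => hb.1 (hBfix b hb.2 ?_)) ?_
      · rw [IsPeriodicPt, IsFixedPt, hf] at h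
        exact h
      · rw [IsPeriodicPt, IsFixedPt, hf, hg]
        simp)
  refine ⟨-m, ?_⟩
  simp only [smul_neg, sum_neg_distrib, ← hm]
  have h1 : ∑ b ∈ univ.filter (· ∈ B), b • x = 0 := by
    rw [← hsum]
    exact Finset.sum_subtype _ (by simp) _
  rw [← add_sum_erase _ _ (show (1 : H) ∈ univ.filter (· ∈ B) by simp [B.one_mem]), one_smul] at h1
  exact eq_neg_of_add_eq_zero_left h1

theorem exists_sum_pow_smul_eq (hp : p.Prime) (hM : ∀ x : M, p • x = 0) {k : ℕ} {g : H}
    (hg : g ^ p ^ k = 1) (A : Subgroup H) [A.Normal]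
    (hcop : (Nat.card A).Coprime p)
    (hfree : ∀ x : M, x ≠ 0 → g • x = x → ∀ a ∈ A, a • x = x → a = 1)
    {a : H} (ha : a ∈ A) (hga : g * a ≠ a * g) (m : M) :
    ∃ r : M, ∑ i ∈ range (p ^ k), g ^ i • (a • (r - g • r)) = ∑ i ∈ range (p ^ k), g ^ i • m := by
  classical
  have := Fintype.ofFinite H
  set c := a⁻¹ * g * a with hc
  let P : Subgroup H :=
    { carrier := {h | ∀ x : M, ∃ r s : M, h • x - x = (r - g • r) + (s - c • s)}
      one_mem' := fun x => ⟨0, 0, by simp⟩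
      mul_mem' := by
        intro h h' hh hh' x
        obtain ⟨r, s, e⟩ := hh (h' • x)
        obtain ⟨r', s', e'⟩ := hh' x
        refine ⟨r + r', s + s', ?_⟩
        rw [mul_smul, smul_add, smul_add, ← sub_add_sub_cancel _ (h' • x) x, e, e']
        abel
      inv_mem' := by
        intro h hh x
        obtain ⟨r, s, e⟩ := hh (h⁻¹ • x)
        refine ⟨-r, -s, ?_⟩
        rw [smul_inv_smul] at e
        rw [← neg_sub, e, smul_neg, smul_neg]
        abel }
  have hgP : g ∈ P := fun x => ⟨-x, 0, by simp [sub_eq_add_neg, add_comm]⟩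
  have hcP : c ∈ P := fun x => ⟨0, -x, by simp [sub_eq_add_neg, add_comm]⟩
  have heP : g⁻¹ * c ∈ P := P.mul_mem (P.inv_mem hgP) hcP
  have heA : g⁻¹ * c ∈ A := by
    have h1 : g⁻¹ * c = (g⁻¹ * a⁻¹ * g) * a := by rw [hc]; group
    rw [h1]
    exact A.mul_mem (Subgroup.Normal.conj_mem' ‹_› _ (A.inv_mem ha) g) ha
  have hD1 : P ⊓ A ≠ ⊥ := by
    intro hbot
    have h1 : g⁻¹ * c ∈ P ⊓ A := ⟨heP, heA⟩
    rw [hbot, Subgroup.mem_bot, inv_mul_eq_one, hc] at h1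
    apply hga
    nth_rw 2 [h1]
    group
  have hsum := sum_smul_eq_zero hp hM hg (P ⊓ A)
    (fun d hd => ⟨P.mul_mem (P.mul_mem (P.inv_mem hgP) hd.1) hgP,
      Subgroup.Normal.conj_mem' ‹_› _ hd.2 g⟩) hD1
    (fun x hx hgx d hd => hfree x hx hgx d hd.2) (a⁻¹ • m)
  have hdec : ∃ r s : M, a⁻¹ • m = (r - g • r) + (s - c • s) := by
    set y := a⁻¹ • m
    have hcopD : (Nat.card (P ⊓ A : Subgroup H)).Coprime p :=
      hcop.coprime_dvd_left (Subgroup.card_dvd_of_le inf_le_right)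
    choose r s hrs using fun d : (P ⊓ A : Subgroup H) => d.2.1 y
    have h1 : ∑ d : (P ⊓ A : Subgroup H), ((d : H) • y - y) =
        (∑ d, r d - g • ∑ d, r d) + (∑ d, s d - c • ∑ d, s d) := by
      simp only [hrs, sum_add_distrib, sum_sub_distrib, smul_sum]
    rw [sum_sub_distrib, hsum, sum_const, card_univ, ← Nat.card_eq_fintype_card, zero_sub] at h1
    have hbez := Nat.gcd_eq_gcd_ab (Nat.card (P ⊓ A : Subgroup H)) p
    rw [hcopD.gcd_eq_one] at hbez
    set e := Nat.card (P ⊓ A : Subgroup H)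
    have hy : y = Nat.gcdA e p • ((e : ℤ) • y) + Nat.gcdB e p • ((p : ℤ) • y) := by
      rw [smul_smul, smul_smul, ← add_smul, mul_comm, mul_comm (Nat.gcdB e p), ← hbez]
      simp
    rw [natCast_zsmul, natCast_zsmul, hM, smul_zero, add_zero, ← neg_neg (e • y), h1] at hy
    refine ⟨-(Nat.gcdA e p • ∑ d, r d), -(Nat.gcdA e p • ∑ d, s d), hy.trans ?_⟩
    simp only [smul_neg, smul_add, smul_sub, smul_comm g (Nat.gcdA e p),
      smul_comm c (Nat.gcdA e p)]
    abel
  obtain ⟨r, s, hrs⟩ := hdec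
  have hnorm : ∀ v : M, ∑ i ∈ range (p ^ k), g ^ i • (v - g • v) = 0 := by
    intro v
    have : ∀ i, g ^ i • (v - g • v) = g ^ i • v - g ^ (i + 1) • v := fun i => by
      rw [smul_sub, pow_succ, mul_smul]
    simp only [this, sum_range_sub', hg, pow_zero, sub_self]
  refine ⟨r, ?_⟩
  have hm : m = a • (r - g • r) + (a • s - g • a • s) := by
    rw [← smul_inv_smul a m, hrs, smul_add, smul_sub a s, hc]
    congr 2
    rw [← mul_smul, ← mul_smul]
    congr 1
    group
  conv_rhs => rw [hm]
  simp only [smul_add _ (a • (r - g • r)), sum_add_distrib, hnorm, add_zero]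

end NormSums

section QuotientAction

open scoped IsMulCommutative

variable {G : Type*} [Group G] (Q : Subgroup G) [Q.Normal] [IsMulCommutative Q]

/-- Conjugation of a commutative normal subgroup `Q` as an action of the quotient by `Q`. -/
def quotientConj : G ⧸ Q →* MulAut Q :=
  QuotientGroup.lift Q MulAut.conjNormal fun u hu => by
    ext v
    have h : (⟨u, hu⟩ : Q) * v = v * ⟨u, hu⟩ := mul_comm' _ _
    have huv : u * (v : G) = v * u := congrArg Subtype.val h
    simp [MulAut.conjNormal_apply, huv]

/-- The additive form of the conjugation action of `G ⧸ Q` on `Q`. -/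
abbrev quotientConjAction : DistribMulAction (G ⧸ Q) (Additive Q) where
  smul h y := Additive.ofMul (quotientConj Q h y.toMul)
  one_smul y := by
    change Additive.ofMul (quotientConj Q 1 y.toMul) = y
    rw [map_one]
    rfl
  mul_smul h h' y := by
    change Additive.ofMul (quotientConj Q (h * h') y.toMul) = _
    rw [map_mul]
    rfl
  smul_zero h := map_one (quotientConj Q h)
  smul_add h y y' := map_mul (quotientConj Q h) y.toMul y'.toMul

attribute [local instance] quotientConjAction

theorem coe_toMul_mk_smul (h : G) (y : Additive Q) :
    ((((h : G ⧸ Q) • y).toMul : Q) : G) = h * (y.toMul : Q) * h⁻¹ := rfl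

theorem toMul_mul_pow (h : G) (y : Additive Q) (k : ℕ) :
    (((y.toMul : Q) : G) * h) ^ k =
      (((∑ i ∈ Finset.range k, (h : G ⧸ Q) ^ i • y).toMul : Q) : G) * h ^ k := by
  induction k with
  | zero => simp
  | succ k ih =>
    have h1 : ∑ i ∈ Finset.range (k + 1), (h : G ⧸ Q) ^ i • y =
        y + (h : G ⧸ Q) • ∑ i ∈ Finset.range k, (h : G ⧸ Q) ^ i • y := by
      rw [Finset.sum_range_succ', Finset.smul_sum, add_comm]
      simp [pow_succ', mul_smul]
    rw [pow_succ', ih, h1, toMul_add, Subgroup.coe_mul, coe_toMul_mk_smul, pow_succ']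
    group

theorem exists_isConj_mul_pow_eq_one [Finite G] {p : ℕ} (hp : p.Prime) (hodd : p ≠ 2) {k : ℕ}
    (hQp : ∀ u ∈ Q, u ^ p = 1) {w : G} (hw : w ^ p ^ (k + 1) ∈ Q) (A : Subgroup (G ⧸ Q)) [A.Normal]
    (hA : ∀ a ∈ A, ∀ b ∈ A, a * b = b * a) (hcop : (Nat.card A).Coprime p)
    (hfree : ∀ x ∈ Q, x ≠ 1 → Commute w x → ∀ a : G, (a : G ⧸ Q) ∈ A → Commute a x → a ∈ Q)
    (hfaith : ∃ a ∈ A, (w : G ⧸ Q) ^ p ^ k * a ≠ a * (w : G ⧸ Q) ^ p ^ k) :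
    ∃ u v : G, IsConj w u ∧ IsConj w v ∧ (u * v) ^ p ^ (k + 1) = 1 := by
  have hM : ∀ x : Additive Q, p • x = 0 := fun x => by
    apply Additive.toMul.injective
    apply Subtype.ext
    exact hQp _ x.toMul.2
  set c : G ⧸ Q := (w : G ⧸ Q) with hc
  set g : G ⧸ Q := ((w ^ 2 : G) : G ⧸ Q) with hg
  have hgc : g = c ^ 2 := rfl
  have hcN : c ^ p ^ (k + 1) = 1 := (QuotientGroup.eq_one_iff (w ^ p ^ (k + 1))).mpr hw
  have hgN : g ^ p ^ (k + 1) = 1 := by rw [hgc, ← pow_mul, mul_comm, pow_mul, hcN, one_pow]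
  obtain ⟨l, hl⟩ : Odd (p ^ (k + 1)) := (hp.odd_of_ne_two hodd).pow
  have hcg : c = g ^ (l + 1) := by
    rw [hgc, ← pow_mul, show 2 * (l + 1) = p ^ (k + 1) + 1 by omega, pow_succ, hcN, one_mul]
  have hfree' : ∀ x : Additive Q, x ≠ 0 → g • x = x → ∀ a ∈ A, a • x = x → a = 1 := by
    intro x hx hgx a ha hax
    have hcx : c • x = x := by
      rw [hcg]
      generalize l + 1 = j
      induction j with
      | zero => simp
      | succ j ih => rw [pow_succ, mul_smul, hgx, ih]
    have hcomm : ∀ h : G, (h : G ⧸ Q) • x = x → Commute h ((x.toMul : Q) : G) := by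
      intro h hh
      have := congrArg (fun y : Additive Q => ((y.toMul : Q) : G)) hh
      simp only [coe_toMul_mk_smul] at this
      exact mul_inv_eq_iff_eq_mul.mp this
    obtain ⟨a, rfl⟩ := QuotientGroup.mk_surjective a
    refine (QuotientGroup.eq_one_iff a).mpr
      (hfree _ x.toMul.2 (fun h => hx ?_) (hcomm w hcx) a ha (hcomm a hax))
    apply Additive.toMul.injective
    exact Subtype.ext h
  have hcommute : ∀ {a : G ⧸ Q} (j : ℕ), c ^ j * a ≠ a * c ^ j → g ^ j * a ≠ a * g ^ j := by
    intro a j hne h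
    apply hne
    have h1 : Commute ((g ^ j) ^ (l + 1)) a := Commute.pow_left h _
    rw [← pow_mul, mul_comm, pow_mul, ← hcg] at h1
    exact h1
  obtain ⟨a, ha, hca⟩ := hfaith
  have hga : g * a ≠ a * g := by
    intro h
    exact hcommute _ hca (Commute.pow_left h _)
  obtain ⟨a, rfl⟩ := QuotientGroup.mk_surjective a
  have hgfaith : ∃ a ∈ A, g ^ p ^ k * a ≠ a * g ^ p ^ k := ⟨_, ha, hcommute _ hca⟩
  -- the `p ^ (k + 1)`-th power of `w ^ 2` is a norm
  let z : Additive Q := Additive.ofMul ⟨(w ^ 2) ^ p ^ (k + 1), by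
    rw [← pow_mul, mul_comm, pow_mul]; exact Q.pow_mem hw 2⟩
  have hz : g • z = z := by
    apply Additive.toMul.injective
    apply Subtype.ext
    rw [hg, coe_toMul_mk_smul]
    change w ^ 2 * (w ^ 2) ^ p ^ (k + 1) * (w ^ 2)⁻¹ = (w ^ 2) ^ p ^ (k + 1)
    rw [← pow_succ', pow_succ, mul_inv_cancel_right]
  obtain ⟨z', hz'⟩ := exists_eq_sum_pow_smul hp hM hgN A hA hcop hfree' hgfaith hz
  have hq : a * w * a⁻¹ * w⁻¹ * a⁻¹ * w * a * w * (w ^ 2)⁻¹ ∈ Q := by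
    have hwa : (w : G ⧸ Q) * a * (w : G ⧸ Q)⁻¹ ∈ A := Subgroup.Normal.conj_mem ‹_› _ ha _
    have hcm := hA _ (A.inv_mem hwa) _ (A.inv_mem ha)
    rw [← QuotientGroup.eq_one_iff]
    calc (a : G ⧸ Q) * w * (a : G ⧸ Q)⁻¹ * (w : G ⧸ Q)⁻¹ * (a : G ⧸ Q)⁻¹ * w * a * w *
          ((w : G ⧸ Q) ^ 2)⁻¹
        = a * (((w : G ⧸ Q) * a * (w : G ⧸ Q)⁻¹)⁻¹ * (a : G ⧸ Q)⁻¹) *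
          ((w : G ⧸ Q) * a * (w : G ⧸ Q)⁻¹) := by group
      _ = 1 := by rw [hcm]; group
  let q : Additive Q := Additive.ofMul ⟨_, hq⟩
  obtain ⟨r, hr⟩ := exists_sum_pow_smul_eq hp hM hgN A hcop hfree' ha hga (-(q + z'))
  let s : Additive Q := r + c • r
  have hs : s - c • s = r - g • r := by
    simp only [s, hgc, pow_two, mul_smul, smul_add]
    abel
  let t : G := (s.toMul : Q)
  refine ⟨(a * t) * w * (a * t)⁻¹, (w⁻¹ * a⁻¹ * w) * w * (w⁻¹ * a⁻¹ * w)⁻¹,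
    isConj_iff.mpr ⟨_, rfl⟩, isConj_iff.mpr ⟨_, rfl⟩, ?_⟩
  have hprod : (a * t) * w * (a * t)⁻¹ * ((w⁻¹ * a⁻¹ * w) * w * (w⁻¹ * a⁻¹ * w)⁻¹) =
      ((((a : G ⧸ Q) • (s - c • s) + q).toMul : Q) : G) * w ^ 2 := by
    have h1 : (((s - c • s).toMul : Q) : G) = t * (w * t * w⁻¹)⁻¹ := by
      rw [sub_eq_add_neg]; rfl
    rw [toMul_add, Subgroup.coe_mul, coe_toMul_mk_smul, h1]
    change _ = _ * (a * w * a⁻¹ * w⁻¹ * a⁻¹ * w * a * w * (w ^ 2)⁻¹) * w ^ 2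
    group
  have hsum : ∑ i ∈ Finset.range (p ^ (k + 1)), g ^ i • ((a : G ⧸ Q) • (s - c • s) + q) + z = 0 := by
    simp only [hs, smul_add _ ((a : G ⧸ Q) • (r - g • r)), Finset.sum_add_distrib, hr, hz']
    simp only [smul_neg, smul_add, Finset.sum_neg_distrib, Finset.sum_add_distrib]
    abel
  rw [hprod, toMul_mul_pow]
  exact congrArg (fun y : Additive Q => ((y.toMul : Q) : G)) hsum

end QuotientAction

theorem mem_of_pow_mem_of_coprime {G : Type*} [Group G] {Q : Subgroup G} {x : G} {i j : ℕ}
    (hij : i.Coprime j) (hi : x ^ i ∈ Q) (hj : x ^ j ∈ Q) : x ∈ Q := by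
  have h := Nat.gcd_eq_gcd_ab i j
  rw [hij.gcd_eq_one] at h
  rw [← zpow_one x, ← Nat.cast_one, h, zpow_add, zpow_mul, zpow_mul, zpow_natCast, zpow_natCast]
  exact Q.mul_mem (Q.zpow_mem hi _) (Q.zpow_mem hj _)

theorem mk_pow_eq_one_iff_pow_mem {G : Type*} [Group G] {Q K : Subgroup G} [Q.Normal] {x : K}
    {j : ℕ} : (x : K ⧸ Q.subgroupOf K) ^ j = 1 ↔ (x : G) ^ j ∈ Q := by
  rw [← QuotientGroup.mk_pow, QuotientGroup.eq_one_iff]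
  rfl

/-- **Proposition 2.9.**  Let `n ≥ 1`, `p` prime, `S ∈ Syl_p(G)`, `Q = O_p(G)` elementary
abelian with `S/Q` cyclic of order `pⁿ` and with an abelian normal `p`-complement `K/Q` in
`G/Q`.  Assume `C_G(X) = S` for every nontrivial `X ≤ C_Q(S)`.  If `w ∈ S` has order
`p^{n+1}` then `(w^G)²` contains elements which do not have order `p^{n+1}`. -/
theorem stmt10 {G : Type*} [Group G] [Fintype G] {p : ℕ} [Fact p.Prime] {n : ℕ}
    (hn : 1 ≤ n) (S : Sylow p G) (Q : Subgroup G) [Q.Normal]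
    (hQS : Q ≤ S)
    (hQab : ∀ u ∈ Q, ∀ v ∈ Q, u * v = v * u)
    (hQelem : ∀ u ∈ Q, u ≠ 1 → orderOf u = p)
    (hQmax : ∀ R : Subgroup G, R.Normal → IsPGroup p R → R ≤ Q)
    (hScyc : IsCyclic ((S : Subgroup G) ⧸ Q.subgroupOf (S : Subgroup G)))
    (hScard : Nat.card ((S : Subgroup G) ⧸ Q.subgroupOf (S : Subgroup G)) = p ^ n)
    (K : Subgroup G) (hKnormal : K.Normal) (hQK : Q ≤ K)
    (hKab : ∀ u v : K ⧸ Q.subgroupOf K, u * v = v * u)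
    (hKcop : Nat.Coprime (Nat.card (K ⧸ Q.subgroupOf K)) p)
    (hKS : ∀ g : G, ∃ k ∈ K, ∃ s ∈ (S : Subgroup G), g = k * s)
    (hcent : ∀ X : Subgroup G, X ≠ ⊥ →
      X ≤ Q ⊓ Subgroup.centralizer ((S : Subgroup G) : Set G) →
      Subgroup.centralizer (X : Set G) = (S : Subgroup G))
    (w : G) (hwS : w ∈ (S : Subgroup G)) (hw : orderOf w = p ^ (n + 1)) :
    ∃ u v : G, IsConj w u ∧ IsConj w v ∧ orderOf (u * v) ≠ p ^ (n + 1) := by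
  have hp : p.Prime := Fact.out
  obtain ⟨k, rfl⟩ := Nat.exists_eq_add_of_le' hn
  have hord : ∀ x : G, x ^ p ^ (k + 1) = 1 → orderOf x ≠ p ^ (k + 1 + 1) := fun x hx h => by
    have h1 := orderOf_dvd_of_pow_eq_one hx
    rw [h, Nat.pow_dvd_pow_iff_le_right hp.one_lt] at h1
    omega
  rcases eq_or_ne p 2 with rfl | hodd
  · refine ⟨w, w, IsConj.refl w, IsConj.refl w, hord _ ?_⟩
    rw [← pow_two, ← pow_mul, ← pow_succ', ← hw, pow_orderOf_eq_one]
  have : IsMulCommutative Q := ⟨⟨fun u v => Subtype.ext (hQab u u.2 v v.2)⟩⟩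
  have hQp : ∀ u ∈ Q, u ^ p = 1 := fun u hu => by
    by_cases h : u = 1
    · rw [h, one_pow]
    · rw [← hQelem u hu h, pow_orderOf_eq_one]
  have hSpow : ∀ s ∈ (S : Subgroup G), s ^ p ^ (k + 1) ∈ Q := fun s hs =>
    mk_pow_eq_one_iff_pow_mem (x := ⟨s, hs⟩).mp (by rw [← hScard, pow_card_eq_one'])
  have hKpow : ∀ x ∈ K, x ^ Nat.card (K ⧸ Q.subgroupOf K) ∈ Q := fun x hx =>
    mk_pow_eq_one_iff_pow_mem (x := ⟨x, hx⟩).mp pow_card_eq_one'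
  have hSK : ∀ x ∈ K, x ∈ (S : Subgroup G) → x ∈ Q := fun x hxK hxS =>
    mem_of_pow_mem_of_coprime (hKcop.pow_right (k + 1)) (hKpow x hxK) (hSpow x hxS)
  have hwk : w ^ p ^ k ∉ Q := fun h => by
    refine hord w ?_ hw
    rw [pow_succ, pow_mul, hQp _ h]
  have hSgen : ∀ s ∈ (S : Subgroup G), ∃ i : ℕ, ∃ u ∈ Q, s = w ^ i * u := fun s hs => by
    have h1 : orderOf ((⟨w, hwS⟩ : (S : Subgroup G)) : (S : Subgroup G) ⧸ Q.subgroupOf S) =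
        p ^ (k + 1) := orderOf_eq_prime_pow
      (fun h => hwk (mk_pow_eq_one_iff_pow_mem.mp h))
      (by rw [← hScard, pow_card_eq_one'])
    have htop := Subgroup.eq_top_of_card_eq _
      ((Nat.card_zpowers _).trans (h1.trans hScard.symm))
    obtain ⟨i, hi⟩ := mem_powers_iff_mem_zpowers.mpr (htop ▸ Subgroup.mem_top
      ((⟨s, hs⟩ : (S : Subgroup G)) : (S : Subgroup G) ⧸ Q.subgroupOf S))
    have h3 : (⟨w, hwS⟩ ^ i : (S : Subgroup G))⁻¹ * ⟨s, hs⟩ ∈ Q.subgroupOf S :=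
      QuotientGroup.eq.mp hi
    exact ⟨i, (w ^ i)⁻¹ * s, h3, by group⟩
  let A : Subgroup (G ⧸ Q) := K.map (QuotientGroup.mk' Q)
  have : A.Normal := hKnormal.map _ (QuotientGroup.mk'_surjective Q)
  have hmemA : ∀ a : G, (a : G ⧸ Q) ∈ A → a ∈ K := by
    rintro a ⟨b, hb, hab⟩
    have h1 : b⁻¹ * a ∈ Q := QuotientGroup.eq.mp hab
    simpa using K.mul_mem hb (hQK h1)
  have hA : ∀ a ∈ A, ∀ b ∈ A, a * b = b * a := by
    rintro _ ⟨a, ha, rfl⟩ _ ⟨b, hb, rfl⟩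
    have h1 : (((⟨a, ha⟩ * ⟨b, hb⟩ : K)) : K ⧸ Q.subgroupOf K) = ((⟨b, hb⟩ * ⟨a, ha⟩ : K)) := by
      rw [QuotientGroup.mk_mul, QuotientGroup.mk_mul]
      exact hKab _ _
    have h2 : (⟨a, ha⟩ * ⟨b, hb⟩ : K)⁻¹ * (⟨b, hb⟩ * ⟨a, ha⟩) ∈ Q.subgroupOf K :=
      QuotientGroup.eq.mp h1
    exact QuotientGroup.eq.mpr h2
  have hcop : (Nat.card A).Coprime p := by
    have hker : ((QuotientGroup.mk' Q).subgroupMap K).ker = Q.subgroupOf K := by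
      ext x
      simp [MonoidHom.mem_ker, Subtype.ext_iff, Subgroup.mem_subgroupOf]
    have h1 := Subgroup.index_ker ((QuotientGroup.mk' Q).subgroupMap K)
    rw [hker, MonoidHom.range_eq_top.mpr ((QuotientGroup.mk' Q).subgroupMap_surjective K),
      Subgroup.card_top] at h1
    rw [← h1]
    exact hKcop
  have hfree : ∀ x ∈ Q, x ≠ 1 → Commute w x → ∀ a : G, (a : G ⧸ Q) ∈ A → Commute a x → a ∈ Q := by
    intro x hx hx1 hwx a ha hax
    refine hSK a (hmemA a ha) ?_
    have h1 : Subgroup.zpowers x ≤ Q ⊓ Subgroup.centralizer ((S : Subgroup G) : Set G) := by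
      rw [Subgroup.zpowers_le]
      refine ⟨hx, Subgroup.mem_centralizer_iff.mpr ?_⟩
      intro s hs
      obtain ⟨i, u, hu, rfl⟩ := hSgen s hs
      exact (hwx.pow_left i).mul_left (hQab u hu x hx)
    rw [← hcent _ (by simpa using hx1) h1, Subgroup.mem_centralizer_iff]
    rintro _ ⟨j, rfl⟩
    exact (hax.symm.zpow_left j)
  have hfaith : ∃ a ∈ A, (w : G ⧸ Q) ^ p ^ k * a ≠ a * (w : G ⧸ Q) ^ p ^ k := by
    by_contra! hcon
    let t : G ⧸ Q := (w : G ⧸ Q) ^ p ^ k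
    have hcentral : ∀ y : G ⧸ Q, Commute t y := by
      intro y
      obtain ⟨y, rfl⟩ := QuotientGroup.mk_surjective y
      obtain ⟨x, hx, s, hs, rfl⟩ := hKS y
      obtain ⟨i, u, hu, rfl⟩ := hSgen s hs
      have h1 : ((x * (w ^ i * u) : G) : G ⧸ Q) = x * (w : G ⧸ Q) ^ i := by
        rw [QuotientGroup.mk_mul, QuotientGroup.mk_mul, (QuotientGroup.eq_one_iff u).mpr hu,
          mul_one, QuotientGroup.mk_pow]
      rw [h1]
      exact Commute.mul_right (hcon _ ⟨x, hx, rfl⟩) ((Commute.refl (w : G ⧸ Q)).pow_pow _ _)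
    have hnorm : (Subgroup.zpowers t).Normal := by
      refine ⟨?_⟩
      rintro _ ⟨j, rfl⟩ y
      refine ⟨j, ?_⟩
      change t ^ j = y * t ^ j * y⁻¹
      rw [← ((hcentral y).zpow_left j).eq, mul_inv_cancel_right]
    have hle : (Subgroup.zpowers t).comap (QuotientGroup.mk' Q) ≤ S := by
      rintro y ⟨j, hj⟩
      have h1 : (((w ^ p ^ k) ^ j : G) : G ⧸ Q) = y := hj
      have h2 := QuotientGroup.eq.mp h1
      simpa using Subgroup.mul_mem _ (Subgroup.zpow_mem _ (Subgroup.pow_mem _ hwS (p ^ k)) j)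
        (hQS h2)
    exact hwk (hQmax _ (hnorm.comap _) (S.isPGroup'.to_le hle) ⟨1, by simp [t]⟩)
  obtain ⟨u, v, hu, hv, huv⟩ :=
    exists_isConj_mul_pow_eq_one Q hp hodd hQp (hSpow w hwS) A hA hcop hfree hfaith
  exact ⟨u, v, hu, hv, hord _ huv⟩
end

section
/- Let G be a finite group and let a, b, c be nontrivial elements of G. Then the product set a^G · b^G = {uv : u ∈ a^G, v ∈ b^G} of the conjugacy classes of a and b equals the conjugacy class c^G if and only if χ(a)·χ(b) = χ(c)·χ(1) for every character χ of an irreducible finite-dimensional complex representation of G. -/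
section

open CategoryTheory Module Representation
open scoped MonoidAlgebra

/-- The sum of the conjugates `h * a * h⁻¹` over `h : G`, as an element of the group algebra. -/
noncomputable def conjSum {G : Type} [Group G] [Fintype G] (a : G) : ℂ[G] :=
  ∑ h : G, MonoidAlgebra.single (h * a * h⁻¹) 1

variable {G : Type} [Group G]

theorem mem_invariants_linHom_iff {V : Type} [AddCommGroup V] [Module ℂ V]
    (ρ : Representation ℂ G V) (f : V →ₗ[ℂ] V) :
    f ∈ (linHom ρ ρ).invariants ↔ ∀ g, f ∘ₗ ρ g = ρ g ∘ₗ f := by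
  refine forall_congr' fun g => ?_
  simp only [linHom_apply, LinearMap.ext_iff, LinearMap.comp_apply]
  refine ⟨fun h v => ?_, fun h v => ?_⟩
  · simpa using (h (ρ g v)).symm
  · simp [← h]

/-- A simple `ℂ[G]`-module of finite dimension gives a simple object of `FDRep ℂ G`. -/
theorem FDRep.simple_of_isSimpleModule [Finite G] (S : Type) [AddCommGroup S] [Module ℂ S]
    [Module ℂ[G] S] [IsScalarTower ℂ ℂ[G] S] [Module.Finite ℂ S] [IsSimpleModule ℂ[G] S] :
    Simple (FDRep.of (ofModule' (k := ℂ) (G := G) S)) := by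
  rw [FDRep.simple_iff_end_is_rank_one,
    ← (linHom.invariantsEquivFDRepHom (FDRep.of (ofModule' (k := ℂ) (G := G) S))
      (FDRep.of (ofModule' (k := ℂ) (G := G) S))).finrank_eq, finrank_eq_one_iff']
  have : Nontrivial S := IsSimpleModule.nontrivial ℂ[G] S
  have hcomm (f : S →ₗ[ℂ] S) :
      f ∈ (linHom (ofModule' (k := ℂ) (G := G) S) (ofModule' S)).invariants ↔
        ∀ (g : G) (v : S), f (MonoidAlgebra.single g (1 : ℂ) • v) =
          MonoidAlgebra.single g (1 : ℂ) • f v :=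
    (mem_invariants_linHom_iff _ f).trans
      (forall_congr' fun g => by simp [LinearMap.ext_iff, ofModule'])
  refine ⟨⟨LinearMap.id, (hcomm _).2 fun _ _ => rfl⟩, ?_, ?_⟩
  · intro h
    obtain ⟨v, hv⟩ := exists_ne (0 : S)
    exact hv (LinearMap.congr_fun (congrArg Subtype.val h) v)
  · rintro ⟨f, hf⟩
    obtain ⟨c, hc⟩ := (IsSimpleModule.algebraMap_end_bijective_of_isAlgClosed
      (A := ℂ[G]) (V := S) ℂ).2 (MonoidAlgebra.equivariantOfLinearOfComm f ((hcomm f).1 hf))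
    exact ⟨c, Subtype.ext (LinearMap.ext fun v => LinearMap.congr_fun hc v)⟩

/-- An element of the group algebra acting as zero on every irreducible representation is zero. -/
theorem eq_zero_of_forall_simple_asAlgebraHom_eq_zero [Finite G] (z : ℂ[G])
    (hz : ∀ V : FDRep ℂ G, Simple V → asAlgebraHom V.ρ z = 0) : z = 0 := by
  suffices z ∈ Module.annihilator ℂ[G] ℂ[G] by
    simpa using Module.mem_annihilator.1 this 1
  rw [← Submodule.annihilator_top, ← IsSemisimpleModule.sSup_simples_eq_top, sSup_eq_iSup',
    Submodule.annihilator_iSup, Submodule.mem_iInf]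
  rintro ⟨S, hS⟩
  have : IsSimpleModule ℂ[G] S := hS
  have : Module.Finite ℂ S := Module.Finite.of_injective
    (S.subtype.restrictScalars ℂ) Subtype.val_injective
  have h := hz _ (FDRep.simple_of_isSimpleModule (G := G) S)
  refine Module.mem_annihilator.2 fun v => ?_
  have key : asAlgebraHom (ofModule' (k := ℂ) (G := G) S) z v = z • v := by
    simp [asAlgebraHom, ofModule']
  rw [← key]
  exact LinearMap.congr_fun h v

variable [Fintype G]

theorem asAlgebraHom_conjSum (V : FDRep ℂ G) (a : G) :
    asAlgebraHom V.ρ (conjSum a) = ∑ h : G, V.ρ (h * a * h⁻¹) := by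
  simp [conjSum]

theorem trace_asAlgebraHom_conjSum (V : FDRep ℂ G) (a : G) :
    LinearMap.trace ℂ V (asAlgebraHom V.ρ (conjSum a)) = Fintype.card G * V.character a := by
  have h (g : G) : LinearMap.trace ℂ V (V.ρ (g * a * g⁻¹)) = V.character a := V.char_conj a g
  simp only [asAlgebraHom_conjSum, map_sum, h, Finset.sum_const, Finset.card_univ, nsmul_eq_mul]

theorem trace_asAlgebraHom_conjSum_mul (V : FDRep ℂ G) (a b : G) :
    LinearMap.trace ℂ V (asAlgebraHom V.ρ (conjSum a * conjSum b)) =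
      ∑ g : G, ∑ h : G, V.character ((g * a * g⁻¹) * (h * b * h⁻¹)) := by
  simp [conjSum, Finset.sum_mul_sum, MonoidAlgebra.single_mul_single, FDRep.character]

theorem FDRep.finrank_invariants_linHom_self (V : FDRep ℂ G) [Simple V] :
    finrank ℂ (linHom V.ρ V.ρ).invariants = 1 :=
  (linHom.invariantsEquivFDRepHom V V).finrank_eq.trans
    ((FDRep.simple_iff_end_is_rank_one V).1 ‹_›)

theorem FDRep.character_one_ne_zero (V : FDRep ℂ G) [Simple V] : V.character 1 ≠ 0 := by
  intro h
  have : Subsingleton V := by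
    rw [← finrank_zero_iff (R := ℂ)]
    simpa using h
  have h1 := V.finrank_invariants_linHom_self
  rw [finrank_zero_of_subsingleton] at h1
  exact zero_ne_one h1

theorem conjSum_action_mem_invariants (V : FDRep ℂ G) (a : G) :
    asAlgebraHom V.ρ (conjSum a) ∈ (linHom V.ρ V.ρ).invariants := by
  rw [mem_invariants_linHom_iff]
  intro g
  simp only [asAlgebraHom_conjSum, ← Module.End.mul_eq_comp, Finset.sum_mul, Finset.mul_sum,
    ← map_mul]
  refine (Fintype.sum_equiv (Equiv.mulLeft g) _ _ fun h => ?_).symm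
  simp [mul_assoc]

/-- Schur's lemma for the action of a conjugacy class sum. -/
theorem exists_asAlgebraHom_conjSum_eq_smul (V : FDRep ℂ G) [Simple V] (a : G) :
    ∃ c : ℂ, asAlgebraHom V.ρ (conjSum a) = c • LinearMap.id ∧
      Fintype.card G * V.character a = c * V.character 1 := by
  have hid : LinearMap.id ∈ (linHom V.ρ V.ρ).invariants :=
    (mem_invariants_linHom_iff _ _).2 fun _ => rfl
  have hne : (⟨LinearMap.id, hid⟩ : (linHom V.ρ V.ρ).invariants) ≠ 0 := by
    intro h
    have h0 : (LinearMap.id : V →ₗ[ℂ] V) = 0 := congrArg Subtype.val h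
    refine V.character_one_ne_zero ?_
    rw [FDRep.character, map_one, Module.End.one_eq_id, h0, map_zero]
  obtain ⟨c, hc⟩ := (finrank_eq_one_iff_of_nonzero' _ hne).1 V.finrank_invariants_linHom_self
    ⟨_, conjSum_action_mem_invariants V a⟩
  have hc' : asAlgebraHom V.ρ (conjSum a) = c • LinearMap.id := (congrArg Subtype.val hc).symm
  refine ⟨c, hc', ?_⟩
  rw [← trace_asAlgebraHom_conjSum, hc', map_smul, smul_eq_mul, FDRep.character, map_one,
    Module.End.one_eq_id]

/-- If the irreducible characters satisfy `χ(a)χ(b) = χ(c)χ(1)`, the class sums multiply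
accordingly in the group algebra. -/
theorem conjSum_mul_conjSum_of_character (a b c : G)
    (h : ∀ V : FDRep ℂ G, Simple V →
      V.character a * V.character b = V.character c * V.character 1) :
    conjSum a * conjSum b = (Fintype.card G : ℂ) • conjSum c := by
  rw [← sub_eq_zero]
  refine eq_zero_of_forall_simple_asAlgebraHom_eq_zero _ fun V hV => ?_
  obtain ⟨x, hx, hxa⟩ := exists_asAlgebraHom_conjSum_eq_smul V a
  obtain ⟨y, hy, hyb⟩ := exists_asAlgebraHom_conjSum_eq_smul V b
  obtain ⟨w, hw, hwc⟩ := exists_asAlgebraHom_conjSum_eq_smul V c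
  have hd := V.character_one_ne_zero
  have hxy : x * y = Fintype.card G * w := by
    refine mul_right_cancel₀ (mul_ne_zero hd hd) ?_
    linear_combination (-(y * V.character 1)) * hxa - Fintype.card G * V.character a * hyb +
      (Fintype.card G : ℂ) ^ 2 * h V hV + Fintype.card G * V.character 1 * hwc
  rw [map_sub, map_mul, map_smul, hx, hy, hw, sub_eq_zero, smul_smul, ← hxy,
    ← Module.End.one_eq_id, smul_mul_smul_comm, one_mul]

/-- If class sums multiply up to a scalar like a single class sum, the product of the classes lies in that class. -/
theorem isConj_mul_of_conjSum_mul_conjSum {a b c u v : G} {r : ℂ}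
    (h : conjSum a * conjSum b = r • conjSum c) (hu : IsConj a u) (hv : IsConj b v) :
    IsConj c (u * v) := by
  classical
  obtain ⟨g, rfl⟩ := isConj_iff.1 hu
  obtain ⟨k, rfl⟩ := isConj_iff.1 hv
  by_contra hcon
  have hne (l : G) : l * c * l⁻¹ ≠ g * a * g⁻¹ * (k * b * k⁻¹) :=
    fun hl => hcon (isConj_iff.2 ⟨l, hl⟩)
  have hcoeff := congrArg (fun z : ℂ[G] => z.coeff (g * a * g⁻¹ * (k * b * k⁻¹))) h
  simp [conjSum, Finset.sum_mul_sum, MonoidAlgebra.single_mul_single, MonoidAlgebra.coeff_sum,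
    Finsupp.single_apply, hne] at hcoeff
  rw [← Nat.cast_sum, Nat.cast_eq_zero, Finset.sum_eq_zero_iff] at hcoeff
  have hempty := Finset.card_eq_zero.1 (hcoeff g (Finset.mem_univ g))
  exact Finset.notMem_empty k (hempty ▸ Finset.mem_filter.2 ⟨Finset.mem_univ k, rfl⟩)

end

/-- **Lemma 3.2.**  For nontrivial `a, b, c` in a finite group `G`, `a^G b^G = c^G` if and
only if `χ(a)χ(b) = χ(c)χ(1)` for every irreducible complex character `χ` of `G`. -/
theorem stmt12 {G : Type} [Group G] [Fintype G] (a b c : G)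
    (ha : a ≠ 1) (hb : b ≠ 1) (hc : c ≠ 1) :
    {x : G | ∃ u v : G, IsConj a u ∧ IsConj b v ∧ x = u * v} = {x : G | IsConj c x} ↔
      ∀ V : FDRep ℂ G, CategoryTheory.Simple V →
        V.character a * V.character b = V.character c * V.character 1 := by
  refine ⟨fun h V hV => ?_, fun h => Set.ext fun x => ⟨?_, fun hx => ?_⟩⟩
  · have hchar (g k : G) : V.character (g * a * g⁻¹ * (k * b * k⁻¹)) = V.character c := by
      have hmem : IsConj c (g * a * g⁻¹ * (k * b * k⁻¹)) := h.subset
        ⟨_, _, isConj_iff.2 ⟨g, rfl⟩, isConj_iff.2 ⟨k, rfl⟩, rfl⟩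
      obtain ⟨l, hl⟩ := isConj_iff.1 hmem
      rw [← hl, V.char_conj]
    obtain ⟨x, hx, hxa⟩ := exists_asAlgebraHom_conjSum_eq_smul V a
    obtain ⟨y, hy, hyb⟩ := exists_asAlgebraHom_conjSum_eq_smul V b
    have htr := trace_asAlgebraHom_conjSum_mul V a b
    simp only [hchar, Finset.sum_const, Finset.card_univ, nsmul_eq_mul] at htr
    rw [map_mul, hx, hy, ← Module.End.one_eq_id, smul_mul_smul_comm, one_mul, map_smul,
      smul_eq_mul, ← map_one V.ρ] at htr
    change x * y * V.character 1 = _ at htr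
    have hG : (Fintype.card G : ℂ) ≠ 0 := Nat.cast_ne_zero.2 Fintype.card_ne_zero
    refine mul_left_cancel₀ (mul_ne_zero hG hG) ?_
    linear_combination Fintype.card G * V.character b * hxa + x * V.character 1 * hyb +
      V.character 1 * htr
  · rintro ⟨u, v, hu, hv, rfl⟩
    exact isConj_mul_of_conjSum_mul_conjSum (conjSum_mul_conjSum_of_character a b c h) hu hv
  · have hab : IsConj c (a * b) := isConj_mul_of_conjSum_mul_conjSum
      (conjSum_mul_conjSum_of_character a b c h) (IsConj.refl a) (IsConj.refl b)
    obtain ⟨l, rfl⟩ := isConj_iff.1 (hab.symm.trans hx)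
    exact ⟨l * a * l⁻¹, l * b * l⁻¹, isConj_iff.2 ⟨l, rfl⟩, isConj_iff.2 ⟨l, rfl⟩, by group⟩
end

section
/- Let p ∈ {2, 3} and let b be a positive integer with p^b ≥ 4. Let G = PSL₂(p^b) be the projective special linear group of degree 2 over the field with p^b elements, and let x be an automorphism of G whose order b is coprime to |G|. Let L be the semidirect product G ⋊ ⟨x⟩ of G by the cyclic subgroup of Aut(G) generated by x, acting naturally; identify G with the normal subgroup G × 1 of L and x with the element (1, x) of L. Then the set of products of two L-conjugates of x equals the coset x²G; that is, {uv : u, v ∈ x^L} = {(g, x²) : g ∈ G}. -/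
namespace PSLTwist

open Matrix

section

variable {F : Type*} [Field F]

/-- The action of a `2 × 2` matrix on a pair of field elements. -/
def ap (A : Matrix (Fin 2) (Fin 2) F) (v : F × F) : F × F :=
  (A 0 0 * v.1 + A 0 1 * v.2, A 1 0 * v.1 + A 1 1 * v.2)

/-- The determinant of two vectors. -/
def dt (v w : F × F) : F := v.1 * w.2 - v.2 * w.1

/-- The coordinatewise action of a field automorphism. -/
def sg (σ : RingAut F) (v : F × F) : F × F := (σ v.1, σ v.2)

/-- The matrix with two given columns. -/
def cols (v w : F × F) : Matrix (Fin 2) (Fin 2) F := !![v.1, w.1; v.2, w.2]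

lemma ap_mul (A B : Matrix (Fin 2) (Fin 2) F) (v : F × F) : ap (A * B) v = ap A (ap B v) := by
  ext <;> simp [ap, Matrix.mul_apply, Fin.sum_univ_two] <;> ring

lemma ap_one (v : F × F) : ap (1 : Matrix (Fin 2) (Fin 2) F) v = v := by
  ext <;> simp [ap]

lemma ap_smul (A : Matrix (Fin 2) (Fin 2) F) (c : F) (v : F × F) : ap A (c • v) = c • ap A v := by
  ext <;> simp [ap] <;> ring

lemma ap_add (A : Matrix (Fin 2) (Fin 2) F) (v w : F × F) : ap A (v + w) = ap A v + ap A w := by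
  ext <;> simp [ap] <;> ring

lemma sg_smul (σ : RingAut F) (c : F) (v : F × F) : sg σ (c • v) = σ c • sg σ v := by
  ext <;> simp [sg]

lemma sg_add (σ : RingAut F) (v w : F × F) : sg σ (v + w) = sg σ v + sg σ w := by
  ext <;> simp [sg]

lemma sg_mul (σ τ : RingAut F) (v : F × F) : sg (σ * τ) v = sg σ (sg τ v) := rfl

lemma sg_one (v : F × F) : sg 1 v = v := rfl

lemma sg_ap (σ : RingAut F) (A : Matrix (Fin 2) (Fin 2) F) (v : F × F) :
    sg σ (ap A v) = ap (A.map σ) (sg σ v) := by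
  ext <;> simp [ap, sg]

lemma dt_ap (A : Matrix (Fin 2) (Fin 2) F) (v w : F × F) :
    dt (ap A v) (ap A w) = A.det * dt v w := by
  simp [dt, ap, det_fin_two]; ring

lemma det_cols (v w : F × F) : (cols v w).det = dt v w := by
  simp [cols, dt, det_fin_two]; ring

lemma mul_cols (A : Matrix (Fin 2) (Fin 2) F) (v w : F × F) :
    A * cols v w = cols (ap A v) (ap A w) := by
  ext i j; fin_cases i <;> fin_cases j <;>
    simp [cols, ap, Matrix.mul_apply, Fin.sum_univ_two]

lemma map_cols (σ : RingAut F) (v w : F × F) :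
    (cols v w).map σ = cols (sg σ v) (sg σ w) := by
  ext i j; fin_cases i <;> fin_cases j <;> simp [cols, sg]

/-- A semilinear operator of finite order has fixed vectors outside every hyperplane. -/
lemma exists_fixed_ne {σ : RingAut F} {b : ℕ} (hb : 0 < b) (hσ : orderOf σ = b)
    (y : F × F → F × F) (hadd : ∀ v w, y (v + w) = y v + y w)
    (hsm : ∀ (c : F) v, y (c • v) = σ c • y v) (hy : ∀ v, y^[b] v = v)
    (α β : F) (h : α ≠ 0 ∨ β ≠ 0) : ∃ v, y v = v ∧ α * v.1 + β * v.2 ≠ 0 := by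
  by_contra! hcon
  have hiter_sm : ∀ (i : ℕ) (c : F) v, y^[i] (c • v) = (σ ^ i) c • y^[i] v := by
    intro i
    induction i with
    | zero => intro c v; simp
    | succ i ih =>
      intro c v
      rw [Function.iterate_succ_apply', ih, hsm, Function.iterate_succ_apply', pow_succ']
      rfl
  let P : F × F → F × F := fun v => ∑ i ∈ Finset.range b, y^[i] v
  let Y : F × F →+ F × F := AddMonoidHom.mk' y hadd
  have hP : ∀ v, y (P v) = P v := by
    intro v
    have h1 : y (P v) = ∑ i ∈ Finset.range b, y^[i+1] v := by
      have := map_sum Y (fun i => y^[i] v) (Finset.range b)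
      simp only [Function.iterate_succ_apply']
      exact this
    have h2 := Finset.sum_range_succ (fun i => y^[i] v) b
    have h3 := Finset.sum_range_succ' (fun i => y^[i] v) b
    rw [h1]
    rw [h2] at h3
    simp only [hy, Function.iterate_zero, id] at h3
    exact (add_right_cancel h3).symm
  let ch : Fin b → (F →* F) := fun i => ((σ ^ (i : ℕ) : RingAut F) : F →* F)
  have hinj : Function.Injective ch := by
    intro i j hij
    have h1 : σ ^ (i : ℕ) = σ ^ (j : ℕ) := by
      ext c
      exact DFunLike.congr_fun hij c
    have := pow_injOn_Iio_orderOf (x := σ) (by simp [hσ]) (by simp [hσ]) h1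
    exact Fin.ext this
  have hli := (linearIndependent_monoidHom F F).comp ch hinj
  rw [Fintype.linearIndependent_iff] at hli
  have key : ∀ v : F × F, α * v.1 + β * v.2 = 0 := by
    intro v
    have := hli (fun i => α * (y^[i] v).1 + β * (y^[i] v).2) (by
      ext c
      have h0 := hcon (P (c • v)) (hP _)
      simp only [P, hiter_sm, Prod.fst_sum, Prod.snd_sum, Finset.mul_sum,
        ← Finset.sum_add_distrib, Finset.sum_range] at h0
      simp only [Function.comp, Finset.sum_apply, Pi.smul_apply, Pi.zero_apply]
      rw [← h0]
      refine Finset.sum_congr rfl fun i _ => ?_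
      simp [ch]; ring) ⟨0, hb⟩
    simpa using this
  have e1 := key (1, 0)
  have e2 := key (0, 1)
  simp at e1 e2
  tauto

/-- Hilbert 90 for `GL₂`. -/
lemma exists_eq_cols {σ : RingAut F} {b : ℕ} (hb : 0 < b) (hσ : orderOf σ = b)
    (A : Matrix (Fin 2) (Fin 2) F) (hA : ∀ v, (fun v => ap A (sg σ v))^[b] v = v) :
    ∃ n : Matrix (Fin 2) (Fin 2) F, n.det ≠ 0 ∧ A * n.map σ = n := by
  have key := exists_fixed_ne hb hσ (fun v => ap A (sg σ v))
    (fun v w => by simp only [sg_add, ap_add]) (fun c v => by simp only [sg_smul, ap_smul]) hA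
  obtain ⟨v, hv, hv0⟩ := key 1 0 (by simp)
  obtain ⟨w, hw, hw0⟩ := key (-v.2) v.1 (by right; simpa using hv0)
  refine ⟨cols v w, ?_, ?_⟩
  · rw [det_cols, dt]
    intro h; apply hw0; rw [← h]; ring
  · rw [map_cols, mul_cols, hv, hw]

end

section

variable {F : Type*} [Field F]

/-- `SL₂` over `F`. -/
abbrev SL (F : Type*) [Field F] := SpecialLinearGroup (Fin 2) F

/-- Field automorphisms acting entrywise on `SL₂`. -/
def fa : RingAut F →* MulAut (SL F) where
  toFun σ :=
    { toFun := SpecialLinearGroup.map (σ : F →+* F)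
      invFun := SpecialLinearGroup.map (σ⁻¹ : RingAut F)
      left_inv := fun M => by
        ext i j
        exact σ.symm_apply_apply (M i j)
      right_inv := fun M => by
        ext i j
        exact σ.apply_symm_apply (M i j)
      map_mul' := map_mul _ }
  map_one' := by ext; rfl
  map_mul' _ _ := by ext; rfl

@[simp] lemma fa_apply (σ : RingAut F) (M : SL F) (i j : Fin 2) : fa σ M i j = σ (M i j) := rfl

lemma coe_fa (σ : RingAut F) (M : SL F) : (fa σ M).1 = M.1.map σ := rfl

/-- The matrix of `SL₂` with given entries. -/
def sm (a b c d : F) (h : a * d - b * c = 1) : SL F := ⟨!![a, b; c, d], by rw [det_fin_two_of, h]⟩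

@[simp] lemma sm00 (a b c d : F) (h : a * d - b * c = 1) : sm a b c d h 0 0 = a := rfl
@[simp] lemma sm01 (a b c d : F) (h : a * d - b * c = 1) : sm a b c d h 0 1 = b := rfl
@[simp] lemma sm10 (a b c d : F) (h : a * d - b * c = 1) : sm a b c d h 1 0 = c := rfl
@[simp] lemma sm11 (a b c d : F) (h : a * d - b * c = 1) : sm a b c d h 1 1 = d := rfl

/-- Upper unitriangular matrices. -/
def um (t : F) : SL F := ⟨!![1, t; 0, 1], by simp⟩

/-- Lower unitriangular matrices. -/
def lm (t : F) : SL F := ⟨!![1, 0; t, 1], by simp⟩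

/-- The diagonal matrices of determinant one. -/
def dm (t : F) (ht : t ≠ 0) : SL F := ⟨!![t, 0; 0, t⁻¹], by simp [ht]⟩

lemma sl_ext {M N : SL F} (h00 : M 0 0 = N 0 0) (h01 : M 0 1 = N 0 1) (h10 : M 1 0 = N 1 0)
    (h11 : M 1 1 = N 1 1) : M = N := by
  ext i j
  fin_cases i <;> fin_cases j <;> assumption

@[simp] lemma um00 (t : F) : um t 0 0 = 1 := rfl
@[simp] lemma um01 (t : F) : um t 0 1 = t := rfl
@[simp] lemma um10 (t : F) : um t 1 0 = 0 := rfl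
@[simp] lemma um11 (t : F) : um t 1 1 = 1 := rfl
@[simp] lemma lm00 (t : F) : lm t 0 0 = 1 := rfl
@[simp] lemma lm01 (t : F) : lm t 0 1 = 0 := rfl
@[simp] lemma lm10 (t : F) : lm t 1 0 = t := rfl
@[simp] lemma lm11 (t : F) : lm t 1 1 = 1 := rfl
@[simp] lemma dm00 (t : F) (ht : t ≠ 0) : dm t ht 0 0 = t := rfl
@[simp] lemma dm01 (t : F) (ht : t ≠ 0) : dm t ht 0 1 = 0 := rfl
@[simp] lemma dm10 (t : F) (ht : t ≠ 0) : dm t ht 1 0 = 0 := rfl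
@[simp] lemma dm11 (t : F) (ht : t ≠ 0) : dm t ht 1 1 = t⁻¹ := rfl

lemma mul00 (M N : SL F) : (M * N) 0 0 = M 0 0 * N 0 0 + M 0 1 * N 1 0 := by
  simp [Matrix.mul_apply, Fin.sum_univ_two]
lemma mul01 (M N : SL F) : (M * N) 0 1 = M 0 0 * N 0 1 + M 0 1 * N 1 1 := by
  simp [Matrix.mul_apply, Fin.sum_univ_two]
lemma mul10 (M N : SL F) : (M * N) 1 0 = M 1 0 * N 0 0 + M 1 1 * N 1 0 := by
  simp [Matrix.mul_apply, Fin.sum_univ_two]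
lemma mul11 (M N : SL F) : (M * N) 1 1 = M 1 0 * N 0 1 + M 1 1 * N 1 1 := by
  simp [Matrix.mul_apply, Fin.sum_univ_two]
lemma inv00 (M : SL F) : M⁻¹ 0 0 = M 1 1 := by
  simp [SpecialLinearGroup.SL2_inv_expl]
lemma inv01 (M : SL F) : M⁻¹ 0 1 = -M 0 1 := by
  simp [SpecialLinearGroup.SL2_inv_expl]
lemma inv10 (M : SL F) : M⁻¹ 1 0 = -M 1 0 := by
  simp [SpecialLinearGroup.SL2_inv_expl]
lemma inv11 (M : SL F) : M⁻¹ 1 1 = M 0 0 := by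
  simp [SpecialLinearGroup.SL2_inv_expl]
lemma one00 : (1 : SL F) 0 0 = 1 := rfl
lemma one01 : (1 : SL F) 0 1 = 0 := rfl
lemma one10 : (1 : SL F) 1 0 = 0 := rfl
lemma one11 : (1 : SL F) 1 1 = 1 := rfl
lemma neg_app (M : SL F) (i j : Fin 2) : (-M) i j = -M i j := rfl

lemma sl_det (M : SL F) : M 0 0 * M 1 1 - M 0 1 * M 1 0 = 1 := by
  rw [← det_fin_two]; exact M.2

lemma um_add (s t : F) : um (s + t) = um s * um t := by
  apply sl_ext <;> simp [mul00, mul01, mul10, mul11]; ring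

lemma um_zero : um (0 : F) = 1 := by
  apply sl_ext <;> simp [one00, one01, one10, one11]

lemma um_neg (t : F) : um (-t) = (um t)⁻¹ := by
  apply sl_ext <;> simp [inv00, inv01, inv10, inv11]

lemma um_inj {s t : F} (h : um s = um t) : s = t := by
  have := congrArg (fun M : SL F => M 0 1) h
  simpa using this

lemma um_pow (t : F) (n : ℕ) : um t ^ n = um (n * t) := by
  induction n with
  | zero => simp [um_zero]
  | succ n ih => rw [pow_succ, ih, ← um_add]; push_cast; ring_nf

lemma fa_um (σ : RingAut F) (t : F) : fa σ (um t) = um (σ t) := by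
  apply sl_ext <;> simp

lemma fa_lm (σ : RingAut F) (t : F) : fa σ (lm t) = lm (σ t) := by
  apply sl_ext <;> simp

lemma fa_neg (σ : RingAut F) (M : SL F) : fa σ (-M) = -fa σ M := by
  apply sl_ext <;> simp

section Lang

lemma iterate_semilinear (τ : RingAut F) (M : SL F) (i : ℕ) (v : F × F) :
    (fun v => ap M.1 (sg τ v))^[i] v =
      ap ((⟨M, τ⟩ : SL F ⋊[fa] RingAut F) ^ i).left.1 (sg (τ ^ i) v) := by
  induction i with
  | zero => simp [ap_one, sg_one]
  | succ i ih =>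
    rw [Function.iterate_succ_apply', ih, pow_succ', pow_succ', sg_mul, sg_ap, ← ap_mul]
    rfl

/-- Twisted elements of `SL₂` whose norm is trivial are coboundaries. -/
lemma exists_eq_mul_inv {τ : RingAut F} {b : ℕ} (hb : 0 < b) (hτ : orderOf τ = b)
    (M : SL F) (hM : (⟨M, τ⟩ : SL F ⋊[fa] RingAut F) ^ b = 1) :
    ∃ n : SL F, M = n * (fa τ n)⁻¹ := by
  obtain ⟨n, hn, hMn⟩ := exists_eq_cols hb hτ M.1 (fun v => by
    rw [iterate_semilinear, hM, ← hτ, pow_orderOf_eq_one]; simp [ap_one, sg_one])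
  have hdet : τ n.det = n.det := by
    have h := congrArg Matrix.det hMn
    rw [det_mul, M.2, one_mul] at h
    have h' : τ n.det = (n.map τ).det := RingHom.map_det (τ : F →+* F) n
    rw [h', h]
  let n' : SL F := ⟨n * !![n.det⁻¹, 0; 0, 1], by simp [det_mul, hn]⟩
  refine ⟨n', ?_⟩
  rw [eq_mul_inv_iff_mul_eq]
  apply Subtype.ext
  change M.1 * (n * !![n.det⁻¹, 0; 0, 1]).map τ = n * !![n.det⁻¹, 0; 0, 1]
  have h2 : (!![n.det⁻¹, 0; 0, 1] : Matrix (Fin 2) (Fin 2) F).map τ = !![n.det⁻¹, 0; 0, 1] := by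
    ext i j
    fin_cases i <;> fin_cases j <;> simp [hdet]
  have h3 : (n * !![n.det⁻¹, 0; 0, 1]).map τ
      = n.map τ * (!![n.det⁻¹, 0; 0, 1] : Matrix (Fin 2) (Fin 2) F).map τ :=
    Matrix.map_mul (f := (τ : F →+* F))
  rw [h3, h2, ← mul_assoc, hMn]

/-- A coprime twisted element is twisted conjugate to a fixed point of the twist. -/
lemma exists_fixed_twist {N K : Type*} [Group N] [Finite N] [Group K] (φ : K →* MulAut N) (k : K)
    (b : ℕ) (hk : k ^ b = 1) (hb : Nat.Coprime b (Nat.card N))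
    (lang : ∀ M : N, (⟨M, k⟩ : N ⋊[φ] K) ^ b = 1 → ∃ n, M = n * (φ k n)⁻¹) (M : N) :
    ∃ n g : N, φ k g = g ∧ M = n * g * (φ k n)⁻¹ := by
  let y : N ⋊[φ] K := ⟨M, k⟩
  have hyr : (y ^ b).right = 1 := by
    have := map_pow (SemidirectProduct.rightHom (φ := φ)) y b
    simpa [y, hk] using this
  set Y := (y ^ b).left with hYdef
  have hY : y ^ b = SemidirectProduct.inl Y := by
    ext
    · simp [hYdef]
    · simp [hyr]
  have hbez : (b : ℤ) * Nat.gcdA b (Nat.card N) + Nat.card N * Nat.gcdB b (Nat.card N) = 1 := by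
    rw [← Nat.gcd_eq_gcd_ab, hb]; rfl
  set u := Nat.gcdA b (Nat.card N)
  set v := Nat.gcdB b (Nat.card N)
  let y' := y ^ ((Nat.card N : ℤ) * v)
  have hg1 : y ^ ((b : ℤ) * u) = SemidirectProduct.inl (Y ^ u) := by
    rw [_root_.zpow_mul, zpow_natCast, hY, map_zpow]
  have hyy : y = SemidirectProduct.inl (Y ^ u) * y' := by
    rw [← hg1, ← _root_.zpow_add, hbez, zpow_one]
  have hcomm : SemidirectProduct.inl (Y ^ u) * y' = y' * SemidirectProduct.inl (Y ^ u) := by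
    rw [← hg1, ← _root_.zpow_add, ← _root_.zpow_add, add_comm]
  have hy'b : y' ^ b = 1 := by
    have : y' ^ b = (y ^ b) ^ ((Nat.card N : ℤ) * v) := by
      rw [← zpow_natCast, ← zpow_natCast, ← _root_.zpow_mul, ← _root_.zpow_mul, mul_comm]
    rw [this, hY, ← map_zpow, _root_.zpow_mul, zpow_natCast, pow_card_eq_one', _root_.one_zpow, map_one]
  have hr : y'.right = k := by
    have := congrArg SemidirectProduct.right hyy
    rw [SemidirectProduct.mul_right, SemidirectProduct.right_inl, one_mul] at this
    exact this.symm
  have hy' : y' = ⟨y'.left, k⟩ := by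
    ext
    · rfl
    · simp [hr]
  obtain ⟨n, hn⟩ := lang y'.left (by rw [← hy']; exact hy'b)
  have e1 := congrArg SemidirectProduct.left hyy
  have e2 := congrArg SemidirectProduct.left hcomm
  simp only [SemidirectProduct.mul_left, SemidirectProduct.left_inl, SemidirectProduct.right_inl,
    map_one, MulAut.one_apply, hr] at e1 e2
  rw [hn] at e1 e2
  refine ⟨n, n⁻¹ * Y ^ u * n, ?_, ?_⟩
  · simp only [map_mul, map_inv]
    have e3 : n⁻¹ * (Y ^ u * (n * (φ k n)⁻¹)) * φ k n
        = n⁻¹ * (n * (φ k n)⁻¹ * (φ k) (Y ^ u)) * φ k n := by rw [e2]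
    simp only [mul_assoc, inv_mul_cancel, mul_one, inv_mul_cancel_left] at e3
    simp only [mul_assoc]
    exact e3.symm
  · change M = _ at e1
    rw [e1]; group

end Lang

end

section

variable {F : Type*} [Field F]

/-- The field automorphisms to which the argument applies: those of odd order `b` on a field of
characteristic `p ∈ {2, 3}` whose fixed field is the prime field, with `b` coprime to `|SL₂|`. -/
structure Good (p b : ℕ) (σ : RingAut F) : Prop where
  two_or_three : p = 2 ∨ p = 3
  charP : CharP F p
  two_le : 2 ≤ b
  odd : Odd b
  order : orderOf σ = b
  not_dvd : ¬ p ∣ b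
  coprime : Nat.Coprime b (Nat.card (SL F))
  fixed : ∀ x, σ x = x → x = 0 ∨ x = 1 ∨ x = -1

namespace Good

variable {p b : ℕ} {σ : RingAut F}

lemma pow_eq_one (h : Good p b σ) : σ ^ b = 1 := by rw [← h.order]; exact pow_orderOf_eq_one σ

lemma sq_fixed (h : Good p b σ) {x : F} (hx : (σ * σ) x = x) : σ x = x := by
  obtain ⟨k, hk⟩ := h.odd
  have h1 : ∀ n : ℕ, ((σ * σ) ^ n) x = x := by
    intro n
    induction n with
    | zero => rfl
    | succ n ih => rw [pow_succ, RingAut.mul_apply, hx, ih]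
  have h2 : (σ * σ) ^ k * σ = 1 := by
    rw [← sq, ← pow_mul, ← pow_succ, ← hk, h.pow_eq_one]
  have h3 : ((σ * σ) ^ k) (σ x) = x := by
    rw [← RingAut.mul_apply, h2]; rfl
  exact ((σ * σ) ^ k).injective (h3.trans (h1 k).symm)

lemma sq_order (h : Good p b σ) : orderOf (σ * σ) = b := by
  rw [← sq, orderOf_pow' _ two_ne_zero, h.order, Nat.gcd_comm]
  have : Nat.Coprime 2 b := Nat.coprime_two_left.2 h.odd
  rw [this]; simp

lemma one_ne (h : Good p b σ) {c : F} (hc : σ c = c) (hc0 : c ≠ 0) (r : F) : r - σ r ≠ c := by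
  intro hr
  have h1 : ∀ n : ℕ, (σ ^ n) r = r - n * c := by
    intro n
    induction n with
    | zero => simp
    | succ n ih =>
      rw [pow_succ', RingAut.mul_apply, ih, map_sub, map_mul, hc, map_natCast]
      push_cast
      linear_combination -hr
  have h2 := h1 b
  rw [h.pow_eq_one] at h2
  have h3 : (b : F) * c = 0 := by
    have : (1 : RingAut F) r = r := rfl
    rw [this] at h2
    linear_combination h2
  have h4 : (b : F) = 0 := by simpa [hc0] using h3
  have := h.charP
  exact h.not_dvd ((CharP.cast_eq_zero_iff F p b).1 h4)

lemma exists_sq_sub (h : Good p b σ) (r : F) : ∃ s, s - (σ * σ) s = r - σ r := by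
  obtain ⟨k, hk⟩ := h.odd
  have h2 : (σ * σ) ^ (k + 1) = σ := by
    rw [← sq, ← pow_mul, show 2 * (k + 1) = (2 * k + 1) + 1 by ring, pow_succ, ← hk,
      h.pow_eq_one, one_mul]
  refine ⟨∑ i ∈ Finset.range (k + 1), ((σ * σ) ^ i) r, ?_⟩
  rw [map_sum, ← Finset.sum_sub_distrib]
  have := Finset.sum_range_sub' (fun i => ((σ * σ) ^ i) r) (k + 1)
  simp only [h2] at this
  rw [pow_zero] at this
  have h5 : (1 : RingAut F) r = r := rfl
  rw [h5] at this
  rw [← this]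
  refine Finset.sum_congr rfl fun i _ => ?_
  rw [pow_succ', RingAut.mul_apply (σ * σ)]

lemma exists_sub (r : F) : ∃ s, s - σ s = r - (σ * σ) r := by
  refine ⟨r + σ r, ?_⟩
  rw [map_add, RingAut.mul_apply]; ring

lemma exists_not_fixed (h : Good p b σ) : ∃ x, σ x ≠ x := by
  by_contra! hc
  have : σ = 1 := by ext x; exact hc x
  have h1 := h.order
  rw [this, orderOf_one] at h1
  have := h.two_le
  omega

lemma order_two (h : Good p b σ) {c : F} (hc : σ c = c) (hc0 : c ≠ 0) : c * c = 1 := by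
  rcases h.fixed c hc with h | h | h
  · contradiction
  · simp [h]
  · simp [h]

end Good

/-- Products of a `σ`-coboundary and a `σ`-translate of a `σ`-coboundary, up to sign. -/
def IsProd (σ : RingAut F) (M : SL F) : Prop :=
  ∃ H K : SL F, M = H * (fa σ H)⁻¹ * (fa σ K * (fa (σ * σ) K)⁻¹) ∨
    M = -(H * (fa σ H)⁻¹ * (fa σ K * (fa (σ * σ) K)⁻¹))

namespace IsProd

variable {σ : RingAut F}

lemma neg {M : SL F} (h : IsProd σ M) : IsProd σ (-M) := by
  obtain ⟨H, K, h | h⟩ := h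
  · exact ⟨H, K, Or.inr (by rw [h])⟩
  · exact ⟨H, K, Or.inl (by rw [h, neg_neg])⟩

lemma twist {M : SL F} (h : IsProd σ M) (n : SL F) :
    IsProd σ (n * M * (fa (σ * σ) n)⁻¹) := by
  obtain ⟨H, K, rfl | rfl⟩ := h
  · refine ⟨n * H, n * K, Or.inl ?_⟩
    simp only [map_mul]; group
  · refine ⟨n * H, n * K, Or.inr ?_⟩
    simp only [map_mul, mul_neg, neg_mul, neg_inj]; group

lemma of_coboundary (H : SL F) : IsProd σ (H * (fa σ H)⁻¹) :=
  ⟨H, 1, Or.inl (by simp)⟩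

end IsProd

lemma isProd_um {p b : ℕ} {σ : RingAut F} (h : Good p b σ) (c : F) :
    IsProd σ (um c) := by
  obtain ⟨φ, hφ⟩ := h.exists_not_fixed
  have hφ0 : φ ≠ 0 := by rintro rfl; simp at hφ
  have hσφ0 : σ φ ≠ 0 := by simpa using hφ0
  have hsq : (φ ^ 2)⁻¹ - ((σ φ) ^ 2)⁻¹ ≠ 0 := by
    intro h0
    have h1 : φ ^ 2 = (σ φ) ^ 2 := inv_injective (sub_eq_zero.1 h0)
    rcases sq_eq_sq_iff_eq_or_eq_neg.1 h1 with h2 | h2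
    · exact hφ h2.symm
    · apply hφ
      apply h.sq_fixed
      rw [RingAut.mul_apply]
      have : σ φ = -φ := by rw [eq_neg_iff_add_eq_zero, add_comm, ← eq_neg_iff_add_eq_zero, ← h2]
      rw [this, map_neg, this, neg_neg]
  set γ := (φ ^ 2)⁻¹ - ((σ φ) ^ 2)⁻¹ with hγ
  obtain ⟨s, hs⟩ : ∃ s, c = s * γ := ⟨c / γ, by field_simp⟩
  obtain ⟨r, hr⟩ := h.exists_sq_sub (s * ((σ φ) ^ 2)⁻¹)
  have key := ((IsProd.of_coboundary (σ := σ)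
    (um s * dm (φ * σ φ) (mul_ne_zero hφ0 hσφ0))).twist (dm φ hφ0)⁻¹).twist (um (-r))
  convert key using 1
  have hs2 : σ (σ φ) ≠ 0 := by simpa using hσφ0
  apply sl_ext
  · simp [mul00, mul01, mul10, mul11, inv00, inv01, inv10, inv11]
    field_simp
  · simp [mul00, mul01, mul10, mul11, inv00, inv01, inv10, inv11]
    rw [RingAut.mul_apply] at hr
    rw [hs, hγ]
    simp only [map_mul, map_inv₀, map_pow] at hr ⊢
    have hr' : σ (σ r) = r - (s * (σ φ ^ 2)⁻¹ - σ s * (σ (σ φ) ^ 2)⁻¹) := by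
      linear_combination -hr
    rw [hr']
    field_simp
    ring
  · simp [mul00, mul01, mul10, mul11, inv00, inv01, inv10, inv11]
  · simp [mul00, mul01, mul10, mul11, inv00, inv01, inv10, inv11]
    field_simp

end

section

variable {F : Type*} [Field F]

lemma eq_neg_self_of_two {p b : ℕ} {σ : RingAut F} (h : Good p b σ) (hp : p = 2) : (-1 : F) = 1 := by
  have := h.charP
  subst hp
  exact CharTwo.neg_eq 1

/-- A fixed matrix with a fixed eigenvector is conjugate to a unipotent one, up to sign. -/
lemma exists_conj_um {p b : ℕ} {σ : RingAut F} (h : Good p b σ) {g : SL F} (hg : fa σ g = g)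
    {e : F × F} (he : e ≠ 0) (hse : sg σ e = e) (hge : dt e (ap g.1 e) = 0) :
    ∃ (N : SL F) (c : F), fa σ N = N ∧ σ c = c ∧
      (g = N * um c * N⁻¹ ∨ g = -(N * um c * N⁻¹)) := by
  obtain ⟨x, y⟩ := e
  have hx : σ x = x := congrArg Prod.fst hse
  have hy : σ y = y := congrArg Prod.snd hse
  obtain ⟨N, hN, hN0, hN1⟩ : ∃ N : SL F, fa σ N = N ∧ N 0 0 = x ∧ N 1 0 = y := by
    by_cases hx0 : x = 0
    · have hy0 : y ≠ 0 := by rintro rfl; simp [hx0] at he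
      refine ⟨sm x (-y⁻¹) y 0 (by simp [hy0]), ?_, rfl, rfl⟩
      apply sl_ext <;> simp [hx, hy]
    · refine ⟨sm x 0 y x⁻¹ (by simp [hx0]), ?_, rfl, rfl⟩
      apply sl_ext <;> simp [hx, hy]
  set g' := N⁻¹ * g * N with hg'
  have hfix : fa σ g' = g' := by simp [hg', hN, hg]
  have hgg : g = N * g' * N⁻¹ := by rw [hg']; group
  have h10 : g' 1 0 = 0 := by
    rw [hg']
    simp only [mul10, inv10, inv11, hN0, hN1]
    simp [dt, ap] at hge
    simp only [mul11, inv10, inv11, hN0, hN1]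
    linear_combination hge
  have hdet := sl_det g'
  rw [h10, mul_zero, sub_zero] at hdet
  have hf : ∀ i j, σ (g' i j) = g' i j := fun i j => by
    rw [← fa_apply, hfix]
  rcases h.fixed _ (hf 0 0) with h0 | h0 | h0
  · simp [h0] at hdet
  · refine ⟨N, g' 0 1, hN, hf 0 1, Or.inl ?_⟩
    rw [hgg]; congr 2
    apply sl_ext <;> simp [h0, h10]
    simpa [h0] using hdet
  · refine ⟨N, -g' 0 1, hN, by rw [map_neg, hf], Or.inr ?_⟩
    have : g' = -um (-g' 0 1) := by
      apply sl_ext <;> simp [h0, h10]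
      rw [h0] at hdet
      linear_combination -hdet
    rw [hgg, ← mul_neg_one]
    conv_lhs => rw [this]
    simp

/-- The fixed matrices without fixed eigenvectors. -/
def IsElliptic (σ : RingAut F) (g : SL F) : Prop :=
  fa σ g = g ∧ ∀ e : F × F, e ≠ 0 → sg σ e = e → dt e (ap g.1 e) ≠ 0

lemma dt_neg (g : SL F) (v e : F × F) : dt v (ap (-g).1 e) = -dt v (ap g.1 e) := by
  have : ∀ i j, (-g).1 i j = - g.1 i j := fun i j => rfl
  simp only [dt, ap, this]; ring

lemma IsElliptic.neg {σ : RingAut F} {g : SL F} (h : IsElliptic σ g) : IsElliptic σ (-g) := by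
  refine ⟨by rw [fa_neg, h.1], fun e he hs => ?_⟩
  rw [dt_neg]
  exact neg_ne_zero.2 (h.2 e he hs)

/-- The companion matrix of `X² - tX + 1`. -/
def cm (t : F) : SL F := sm 0 (-1) 1 t (by simp)

lemma IsElliptic.exists_conj_cm {p b : ℕ} {σ : RingAut F} (h : Good p b σ) {g : SL F}
    (hg : IsElliptic σ g) : ∃ N : SL F, fa σ N = N ∧
      (g = N * cm (if p = 2 then 1 else 0) * N⁻¹ ∨ g = -(N * cm (if p = 2 then 1 else 0) * N⁻¹)) := by
  have main : ∀ g : SL F, IsElliptic σ g → g 1 0 = 1 → ∃ N : SL F, fa σ N = N ∧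
      g = N * cm (if p = 2 then 1 else 0) * N⁻¹ := by
    intro g hg h1
    have hf : ∀ i j, σ (g i j) = g i j := fun i j => by
      rw [← fa_apply, hg.1]
    have hdet := sl_det g
    have hdet' : g 0 1 = g 0 0 * g 1 1 - 1 := by
      rw [h1] at hdet; linear_combination -hdet
    have ht2 : g 0 0 + g 1 1 ≠ 2 := by
      intro ht
      apply hg.2 (1 - g 0 0, -1) (by simp) (by simp [sg, hf])
      have h11 : g 1 1 = 2 - g 0 0 := by linear_combination ht
      simp only [dt, ap]
      rw [h1, hdet', h11]
      ring
    have htm2 : g 0 0 + g 1 1 ≠ -2 := by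
      intro ht
      apply hg.2 (1 + g 0 0, 1) (by simp) (by simp [sg, hf])
      have h11 : g 1 1 = -2 - g 0 0 := by linear_combination ht
      simp only [dt, ap]
      rw [h1, hdet', h11]
      ring
    have ht : g 0 0 + g 1 1 = if p = 2 then 1 else 0 := by
      have hch := h.charP
      have hs := h.fixed (g 0 0 + g 1 1) (by rw [map_add, hf, hf])
      rcases h.two_or_three with hp | hp
      · subst hp
        have h2 : (2 : F) = 0 := by exact_mod_cast CharP.cast_eq_zero F 2
        simp only [if_true]
        rw [h2] at ht2
        have := eq_neg_self_of_two h rfl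
        rw [this] at hs
        tauto
      · subst hp
        have h3 : (3 : F) = 0 := by exact_mod_cast CharP.cast_eq_zero F 3
        rw [if_neg (by norm_num)]
        rcases hs with hs | hs | hs
        · exact hs
        · exact absurd (hs.trans (by linear_combination h3)) htm2
        · exact absurd (hs.trans (by linear_combination -h3)) ht2
    refine ⟨um (g 0 0), by rw [fa_um, hf], ?_⟩
    rw [← ht]
    apply sl_ext <;> simp [mul00, mul01, mul10, mul11, inv00, inv01, inv10, inv11, cm, h1]
    rw [hdet']; ring
  have hf : σ (g 1 0) = g 1 0 := by
    rw [← fa_apply, hg.1]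
  rcases h.fixed _ hf with h0 | h0 | h0
  · exfalso
    apply hg.2 (1, 0) (by simp) (by simp [sg])
    simp [dt, ap, h0]
  · obtain ⟨N, hN, hh⟩ := main g hg h0
    exact ⟨N, hN, Or.inl hh⟩
  · obtain ⟨N, hN, hh⟩ := main (-g) hg.neg (by simp [h0])
    exact ⟨N, hN, Or.inr (by rw [← hh, neg_neg])⟩

/-- If some coboundary is twisted conjugate to an elliptic fixed matrix then every matrix is a
product of two coboundaries up to sign. -/
lemma isProd_of_exists_elliptic [Finite F] {p b : ℕ} {σ : RingAut F} (h : Good p b σ)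
    (hex : ∃ H n g : SL F, IsElliptic σ g ∧ H * (fa σ H)⁻¹ = n * g * (fa (σ * σ) n)⁻¹) (M : SL F) :
    IsProd σ M := by
  have h2 : ∀ X : SL F, fa (σ * σ) X = fa σ (fa σ X) := fun X => by rw [map_mul]; rfl
  obtain ⟨n, g, hg, rfl⟩ := exists_fixed_twist fa (σ * σ) b
    (by rw [← h.sq_order]; exact pow_orderOf_eq_one _) h.coprime
    (fun M => exists_eq_mul_inv (by have := h.two_le; omega) h.sq_order M) M
  apply IsProd.twist
  have hgσ : fa σ g = g := by
    ext i j
    apply h.sq_fixed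
    have := congrArg (fun M : SL F => M i j) hg
    exact this
  have twfix : ∀ N X : SL F, fa σ N = N → IsProd σ X → IsProd σ (N * X * N⁻¹) := by
    intro N X hN hX
    have := hX.twist N
    rwa [h2, hN, hN] at this
  by_cases hell : IsElliptic σ g
  · obtain ⟨H, n, g1, hg1, hH⟩ := hex
    have hC : IsProd σ (cm (if p = 2 then 1 else 0)) := by
      have hg1' : IsProd σ g1 := by
        have := (IsProd.of_coboundary (σ := σ) H).twist n⁻¹
        rw [hH] at this
        convert this using 1
        rw [map_inv]; group
      obtain ⟨N, hN, hh⟩ := hg1.exists_conj_cm h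
      have hc : IsProd σ (N * cm (if p = 2 then 1 else 0) * N⁻¹) := by
        rcases hh with hh | hh
        · rwa [← hh]
        · rw [← neg_neg (N * cm (if p = 2 then 1 else 0) * N⁻¹), ← hh]
          exact hg1'.neg
      have := twfix N⁻¹ _ (by rw [map_inv, hN]) hc
      convert this using 1
      group
    obtain ⟨N, hN, hh | hh⟩ := hell.exists_conj_cm h
    · rw [hh]; exact twfix N _ hN hC
    · rw [hh]; exact (twfix N _ hN hC).neg
  · simp only [IsElliptic, hgσ, true_and, not_forall, not_not] at hell
    obtain ⟨e, he, hse, hge⟩ := hell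
    obtain ⟨N, c, hN, hc, hh | hh⟩ := exists_conj_um h hgσ he hse hge
    · rw [hh]; exact twfix N _ hN (isProd_um h c)
    · rw [hh]; exact (twfix N _ hN (isProd_um h c)).neg

end

section

variable {F : Type*} [Field F]

lemma val_mul (A B : SL F) : (A * B).1 = A.1 * B.1 := rfl

lemma val_one : (1 : SL F).1 = 1 := rfl

lemma ap_inv_ap (n : SL F) (e : F × F) : ap n⁻¹.1 (ap n.1 e) = e := by
  rw [← ap_mul]
  have : n⁻¹.1 * n.1 = 1 := congrArg Subtype.val (inv_mul_cancel n)
  rw [this, ap_one]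

lemma ap_ap_inv (n : SL F) (e : F × F) : ap n.1 (ap n⁻¹.1 e) = e := by
  simpa using ap_inv_ap n⁻¹ e

lemma ap_zero (A : Matrix (Fin 2) (Fin 2) F) : ap A 0 = 0 := by
  simp [ap]

lemma ap_ne_zero (n : SL F) {e : F × F} (he : e ≠ 0) : ap n.1 e ≠ 0 := by
  intro h
  apply he
  rw [← ap_inv_ap n e, h, ap_zero]

lemma dt_sl (n : SL F) (v w : F × F) : dt (ap n.1 v) (ap n.1 w) = dt v w := by
  rw [dt_ap, n.2, one_mul]

lemma exists_ap_eq {e : F × F} (he : e ≠ 0) : ∃ n : SL F, ap n.1 (1, 0) = e := by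
  obtain ⟨x, y⟩ := e
  by_cases hx : x = 0
  · have hy : y ≠ 0 := by rintro rfl; simp [hx] at he
    exact ⟨sm x (-y⁻¹) y 0 (by simp [hy]), by simp [ap]⟩
  · exact ⟨sm x 0 y x⁻¹ (by simp [hx]), by simp [ap]⟩

lemma dt_sg_self (σ : RingAut F) (e : F × F) :
    dt e (sg σ e) = 0 ↔ e.2 = 0 ∨ σ (e.1 / e.2) = e.1 / e.2 := by
  by_cases h : e.2 = 0
  · simp [dt, sg, h]
  · have h' : σ e.2 ≠ 0 := by simpa using h
    simp only [h, false_or, dt, sg, map_div₀]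
    rw [div_eq_div_iff h' h]
    constructor <;> intro h <;> linear_combination -h

lemma Good.dt_sq_iff {p b : ℕ} {σ : RingAut F} (h : Good p b σ) (e : F × F) :
    dt e (sg (σ * σ) e) = 0 ↔ dt e (sg σ e) = 0 := by
  rw [dt_sg_self, dt_sg_self]
  constructor
  · rintro (h1 | h1)
    · exact Or.inl h1
    · exact Or.inr (h.sq_fixed h1)
  · rintro (h1 | h1)
    · exact Or.inl h1
    · exact Or.inr (by rw [RingAut.mul_apply, h1, h1])

variable [DecidableEq F]

lemma card_prime_field {p b : ℕ} {σ : RingAut F} (h : Good p b σ) :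
    ({0, 1, -1} : Finset F).card = p := by
  have := h.charP
  rcases h.two_or_three with hp | hp
  · rw [eq_neg_self_of_two h hp]; simp [hp]
  · subst hp
    have h1 : (1 : F) ≠ -1 := by
      intro h1
      have h2 : ((2 : ℕ) : F) = 0 := by push_cast; linear_combination h1
      rw [CharP.cast_eq_zero_iff F 3] at h2
      omega
    rw [Finset.card_insert_of_notMem, Finset.card_insert_of_notMem] <;> simp [h1]

variable [Fintype F]

/-- The number of nonzero vectors whose line is preserved by a semilinear map. -/
def Fx (τ : RingAut F) (A : SL F) : ℕ :=
  (Finset.univ.filter fun e : F × F => e ≠ 0 ∧ dt e (ap A.1 (sg τ e)) = 0).card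

lemma Fx_twist (τ : RingAut F) (n A : SL F) : Fx τ (n * A * (fa τ n)⁻¹) = Fx τ A := by
  have key : ∀ e : F × F, dt (ap n.1 e) (ap (n * A * (fa τ n)⁻¹).1 (sg τ (ap n.1 e)))
      = dt e (ap A.1 (sg τ e)) := by
    intro e
    rw [sg_ap, ← coe_fa, ← ap_mul]
    have : (n * A * (fa τ n)⁻¹).1 * (fa τ n).1 = n.1 * A.1 := by
      rw [← val_mul, ← val_mul, inv_mul_cancel_right]
    rw [this, ap_mul, dt_sl]
  symm
  apply Finset.card_bij' (fun e _ => ap n.1 e) (fun e _ => ap n⁻¹.1 e)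
  · intro e he
    simp only [Finset.mem_filter, Finset.mem_univ, true_and] at he ⊢
    exact ⟨ap_ne_zero n he.1, by rw [key]; exact he.2⟩
  · intro e he
    simp only [Finset.mem_filter, Finset.mem_univ, true_and] at he ⊢
    exact ⟨ap_ne_zero n⁻¹ he.1, by rw [← key, ap_ap_inv]; exact he.2⟩
  · intro e _; exact ap_inv_ap n e
  · intro e _; exact ap_ap_inv n e

lemma Fx_neg (τ : RingAut F) (A : SL F) : Fx τ (-A) = Fx τ A := by
  simp only [Fx, dt_neg, neg_eq_zero]

lemma card_eigen {p b : ℕ} {σ : RingAut F} (h : Good p b σ) :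
    (Finset.univ.filter fun e : F × F => e ≠ 0 ∧ dt e (sg σ e) = 0).card
      = (p + 1) * (Fintype.card F - 1) := by
  have hfix : ∀ x : F, x = 0 ∨ x = 1 ∨ x = -1 ↔ σ x = x := by
    intro x
    refine ⟨?_, h.fixed x⟩
    rintro (rfl | rfl | rfl) <;> simp
  have : (Finset.univ.filter fun e : F × F => e ≠ 0 ∧ dt e (sg σ e) = 0)
      = (Finset.univ.erase (0 : F)).image (fun x => (x, (0 : F))) ∪
        ((({0, 1, -1} : Finset F) ×ˢ (Finset.univ.erase (0 : F))).image
          fun x => (x.1 * x.2, x.2)) := by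
    ext ⟨x, y⟩
    simp only [Finset.mem_filter, Finset.mem_univ, true_and, dt_sg_self, Finset.mem_union,
      Finset.mem_image, Finset.mem_erase, Finset.mem_product, Finset.mem_insert,
      Finset.mem_singleton, hfix, and_true, Prod.mk.injEq, Prod.exists]
    constructor
    · rintro ⟨h1, h2⟩
      by_cases hy : y = 0
      · left
        refine ⟨x, ?_, rfl, hy.symm⟩
        rintro rfl; exact h1 (by simp [hy])
      · right
        refine ⟨x / y, y, ⟨h2.resolve_left hy, hy⟩, by field_simp, rfl⟩
    · rintro (⟨z, hz, rfl, rfl⟩ | ⟨c, z, ⟨hc, hz⟩, rfl, rfl⟩)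
      · simp [hz]
      · simp [hz, hc]
  rw [this, Finset.card_union_of_disjoint, Finset.card_image_of_injective, Finset.card_image_of_injOn,
    Finset.card_product, card_prime_field h, Finset.card_erase_of_mem (Finset.mem_univ _),
    Finset.card_univ]
  · ring
  · rintro ⟨c, y⟩ h1 ⟨c', y'⟩ h2 h3
    simp only [Prod.mk.injEq] at h3
    obtain ⟨h3, rfl⟩ := h3
    simp at h1
    simpa [h1.2] using h3
  · intro x y hxy; simpa using hxy
  · rw [Finset.disjoint_left]
    simp only [Finset.mem_image, not_exists]
    rintro _ ⟨x, _, rfl⟩ ⟨c, y⟩ h2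
    simp only [Finset.mem_product, Finset.mem_erase, Prod.mk.injEq] at h2
    exact h2.1.2.1 h2.2.2

lemma Fx_one {p b : ℕ} {σ : RingAut F} (h : Good p b σ) :
    Fx (σ * σ) 1 = (p + 1) * (Fintype.card F - 1) := by
  rw [← card_eigen h, Fx]
  congr 1
  ext e
  simp only [val_one, ap_one, h.dt_sq_iff]

lemma Fx_um {p b : ℕ} {σ : RingAut F} (h : Good p b σ) {c : F} (hc : σ c = c) (hc0 : c ≠ 0) :
    Fx (σ * σ) (um c) = Fintype.card F - 1 := by
  have : (Finset.univ.filter fun e : F × F => e ≠ 0 ∧ dt e (ap (um c).1 (sg (σ * σ) e)) = 0)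
      = (Finset.univ.erase (0 : F)).image (fun x => (x, (0 : F))) := by
    ext ⟨x, y⟩
    simp only [Finset.mem_filter, Finset.mem_univ, true_and,
      Finset.mem_image, Finset.mem_erase, and_true, Prod.mk.injEq]
    constructor
    · rintro ⟨h1, h2⟩
      by_cases hy : y = 0
      · refine ⟨x, ?_, rfl, hy.symm⟩
        rintro rfl; exact h1 (by simp [hy])
      · exfalso
        obtain ⟨s, hs⟩ := Good.exists_sub (σ := σ) (x / y)
        apply h.one_ne hc hc0 s
        have hy' : (σ * σ) y ≠ 0 := by simpa using hy
        rw [hs, map_div₀]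
        simp [dt, ap, sg] at h2
        rw [RingAut.mul_apply, RingAut.mul_apply] at *
        field_simp
        linear_combination h2
    · rintro ⟨z, hz, rfl, rfl⟩
      simp [hz, dt, ap, sg]
  rw [Fx, this, Finset.card_image_of_injective, Finset.card_erase_of_mem (Finset.mem_univ _),
    Finset.card_univ]
  intro x y hxy; simpa using hxy

lemma card_transporter {e w : F × F} (he : e ≠ 0) (hw : w ≠ 0) :
    (Finset.univ.filter fun k : SL F => ap k.1 e = w).card = Fintype.card F := by
  obtain ⟨n, rfl⟩ := exists_ap_eq he
  obtain ⟨m, rfl⟩ := exists_ap_eq hw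
  have : (Finset.univ.filter fun k : SL F => ap k.1 (ap n.1 (1, 0)) = ap m.1 (1, 0))
      = Finset.univ.image fun t => m * um t * n⁻¹ := by
    ext k
    simp only [Finset.mem_filter, Finset.mem_univ, true_and, Finset.mem_image]
    constructor
    · intro hk
      have h1 : ap (m⁻¹ * k * n).1 (1, 0) = (1, 0) := by
        rw [val_mul, val_mul, ap_mul, ap_mul, hk, ap_inv_ap]
      have h00 : (m⁻¹ * k * n) 0 0 = 1 := by simpa [ap] using congrArg Prod.fst h1
      have h10 : (m⁻¹ * k * n) 1 0 = 0 := by simpa [ap] using congrArg Prod.snd h1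
      have hd := sl_det (m⁻¹ * k * n)
      refine ⟨(m⁻¹ * k * n) 0 1, ?_⟩
      have : um ((m⁻¹ * k * n) 0 1) = m⁻¹ * k * n := by
        apply sl_ext
        · simpa using h00.symm
        · rfl
        · simpa using h10.symm
        · rw [h00, h10] at hd
          rw [um11]; linear_combination -hd
      rw [this]; group
    · rintro ⟨t, rfl⟩
      rw [val_mul, val_mul, ap_mul, ap_mul, ap_inv_ap]
      congr 1
      simp [ap]
  rw [this, Finset.card_image_of_injective, Finset.card_univ]
  intro s t hst
  exact um_inj (mul_left_cancel (mul_right_cancel hst))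

lemma card_ne_zero : (Finset.univ.filter fun e : F × F => e ≠ 0).card = Fintype.card F ^ 2 - 1 := by
  rw [Finset.filter_ne', Finset.card_erase_of_mem (Finset.mem_univ _), Finset.card_univ,
    Fintype.card_prod, sq]

lemma card_SL : Fintype.card (SL F) = (Fintype.card F ^ 2 - 1) * Fintype.card F := by
  rw [← card_ne_zero, ← Finset.card_univ,
    Finset.card_eq_sum_card_fiberwise (f := fun k : SL F => ap k.1 (1, 0))
      (t := Finset.univ.filter fun e : F × F => e ≠ 0)]
  · rw [Finset.sum_congr rfl (fun w hw => card_transporter (by simp) (by simpa using hw))]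
    simp
  · intro k _
    simpa using ap_ne_zero k (e := (1, 0)) (by simp)

end

section

variable {F : Type*} [Field F]

lemma exists_smul_of_dt {v w : F × F} (hv : v ≠ 0) (h : dt v w = 0) : ∃ μ : F, w = μ • v := by
  obtain ⟨x, y⟩ := v
  obtain ⟨z, t⟩ := w
  simp only [dt] at h
  by_cases hx : x = 0
  · have hy : y ≠ 0 := by rintro rfl; simp [hx] at hv
    refine ⟨t / y, ?_⟩
    subst hx
    have : z = 0 := by simpa [hy] using h
    ext
    · simp [this]
    · simp [hy]
  · refine ⟨z / x, ?_⟩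
    ext
    · simp [hx]
    · simp only [Prod.smul_mk, smul_eq_mul]
      field_simp
      linear_combination h

lemma dt_smul_left (c : F) (v w : F × F) : dt (c • v) w = c * dt v w := by
  simp [dt]; ring

lemma dt_smul_right (c : F) (v w : F × F) : dt v (c • w) = c * dt v w := by
  simp [dt]; ring

lemma dt_swap (v w : F × F) : dt w v = -dt v w := by
  simp [dt]; ring

lemma dt_self (v : F × F) : dt v v = 0 := by
  simp [dt]; ring

lemma sg_ne_zero (σ : RingAut F) {e : F × F} (he : e ≠ 0) : sg σ e ≠ 0 := by
  intro h
  apply he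
  have h1 := congrArg Prod.fst h
  have h2 := congrArg Prod.snd h
  ext
  · simpa [sg] using h1
  · simpa [sg] using h2

lemma cols_inj {v w v' w' : F × F} (h : cols v w = cols v' w') : v = v' ∧ w = w' := by
  have h00 := congrFun (congrFun h 0) 0
  have h01 := congrFun (congrFun h 0) 1
  have h10 := congrFun (congrFun h 1) 0
  have h11 := congrFun (congrFun h 1) 1
  simp [cols] at h00 h01 h10 h11
  constructor <;> ext <;> assumption

lemma dt_coboundary (σ : RingAut F) (k : SL F) (e : F × F) :
    dt e (ap (k⁻¹ * fa σ k).1 (sg (σ * σ) e)) = dt (ap k.1 e) (sg σ (ap k.1 (sg σ e))) := by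
  rw [sg_ap, ← coe_fa, val_mul, ap_mul, ← dt_sl k e, ap_ap_inv, sg_mul]

variable [DecidableEq F] [Fintype F]

lemma card_of_dt_eq_zero {p b : ℕ} {σ : RingAut F} (h : Good p b σ) {e : F × F} (he : e ≠ 0)
    (hd : dt e (sg σ e) = 0) :
    (Finset.univ.filter fun k : SL F => dt (ap k.1 e) (sg σ (ap k.1 (sg σ e))) = 0).card
      = (p + 1) * (Fintype.card F - 1) * Fintype.card F := by
  obtain ⟨μ, hμ⟩ := exists_smul_of_dt he hd
  have hμ0 : μ ≠ 0 := by
    rintro rfl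
    exact sg_ne_zero σ he (by rw [hμ, zero_smul])
  have : (Finset.univ.filter fun k : SL F => dt (ap k.1 e) (sg σ (ap k.1 (sg σ e))) = 0)
      = Finset.univ.filter fun k : SL F => dt (ap k.1 e) (sg σ (ap k.1 e)) = 0 := by
    ext k
    simp [hμ, ap_smul, sg_smul, dt_smul_right, hμ0]
  rw [this, ← card_eigen h, Finset.card_eq_sum_card_fiberwise (f := fun k : SL F => ap k.1 e)
      (t := Finset.univ.filter fun e : F × F => e ≠ 0 ∧ dt e (sg σ e) = 0)]
  · rw [← smul_eq_mul, ← Finset.sum_const]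
    refine Finset.sum_congr rfl fun w hw => ?_
    simp only [Finset.mem_filter, Finset.mem_univ, true_and] at hw
    rw [← card_transporter he hw.1]
    congr 1
    ext k
    simp only [Finset.mem_filter, Finset.mem_univ, true_and, and_iff_right_iff_imp]
    rintro rfl
    exact hw.2
  · intro k hk
    simp only [Finset.coe_filter, Finset.mem_univ, true_and, Set.mem_ofPred_eq] at hk ⊢
    exact ⟨ap_ne_zero k he, hk⟩

lemma card_of_dt_ne_zero {σ : RingAut F} {e : F × F} (hd : dt e (sg σ e) ≠ 0) :
    (Finset.univ.filter fun k : SL F => dt (ap k.1 e) (sg σ (ap k.1 (sg σ e))) = 0).card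
      = (Finset.univ.filter fun w : F × F => dt w (sg σ w) ≠ 0).card := by
  apply Finset.card_bij (fun k _ => ap k.1 (sg σ e))
  · intro k hk
    simp only [Finset.mem_filter, Finset.mem_univ, true_and] at hk ⊢
    intro h0
    have hw0 : ap k.1 (sg σ e) ≠ 0 := by
      intro h1
      rw [← dt_sl k, h1] at hd
      simp [dt] at hd
    obtain ⟨μ, hμ⟩ := exists_smul_of_dt hw0 h0
    have hμ0 : μ ≠ 0 := by
      rintro rfl
      exact sg_ne_zero σ hw0 (by rw [hμ, zero_smul])
    rw [hμ, dt_smul_right, dt_sl] at hk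
    exact mul_ne_zero hμ0 hd hk
  · intro k hk k' hk' hkk
    simp only [Finset.mem_filter, Finset.mem_univ, true_and] at hk hk'
    set w := ap k.1 (sg σ e) with hw
    have h1 : dt (ap k.1 e) w = dt e (sg σ e) := dt_sl k _ _
    have h2 : dt (ap k'.1 e) w = dt e (sg σ e) := by rw [hkk]; exact dt_sl k' _ _
    rw [← hkk] at hk'
    have hne : dt w (sg σ w) ≠ 0 := by
      intro h0
      have hw0 : w ≠ 0 := by
        rintro h3
        rw [← h1, h3] at hd
        simp [dt] at hd
      obtain ⟨μ, hμ⟩ := exists_smul_of_dt hw0 h0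
      have hμ0 : μ ≠ 0 := by
        rintro rfl
        exact sg_ne_zero σ hw0 (by rw [hμ, zero_smul])
      rw [hμ, dt_smul_right, h1] at hk
      exact mul_ne_zero hμ0 hd hk
    have h3 : ap k.1 e = ap k'.1 e := by
      generalize ap k.1 e = v at *
      generalize ap k'.1 e = v' at *
      generalize sg σ w = w' at *
      rw [← h2] at h1
      simp only [dt] at *
      ext
      · apply mul_left_cancel₀ hne
        linear_combination -w'.1 * h1 + w.1 * hk - w.1 * hk'
      · apply mul_left_cancel₀ hne
        linear_combination -w'.2 * h1 + w.2 * hk - w.2 * hk'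
    have h4 : k.1 * cols e (sg σ e) = k'.1 * cols e (sg σ e) := by
      rw [mul_cols, mul_cols, h3, ← hkk]
    apply Subtype.ext
    have hu : IsUnit (cols e (sg σ e)) := by
      rw [isUnit_iff_isUnit_det, det_cols]
      exact isUnit_iff_ne_zero.2 hd
    exact hu.mul_right_cancel h4
  · intro w hw
    simp only [Finset.mem_filter, Finset.mem_univ, true_and] at hw
    have hw' : dt (sg σ w) w ≠ 0 := by rw [dt_swap]; exact neg_ne_zero.2 hw
    set w1 : F × F := (dt e (sg σ e) / dt (sg σ w) w) • sg σ w with hw1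
    have hdw : dt w1 w = dt e (sg σ e) := by
      rw [hw1, dt_smul_left]; field_simp
    have hu : IsUnit (cols e (sg σ e)).det := by
      rw [det_cols]
      exact isUnit_iff_ne_zero.2 hd
    let k : SL F := ⟨cols w1 w * (cols e (sg σ e))⁻¹, by
      rw [det_mul, det_nonsing_inv, det_cols, det_cols, hdw, Ring.inverse_eq_inv',
        mul_inv_cancel₀ hd]⟩
    have hk : k.1 * cols e (sg σ e) = cols w1 w := by
      change cols w1 w * (cols e (sg σ e))⁻¹ * cols e (sg σ e) = _
      rw [nonsing_inv_mul_cancel_right _ _ hu]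
    rw [mul_cols] at hk
    obtain ⟨hk1, hk2⟩ := cols_inj hk
    refine ⟨k, ?_, hk2⟩
    simp only [Finset.mem_filter, Finset.mem_univ, true_and]
    rw [hk1, hk2, hw1, dt_smul_left, dt_self, mul_zero]

lemma sum_Fx {p b : ℕ} {σ : RingAut F} (h : Good p b σ) :
    ∑ k : SL F, (Fx (σ * σ) (k⁻¹ * fa σ k) : ℤ) =
      ((p + 1) * ((Fintype.card F : ℤ) - 1)) ^ 2 * Fintype.card F +
        ((Fintype.card F : ℤ) ^ 2 - 1 - (p + 1) * ((Fintype.card F : ℤ) - 1)) ^ 2 := by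
  have hq : 1 ≤ Fintype.card F := Fintype.card_pos
  have hq2 : 1 ≤ Fintype.card F ^ 2 := Nat.one_le_pow _ _ hq
  have h1 := Finset.sum_card_bipartiteAbove_eq_sum_card_bipartiteBelow
    (s := (Finset.univ : Finset (SL F))) (t := Finset.univ.filter fun e : F × F => e ≠ 0)
    (fun k e => dt (ap k.1 e) (sg σ (ap k.1 (sg σ e))) = 0)
  have h2 : ∑ k : SL F, Fx (σ * σ) (k⁻¹ * fa σ k) =
      ∑ e ∈ Finset.univ.filter fun e : F × F => e ≠ 0,
        (Finset.univ.filter fun k : SL F => dt (ap k.1 e) (sg σ (ap k.1 (sg σ e))) = 0).card := by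
    refine Eq.trans ?_ h1
    refine Finset.sum_congr rfl fun k _ => ?_
    rw [Fx, Finset.bipartiteAbove, Finset.filter_filter]
    simp only [dt_coboundary]
  have h3 : (Finset.univ.filter fun w : F × F => dt w (sg σ w) ≠ 0)
      = (Finset.univ.filter fun e : F × F => e ≠ 0).filter fun w => ¬ dt w (sg σ w) = 0 := by
    rw [Finset.filter_filter]
    ext w
    simp only [Finset.mem_filter, Finset.mem_univ, true_and, ne_eq, iff_and_self]
    rintro hw rfl
    exact hw (by simp [dt])
  have h4 := Finset.card_filter_add_card_filter_not
    (s := Finset.univ.filter fun e : F × F => e ≠ 0) (fun w => dt w (sg σ w) = 0)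
  have h5 : ((Finset.univ.filter fun e : F × F => e ≠ 0).filter fun w => dt w (sg σ w) = 0).card
      = (p + 1) * (Fintype.card F - 1) := by
    rw [Finset.filter_filter, card_eigen h]
  have h6 := Finset.sum_filter_add_sum_filter_not (Finset.univ.filter fun e : F × F => e ≠ 0)
    (fun w => dt w (sg σ w) = 0) (fun e =>
      (Finset.univ.filter fun k : SL F => dt (ap k.1 e) (sg σ (ap k.1 (sg σ e))) = 0).card)
  have h7 := Finset.sum_congr (s₁ := (Finset.univ.filter fun e : F × F => e ≠ 0).filter
    fun w => dt w (sg σ w) = 0) rfl (fun e he => card_of_dt_eq_zero (e := e) h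
      (Finset.mem_filter.1 (Finset.mem_filter.1 he).1).2 (Finset.mem_filter.1 he).2)
  have h8 := Finset.sum_congr (s₁ := (Finset.univ.filter fun e : F × F => e ≠ 0).filter
    fun w => ¬ dt w (sg σ w) = 0) rfl (fun e he => card_of_dt_ne_zero (e := e)
      (Finset.mem_filter.1 he).2)
  rw [Finset.sum_const, h5] at h7
  rw [Finset.sum_const, h3] at h8
  rw [h5, card_ne_zero] at h4
  rw [← Nat.cast_sum, h2, ← h6, h7, h8]
  zify [hq, hq2] at h4
  have h9 := eq_sub_of_add_eq' h4
  push_cast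
  simp only [smul_eq_mul]
  push_cast
  rw [h9, Nat.cast_sub hq]
  push_cast
  ring

end

section

variable {F : Type*} [Field F] [DecidableEq F] [Fintype F]

omit [DecidableEq F] in
lemma Good.dvd_card {p b : ℕ} {σ : RingAut F} (h : Good p b σ) : p ∣ Fintype.card F := by
  have := h.charP
  rw [← CharP.eq F (CharP.addOrderOf_one F) this]
  exact addOrderOf_dvd_card

lemma Good.prime {p b : ℕ} {σ : RingAut F} (h : Good p b σ) : p.Prime := by
  rcases h.two_or_three with rfl | rfl <;> norm_num

lemma um_pow_char {p b : ℕ} {σ : RingAut F} (h : Good p b σ) (t : F) : um t ^ p = 1 := by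
  have := h.charP
  rw [um_pow, CharP.cast_eq_zero, zero_mul, um_zero]

/-- The coboundaries with the maximal number of preserved lines. -/
def maxCob (p : ℕ) (σ : RingAut F) : Finset (SL F) :=
  Finset.univ.filter fun A => (∃ k, k⁻¹ * fa σ k = A) ∧
    Fx (σ * σ) A = (p + 1) * (Fintype.card F - 1)

lemma mem_maxCob {p : ℕ} {σ : RingAut F} {A : SL F} : A ∈ maxCob p σ ↔
    (∃ k, k⁻¹ * fa σ k = A) ∧ Fx (σ * σ) A = (p + 1) * (Fintype.card F - 1) := by
  simp [maxCob]

lemma um_mem_maxCob {p b : ℕ} {σ : RingAut F} (h : Good p b σ) (r : F) :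
    um (r - σ r) ∈ maxCob p σ := by
  rw [mem_maxCob]
  constructor
  · refine ⟨um (-r), ?_⟩
    rw [fa_um, ← um_neg, ← um_add]
    congr 1
    rw [map_neg]; ring
  · obtain ⟨s, hs⟩ := h.exists_sq_sub r
    rw [← Fx_one h, ← Fx_twist (σ * σ) (um s) 1, ← hs, fa_um, ← um_neg, mul_one, ← um_add,
      sub_eq_add_neg]

lemma exists_eq_um_of_commute {p b : ℕ} {σ : RingAut F} (h : Good p b σ) {A : SL F}
    (hA : A ∈ maxCob p σ) (hc : um 1 * A = A * um 1) : ∃ r, A = um (r - σ r) := by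
  obtain ⟨⟨k, hk⟩, -⟩ := mem_maxCob.1 hA
  have h00 := congrArg (fun M : SL F => M 0 0) hc
  have h01 := congrArg (fun M : SL F => M 0 1) hc
  simp [mul00, mul01] at h00 h01
  have hd := sl_det A
  have h11 : A 1 1 = A 0 0 := by linear_combination h01
  rw [h00, h11, mul_zero, sub_zero] at hd
  have hk' : fa σ k = k * A := by rw [← hk]; group
  have k00 := congrArg (fun M : SL F => M 0 0) hk'
  have k10 := congrArg (fun M : SL F => M 1 0) hk'
  have k01 := congrArg (fun M : SL F => M 0 1) hk'
  have k11 := congrArg (fun M : SL F => M 1 1) hk'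
  simp [mul00, mul01, mul10, mul11, h00, h11] at k00 k10 k01 k11
  have hkd := sl_det k
  have hA00 : A 0 0 = 1 := by
    rcases mul_self_eq_one_iff.1 hd with h1 | h1
    · exact h1
    · rw [h1] at k00 k10 ⊢
      have e1 : σ (k 0 0) = k 0 0 := by
        apply h.sq_fixed
        rw [RingAut.mul_apply, k00, map_mul, k00]; simp
      have e2 : σ (k 1 0) = k 1 0 := by
        apply h.sq_fixed
        rw [RingAut.mul_apply, k10, map_mul, k10]; simp
      rw [e1] at k00
      rw [e2] at k10
      linear_combination 2 * hkd - k 1 1 * k00 + k 0 1 * k10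
  rw [hA00, mul_one] at k00 k10 k01 k11
  have hAu : A = um (A 0 1) := by
    apply sl_ext
    · exact hA00
    · rfl
    · exact h00
    · rw [h11]; exact hA00
  rw [hAu]
  by_cases hz : k 0 0 = 0
  · have hz' : k 1 0 ≠ 0 := by
      intro h0; rw [hz, h0] at hkd; simp at hkd
    have := h.order_two k10 hz'
    refine ⟨-(k 1 0 * k 1 1), ?_⟩
    congr 1
    rw [map_neg, map_mul, k10, k11]
    linear_combination -A 0 1 * this
  · have := h.order_two k00 hz
    refine ⟨-(k 0 0 * k 0 1), ?_⟩
    congr 1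
    rw [map_neg, map_mul, k00, k01]
    linear_combination -A 0 1 * this

lemma dvd_card_maxCob {p b : ℕ} {σ : RingAut F} (h : Good p b σ) : p ∣ (maxCob p σ).card := by
  have hpp : Fact p.Prime := ⟨h.prime⟩
  let f : Function.End (maxCob p σ) := fun A => ⟨um 1 * A.1 * (um 1)⁻¹, by
    obtain ⟨⟨k, hk⟩, hA⟩ := mem_maxCob.1 A.2
    rw [mem_maxCob]
    refine ⟨⟨k * (um 1)⁻¹, ?_⟩, ?_⟩
    · rw [← hk, map_mul, map_inv, fa_um, map_one]; group
    · rw [← hA, ← Fx_twist (σ * σ) (um 1) A.1, fa_um, map_one]⟩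
  have hf : ∀ (n : ℕ) (A : maxCob p σ), ((f ^ n) A).1 = um 1 ^ n * A.1 * (um 1 ^ n)⁻¹ := by
    intro n
    induction n with
    | zero => intro A; simp; rfl
    | succ n ih =>
      intro A
      rw [pow_succ']
      change um 1 * ((f ^ n) A).1 * (um 1)⁻¹ = _
      rw [ih, pow_succ']; group
  have hf1 : f ^ p ^ 1 = 1 := by
    funext A
    apply Subtype.ext
    rw [pow_one, hf, um_pow_char h]; simp; rfl
  have h1 := Equiv.Perm.card_fixedPoints_modEq hf1
  have hch := h.charP
  let D : AddSubgroup F := (AddMonoidHom.id F - (σ : F →+* F).toAddMonoidHom).range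
  have hD : ∀ t, t ∈ D ↔ ∃ r, r - σ r = t := fun t => Iff.rfl
  have h2 : Fintype.card (Function.fixedPoints f) = Nat.card D := by
    rw [← Nat.card_eq_fintype_card]
    symm
    refine Nat.card_congr (Equiv.ofBijective
      (fun t => ⟨⟨um t.1, by obtain ⟨r, hr⟩ := t.2; rw [← hr]; exact um_mem_maxCob h r⟩, ?_⟩) ⟨?_, ?_⟩)
    · apply Subtype.ext
      change um 1 * um t.1 * (um 1)⁻¹ = um t.1
      rw [← um_add, ← um_neg, ← um_add]; congr 1; ring
    · intro s t hst
      apply Subtype.ext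
      exact um_inj (congrArg (fun x => x.1.1) hst)
    · rintro ⟨A, hA⟩
      have hA' : um 1 * A.1 * (um 1)⁻¹ = A.1 := congrArg Subtype.val hA
      obtain ⟨r, hr⟩ := exists_eq_um_of_commute h A.2 (mul_inv_eq_iff_eq_mul.1 hA')
      refine ⟨⟨r - σ r, r, rfl⟩, ?_⟩
      apply Subtype.ext
      apply Subtype.ext
      exact hr.symm
  have h3 : p ∣ Nat.card D := by
    obtain ⟨x, hx⟩ := h.exists_not_fixed
    have hx' : x - σ x ≠ 0 := fun h0 => hx (sub_eq_zero.1 h0).symm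
    have : addOrderOf (⟨x - σ x, x, rfl⟩ : D) = p := by
      apply addOrderOf_eq_prime
      · apply Subtype.ext
        change p • (x - σ x) = 0
        rw [nsmul_eq_mul, CharP.cast_eq_zero, zero_mul]
      · intro h0
        exact hx' (congrArg Subtype.val h0)
    rw [← this]
    exact addOrderOf_dvd_natCard _
  rw [Fintype.card_coe, h2] at h1
  exact (Nat.ModEq.dvd_iff h1 dvd_rfl).2 h3

lemma sq_dvd_card {p b : ℕ} {σ : RingAut F} (h : Good p b σ) :
    p ^ 2 ∣ (Finset.univ.filter fun k : SL F =>
      Fx (σ * σ) (k⁻¹ * fa σ k) = (p + 1) * (Fintype.card F - 1)).card := by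
  have hpp : Fact p.Prime := ⟨h.prime⟩
  let S : Subgroup (SL F) := (MonoidHom.eqLocus (fa σ).toMonoidHom (MonoidHom.id (SL F)))
  have hS : p ∣ Nat.card S := by
    have : orderOf (⟨um 1, by change fa σ (um 1) = um 1; rw [fa_um, map_one]⟩ : S) = p := by
      apply orderOf_eq_prime
      · apply Subtype.ext
        exact um_pow_char h 1
      · intro h0
        have := congrArg Subtype.val h0
        exact one_ne_zero (um_inj (this.trans um_zero.symm))
    rw [← this]
    exact orderOf_dvd_natCard _
  rw [Finset.card_eq_sum_card_fiberwise (f := fun k => k⁻¹ * fa σ k) (t := maxCob p σ)]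
  · rw [Finset.sum_congr rfl (g := fun _ => Nat.card S)]
    · rw [Finset.sum_const, smul_eq_mul, sq]
      exact mul_dvd_mul (dvd_card_maxCob h) hS
    · intro A hA
      obtain ⟨⟨k0, hk0⟩, hFA⟩ := mem_maxCob.1 hA
      rw [← Fintype.card_coe, ← Nat.card_eq_fintype_card]
      symm
      refine Nat.card_congr (Equiv.ofBijective (fun n => ⟨n.1 * k0, ?_⟩) ⟨?_, ?_⟩)
      · have hn : fa σ n.1 = n.1 := n.2
        have hn2 : (n.1 * k0)⁻¹ * fa σ (n.1 * k0) = A := by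
          rw [map_mul, hn, ← hk0]; group
        simp only [Finset.mem_filter, Finset.mem_univ, true_and, hn2, and_true, hFA]
      · intro n n' hnn
        exact Subtype.ext (mul_right_cancel (congrArg Subtype.val hnn))
      · rintro ⟨k, hk⟩
        have hk2 : k⁻¹ * fa σ k = A := (Finset.mem_filter.1 hk).2
        refine ⟨⟨k * k0⁻¹, ?_⟩, ?_⟩
        · change fa σ (k * k0⁻¹) = k * k0⁻¹
          rw [← hk2, inv_mul_eq_iff_eq_mul] at hk0
          rw [map_mul, map_inv, hk0]; group
        · apply Subtype.ext
          change k * k0⁻¹ * k0 = k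
          group
  · intro k hk
    simp only [Finset.coe_filter, Finset.mem_univ, true_and, Set.mem_ofPred_eq] at hk
    exact mem_maxCob.2 ⟨⟨k, rfl⟩, hk⟩

lemma exists_elliptic {p b : ℕ} {σ : RingAut F} (h : Good p b σ) :
    ∃ H n g : SL F, IsElliptic σ g ∧ H * (fa σ H)⁻¹ = n * g * (fa (σ * σ) n)⁻¹ := by
  by_contra hcon
  have key : ∀ k : SL F, Fx (σ * σ) (k⁻¹ * fa σ k) = Fintype.card F - 1 ∨
      Fx (σ * σ) (k⁻¹ * fa σ k) = (p + 1) * (Fintype.card F - 1) := by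
    intro k
    obtain ⟨n, g, hg, hM⟩ := exists_fixed_twist fa (σ * σ) b
      (by rw [← h.sq_order]; exact pow_orderOf_eq_one _) h.coprime
      (fun M => exists_eq_mul_inv (by have := h.two_le; omega) h.sq_order M) (k⁻¹ * fa σ k)
    have hgσ : fa σ g = g := by
      ext i j
      apply h.sq_fixed
      have := congrArg (fun M : SL F => M i j) hg
      exact this
    have hell : ¬ IsElliptic σ g := fun hell =>
      hcon ⟨k⁻¹, n, g, hell, by rw [← hM, map_inv, inv_inv]⟩
    simp only [IsElliptic, hgσ, true_and, not_forall, not_not] at hell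
    obtain ⟨e, he, hse, hge⟩ := hell
    obtain ⟨N, c, hN, hc, hh⟩ := exists_conj_um h hgσ he hse hge
    have h2 : ∀ X : SL F, fa (σ * σ) X = fa σ (fa σ X) := fun X => by rw [map_mul]; rfl
    have hFg : Fx (σ * σ) g = Fx (σ * σ) (um c) := by
      have h3 := Fx_twist (σ * σ) N (um c)
      rw [h2, hN, hN] at h3
      rcases hh with hh | hh
      · rw [hh, h3]
      · rw [hh, Fx_neg, h3]
    rw [hM, Fx_twist, hFg]
    by_cases hc0 : c = 0
    · right; rw [hc0, um_zero, Fx_one h]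
    · left; exact Fx_um h hc hc0
  have hsum := sum_Fx h
  set q := Fintype.card F with hqdef
  have hq : 2 ≤ q := Fintype.one_lt_card
  set m := (Finset.univ.filter fun k : SL F =>
      Fx (σ * σ) (k⁻¹ * fa σ k) = (p + 1) * (q - 1)).card with hm
  have hpp := h.prime
  have hsum2 : ∑ k : SL F, (Fx (σ * σ) (k⁻¹ * fa σ k) : ℤ)
      = (q ^ 2 - 1) * q * (q - 1) + m * (p * (q - 1)) := by
    have : ∀ k : SL F, (Fx (σ * σ) (k⁻¹ * fa σ k) : ℤ) = (q - 1) +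
        if Fx (σ * σ) (k⁻¹ * fa σ k) = (p + 1) * (q - 1) then (p * (q - 1) : ℤ) else 0 := by
      intro k
      split_ifs with h1
      · rw [h1]; push_cast [Nat.cast_sub (show 1 ≤ q by omega)]; ring
      · rw [(key k).resolve_right h1]; push_cast [Nat.cast_sub (show 1 ≤ q by omega)]; ring
    rw [Finset.sum_congr rfl fun k _ => this k, Finset.sum_add_distrib, Finset.sum_const,
      ← Finset.sum_filter, Finset.sum_const, ← hm, Finset.card_univ, card_SL, ← hqdef]
    have hq2 : 1 ≤ q ^ 2 := Nat.one_le_pow _ _ (by omega)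
    simp only [nsmul_eq_mul]
    push_cast [Nat.cast_sub hq2]
    ring
  rw [hsum2] at hsum
  have hq' : (q : ℤ) - 1 ≠ 0 := by omega
  have hp0 : (p : ℤ) ≠ 0 := by exact_mod_cast hpp.ne_zero
  have hmeq : (m : ℤ) = p * (q ^ 2 - 1) := by
    apply mul_left_cancel₀ (mul_ne_zero hp0 hq')
    linear_combination hsum
  have hdvd : ((p : ℤ) * p) ∣ p * (q ^ 2 - 1) := by
    rw [← hmeq]
    have := sq_dvd_card h
    rw [sq] at this
    exact_mod_cast this
  have h3 : (p : ℤ) ∣ q ^ 2 - 1 := (mul_dvd_mul_iff_left hp0).1 hdvd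
  have h4 : (p : ℤ) ∣ q ^ 2 := by
    have : p ∣ q := h.dvd_card
    exact dvd_pow (by exact_mod_cast this) two_ne_zero
  have h5 : (p : ℤ) ∣ 1 := by
    have := dvd_sub h4 h3
    simpa using this
  have h6 : p ∣ 1 := by exact_mod_cast h5
  exact hpp.one_lt.ne' (Nat.dvd_one.1 h6)

end

section

variable {F : Type*} [Field F]

/-- The projection from `SL₂` to `PSL₂`. -/
def pr : SL F →* ProjectiveSpecialLinearGroup (Fin 2) F := QuotientGroup.mk' _

lemma pr_surjective : Function.Surjective (pr (F := F)) := QuotientGroup.mk'_surjective _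

lemma pr_eq_one {A : SL F} : pr A = 1 ↔ A = 1 ∨ A = -1 := by
  rw [pr, QuotientGroup.mk'_apply, QuotientGroup.eq_one_iff,
    Matrix.SpecialLinearGroup.mem_center_iff]
  constructor
  · rintro ⟨r, hr, hA⟩
    have h00 := congrFun (congrFun hA 0) 0
    have h01 := congrFun (congrFun hA 0) 1
    have h10 := congrFun (congrFun hA 1) 0
    have h11 := congrFun (congrFun hA 1) 1
    simp at h00 h01 h10 h11
    rw [Fintype.card_fin, sq_eq_one_iff] at hr
    rcases hr with rfl | rfl
    · left
      apply sl_ext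
      · exact h00.symm
      · exact h01.symm
      · exact h10.symm
      · exact h11.symm
    · right
      apply sl_ext
      · exact h00.symm
      · simpa using h01.symm
      · simpa using h10.symm
      · exact h11.symm
  · rintro (rfl | rfl)
    · exact ⟨1, by simp, by simp⟩
    · refine ⟨-1, by simp, ?_⟩
      ext i j
      fin_cases i <;> fin_cases j <;> simp

lemma pr_eq_iff {A B : SL F} : pr A = pr B ↔ A = B ∨ A = -B := by
  rw [← mul_inv_eq_one, ← map_inv, ← map_mul, pr_eq_one, mul_inv_eq_one, mul_inv_eq_iff_eq_mul,
    neg_one_mul]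

lemma pr_neg (A : SL F) : pr (-A) = pr A := pr_eq_iff.2 (Or.inr rfl)

/-- The action of `GL₂` on `SL₂` by conjugation. -/
def cj : GL (Fin 2) F →* MulAut (SL F) where
  toFun A :=
    { toFun := fun M => ⟨A.1 * M.1 * A⁻¹.1, by
        rw [det_mul, det_mul, M.2, mul_one, ← det_mul, ← Units.val_mul, mul_inv_cancel]; simp⟩
      invFun := fun M => ⟨A⁻¹.1 * M.1 * A.1, by
        rw [det_mul, det_mul, M.2, mul_one, ← det_mul, ← Units.val_mul, inv_mul_cancel]; simp⟩
      left_inv := fun M => by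
        apply Subtype.ext
        change A⁻¹.1 * (A.1 * M.1 * A⁻¹.1) * A.1 = M.1
        simp only [mul_assoc]
        rw [Units.inv_mul, mul_one, ← mul_assoc, Units.inv_mul, one_mul]
      right_inv := fun M => by
        apply Subtype.ext
        change A.1 * (A⁻¹.1 * M.1 * A.1) * A⁻¹.1 = M.1
        simp only [mul_assoc]
        rw [Units.mul_inv, mul_one, ← mul_assoc, Units.mul_inv, one_mul]
      map_mul' := fun M N => by
        apply Subtype.ext
        change A.1 * (M.1 * N.1) * A⁻¹.1 = (A.1 * M.1 * A⁻¹.1) * (A.1 * N.1 * A⁻¹.1)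
        simp only [mul_assoc]
        rw [← mul_assoc A⁻¹.1 A.1, Units.inv_mul, one_mul] }
  map_one' := by
    ext M i j
    change ((1 : GL (Fin 2) F).1 * M.1 * ((1 : GL (Fin 2) F)⁻¹).1) i j = _
    simp
  map_mul' A B := by
    ext M i j
    change (A.1 * B.1 * M.1 * (A * B)⁻¹.1) i j = (A.1 * (B.1 * M.1 * B⁻¹.1) * A⁻¹.1) i j
    rw [_root_.mul_inv_rev, Units.val_mul]
    simp only [mul_assoc]

lemma cj_val (A : GL (Fin 2) F) (M : SL F) : (cj A M).1 = A.1 * M.1 * A⁻¹.1 := rfl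

lemma cj_eq_iff {A : GL (Fin 2) F} {M N : SL F} : cj A M = N ↔ A.1 * M.1 = N.1 * A.1 := by
  constructor
  · rintro rfl
    rw [cj_val, mul_assoc, Units.inv_mul, mul_one]
  · intro h
    apply Subtype.ext
    rw [cj_val, h, mul_assoc, Units.mul_inv, mul_one]

/-- An automorphism of `PSL₂` induced by an automorphism of `SL₂`. -/
def descend (e : MulAut (SL F)) : MulAut (ProjectiveSpecialLinearGroup (Fin 2) F) :=
  QuotientGroup.congr _ _ e (Subgroup.characteristic_iff_map_eq.1 inferInstance e)

lemma descend_pr (e : MulAut (SL F)) (M : SL F) : descend e (pr M) = pr (e M) := rfl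

lemma pr_um_inj {s t : F} (h : pr (um s) = pr (um t)) : s = t := by
  rcases pr_eq_iff.1 h with h | h
  · exact um_inj h
  · have h00 := congrArg (fun M : SL F => M 0 0) h
    have h01 := congrArg (fun M : SL F => M 0 1) h
    simp at h00 h01
    rw [h01, neg_eq_neg_one_mul, ← h00, one_mul]

lemma two_eq_zero_or {p : ℕ} [CharP F p] (hp : p = 2 ∨ p = 3) : (2 : F) = 0 ∨ (2 : F) ≠ 0 ∧ (3 : F) = 0 := by
  rcases hp with rfl | rfl
  · left; exact_mod_cast CharP.cast_eq_zero F 2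
  · have h3 : (3 : F) = 0 := by exact_mod_cast CharP.cast_eq_zero F 3
    right
    refine ⟨fun h2 => one_ne_zero (α := F) (by linear_combination h3 - h2), h3⟩

/-- In characteristic two the centre of `SL₂` is trivial. -/
lemma eq_of_pr_eq {A B : SL F} (h : pr A = pr B) (h2 : (2 : F) = 0 ∨ A ≠ -B) : A = B := by
  rcases pr_eq_iff.1 h with h | h
  · exact h
  · rcases h2 with h2 | h2
    · rw [h]
      have : ∀ x : F, -x = x := fun x => by linear_combination -x * h2
      apply sl_ext <;> simp [this]
    · exact absurd h h2

lemma lm_eq (s : F) : lm s = (sm 0 1 (-1) 0 (by simp)) * um (-s) * (sm 0 1 (-1) 0 (by simp))⁻¹ := by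
  apply sl_ext <;> simp [mul00, mul01, mul10, mul11, inv00, inv01, inv10, inv11]

/-- Upper and lower unitriangular matrices generate `SL₂`. -/
lemma hom_ext_um_lm {H : Type*} [Group H] {f g : SL F →* H} (hu : ∀ s, f (um s) = g (um s))
    (hl : ∀ s, f (lm s) = g (lm s)) : f = g := by
  have main : ∀ M : SL F, M 1 0 ≠ 0 → f M = g M := by
    intro M hM
    have hd := sl_det M
    have : M = um ((M 0 0 - 1) / M 1 0) * lm (M 1 0) * um ((M 1 1 - 1) / M 1 0) := by
      apply sl_ext <;> simp [mul00, mul01, mul10, mul11] <;> field_simp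
      · ring
      · linear_combination -hd
      · ring
    rw [this]
    simp only [map_mul, hu, hl]
  ext M
  by_cases hM : M 1 0 = 0
  · have hd := sl_det M
    have e : f (M * lm 1) = g (M * lm 1) := by
      refine main _ fun h0 => ?_
      simp [mul10, hM] at h0
      simp [hM, h0] at hd
    rw [map_mul, map_mul, hl] at e
    exact mul_right_cancel e
  · exact main M hM

end

section

variable {F : Type*} [Field F] {p : ℕ} [CharP F p]

/-- An element of order `p` in `PSL₂` is conjugate under `GL₂` to the image of `um 1`. -/
lemma exists_cj_um [Fact p.Prime] (hp : p = 2 ∨ p = 3) {Y : SL F} (h1 : pr Y ≠ 1)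
    (hY : pr Y ^ p = 1) :
    ∃ A : GL (Fin 2) F, pr (cj A (um 1)) = pr Y := by
  wlog hYp : Y ^ p = 1 generalizing Y with H
  · rw [← map_pow, pr_eq_one] at hY
    have h2 : (-Y) ^ p = 1 := by
      rcases hY with hY | hY
      · exact absurd hY hYp
      · rcases hp with rfl | rfl
        · have h2 : (2 : F) = 0 := by exact_mod_cast CharP.cast_eq_zero F 2
          have : ∀ x : F, -x = x := fun x => by linear_combination -x * h2
          refine absurd (hY.trans ?_) hYp
          apply sl_ext <;> simp [this]
        · rw [Odd.neg_pow (by decide), hY, neg_neg]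
    have := H (Y := -Y) (by rwa [pr_neg]) (by rw [← map_pow, h2, map_one]) h2
    rwa [pr_neg] at this
  have hn : (Y.1 - 1) ^ p = 0 := by
    have hc : Y.1 ^ p = 1 := (Matrix.SpecialLinearGroup.coe_pow Y p).symm.trans
      (congrArg (fun M : SL F => M.1) hYp)
    rw [sub_pow_char_of_commute _ (Commute.one_right _), one_pow, hc, sub_self]
  have hd : (Y.1 - 1).det = 0 := by
    have := congrArg Matrix.det hn
    rw [det_pow, det_zero] at this
    exact pow_eq_zero_iff (Fact.out : p.Prime).ne_zero |>.1 this
  have hdet := sl_det Y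
  have htr : Y 0 0 + Y 1 1 = 2 := by
    rw [det_fin_two] at hd
    simp at hd
    linear_combination hdet - hd
  by_cases hc : Y 1 0 = 0
  · rw [hc, mul_zero, sub_zero] at hdet
    have h00 : Y 0 0 = 1 := by
      have : (Y 0 0 - 1) ^ 2 = 0 := by linear_combination Y 0 0 * htr - hdet
      exact sub_eq_zero.1 (pow_eq_zero_iff two_ne_zero |>.1 this)
    have h11 : Y 1 1 = 1 := by linear_combination htr - h00
    have h01 : Y 0 1 ≠ 0 := by
      intro h
      apply h1
      rw [show Y = 1 from sl_ext h00 h hc h11, map_one]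
    refine ⟨GeneralLinearGroup.mkOfDetNeZero !![Y 0 1, 0; 0, 1] (by simpa using h01), ?_⟩
    congr 1
    rw [cj_eq_iff]
    change !![Y 0 1, 0; 0, 1] * !![1, 1; 0, 1] = Y.1 * !![Y 0 1, 0; 0, 1]
    rw [eta_fin_two Y.1, mul_fin_two, mul_fin_two]
    congr! 3 <;> simp [h00, h11, hc]
  · refine ⟨GeneralLinearGroup.mkOfDetNeZero !![Y 0 0 - 1, 1; Y 1 0, 0] (by simpa using hc), ?_⟩
    congr 1
    rw [cj_eq_iff]
    change !![Y 0 0 - 1, 1; Y 1 0, 0] * !![1, 1; 0, 1] = Y.1 * !![Y 0 0 - 1, 1; Y 1 0, 0]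
    rw [eta_fin_two Y.1, mul_fin_two, mul_fin_two]
    ext i j
    fin_cases i <;> fin_cases j <;> simp
    · linear_combination -Y 0 0 * htr + hdet
    · linear_combination -Y 1 0 * htr

/-- The centralizer of `um 1` in `PSL₂`. -/
lemma exists_um_of_commute (hp : p = 2 ∨ p = 3) {Z : SL F} (h : Commute (pr Z) (pr (um 1))) :
    ∃ a, pr Z = pr (um a) := by
  have h' : pr (Z * um 1) = pr (um 1 * Z) := by rw [map_mul, map_mul]; exact h
  have hdet := sl_det Z
  have e : Z * um 1 = um 1 * Z := by
    apply eq_of_pr_eq h'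
    rcases two_eq_zero_or (F := F) hp with h2 | ⟨h2, h3⟩
    · exact Or.inl h2
    right
    intro e
    have e10 := congrArg (fun M : SL F => M 1 0) e
    have e00 := congrArg (fun M : SL F => M 0 0) e
    have e11 := congrArg (fun M : SL F => M 1 1) e
    simp only [neg_app, mul00, mul10, mul11, um00, um01, um10, um11] at e00 e10 e11
    have hz : Z 1 0 = 0 := by
      have : 2 * Z 1 0 = 0 := by linear_combination e10
      exact (mul_eq_zero.1 this).resolve_left h2
    rw [hz] at e00 hdet
    have h0 : Z 0 0 = 0 := by
      have : 2 * Z 0 0 = 0 := by linear_combination e00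
      exact (mul_eq_zero.1 this).resolve_left h2
    simp [h0] at hdet
  have e00 := congrArg (fun M : SL F => M 0 0) e
  have e01 := congrArg (fun M : SL F => M 0 1) e
  simp [mul00, mul01] at e00 e01
  rw [e00, mul_zero, sub_zero] at hdet
  have hs : Z 0 0 = Z 1 1 := by linear_combination e01
  rw [← hs, ← sq, sq_eq_one_iff] at hdet
  rcases hdet with h0 | h0
  · exact ⟨Z 0 1, by congr 1; exact sl_ext h0 rfl e00 (hs ▸ h0)⟩
  · refine ⟨-Z 0 1, pr_eq_iff.2 (Or.inr ?_)⟩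
    apply sl_ext <;> simp [h0, e00, ← hs]

end

section

variable {F : Type*} [Field F]

lemma weyl_um {s : F} (hs : s ≠ 0) (t : F) :
    um s * lm (-s⁻¹) * um s * um t = lm (-(t / s ^ 2)) * (um s * lm (-s⁻¹) * um s) := by
  apply sl_ext <;>
    simp only [mul00, mul01, mul10, mul11, um00, um01, um10, um11, lm00, lm01, lm10, lm11] <;>
    field_simp <;> ring

/-- A homomorphism to `PSL₂` that respects the two root subgroups and is compatible with the same
additive map on both is induced by a field automorphism. -/
lemma exists_ringAut [Finite F] {p : ℕ} [Fact p.Prime] [CharP F p] (hp : p = 2 ∨ p = 3)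
    {f : SL F →* ProjectiveSpecialLinearGroup (Fin 2) F}
    (hf : ∀ s t, f (um s) = f (um t) → s = t) {a : F → F} (h1 : a 1 = 1)
    (hu : ∀ s, f (um s) = pr (um (a s))) (hl : ∀ s, f (lm s) = pr (lm (a s))) :
    ∃ σ : RingAut F, ∀ M, f M = pr (fa σ M) := by
  have hadd : ∀ s t, a (s + t) = a s + a t := fun s t => by
    apply pr_um_inj
    rw [← hu, um_add, map_mul, hu, hu, ← map_mul, ← um_add]
  have hinj : Function.Injective a := fun s t h => hf s t (by rw [hu, hu, h])
  have h0 : a 0 = 0 := by simpa using hadd 0 0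
  have hneg : ∀ s, a (-s) = -a s := fun s => by
    have := hadd s (-s)
    rw [add_neg_cancel, h0] at this
    linear_combination -this
  have key : ∀ s, s ≠ 0 → ∀ t,
      (1 + a s * a (-s⁻¹)) * a t = 0 ∧ a (-s⁻¹) * a t =
        a (-(t / s ^ 2)) * (a s * (2 + a s * a (-s⁻¹))) := by
    intro s hs t
    have hk : a (-s⁻¹) ≠ 0 := by
      rw [← h0]
      exact hinj.ne (by simpa using hs)
    have e := congrArg f (weyl_um hs t)
    simp only [map_mul, hu, hl] at e
    simp only [← map_mul] at e
    have e := eq_of_pr_eq e (by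
      rcases two_eq_zero_or (F := F) hp with h2 | ⟨h2, h3⟩
      · exact Or.inl h2
      right
      intro e
      have e00 := congrArg (fun M : SL F => M 0 0) e
      have e10 := congrArg (fun M : SL F => M 1 0) e
      simp only [neg_app, mul00, mul01, mul10, mul11, um00, um01, um10, um11, lm00, lm01, lm10,
        lm11] at e00 e10
      have m0 : 1 + a s * a (-s⁻¹) = 0 := by
        have : 2 * (1 + a s * a (-s⁻¹)) = 0 := by linear_combination e00
        exact (mul_eq_zero.1 this).resolve_left h2
      have : 2 * a (-s⁻¹) = 0 := by linear_combination e10 - a (-(t / s ^ 2)) * m0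
      exact hk ((mul_eq_zero.1 this).resolve_left h2))
    have e01 := congrArg (fun M : SL F => M 0 1) e
    have e11 := congrArg (fun M : SL F => M 1 1) e
    simp only [mul00, mul01, mul10, mul11, um00, um01, um10, um11, lm00, lm01, lm10, lm11]
      at e01 e11
    exact ⟨by linear_combination e01, by linear_combination e11⟩
  have hsq : ∀ s t, a (t * s ^ 2) = a t * a s ^ 2 := by
    intro s t
    rcases eq_or_ne s 0 with rfl | hs
    · simp [h0]
    have m0 := (key s hs 1).1
    rw [h1, mul_one] at m0
    have e := (key s hs (t * s ^ 2)).2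
    rw [show t * s ^ 2 / s ^ 2 = t by field_simp, hneg t] at e
    linear_combination (a (t * s ^ 2) + a t * a s ^ 2) * m0 - a s * e
  have hsq1 : ∀ s, a (s ^ 2) = a s ^ 2 := fun s => by simpa [h1] using hsq s 1
  have hmul : ∀ s t, a (s * t) = a s * a t := by
    intro s t
    rcases two_eq_zero_or (F := F) hp with h2 | ⟨h2, -⟩
    · have hs : Function.Surjective (fun x : F => x ^ 2) := by
        apply Finite.surjective_of_injective
        intro x y hxy
        have : (x - y) ^ 2 = 0 := by
          have hxy : x ^ 2 = y ^ 2 := hxy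
          linear_combination hxy + (y ^ 2 - x * y) * h2
        exact sub_eq_zero.1 (pow_eq_zero_iff two_ne_zero |>.1 this)
      obtain ⟨r, rfl⟩ := hs t
      exact (hsq r s).trans (by rw [hsq1])
    · have e := hsq1 (s + t)
      rw [show (s + t) ^ 2 = s ^ 2 + t ^ 2 + (s * t + s * t) by ring, hadd, hadd, hadd, hadd, hsq1,
        hsq1] at e
      apply mul_left_cancel₀ h2
      linear_combination e
  let σ : RingAut F := RingEquiv.ofBijective
    ({ toFun := a, map_one' := h1, map_mul' := hmul, map_zero' := h0, map_add' := hadd } : F →+* F)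
    (Finite.injective_iff_bijective.1 hinj)
  refine ⟨σ, fun M => ?_⟩
  refine DFunLike.congr_fun (f := f) (g := pr.comp (fa σ).toMonoidHom) (hom_ext_um_lm ?_ ?_) M
  · intro s
    rw [hu]
    exact congrArg pr (fa_um σ s).symm
  · intro s
    rw [hl]
    exact congrArg pr (fa_lm σ s).symm

end

section

variable {F : Type*} [Field F]

/-- The Weyl element of `SL₂`. -/
def wl : SL F := sm 0 1 (-1) 0 (by simp)

lemma wl_eq : (wl : SL F) = um 1 * lm (-1) * um 1 := by
  apply sl_ext <;> simp [wl, mul00, mul01, mul10, mul11]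

lemma cj_coe (g M : SL F) : cj (Matrix.SpecialLinearGroup.toGL g) M = g * M * g⁻¹ := by
  rw [cj_eq_iff]
  change g.1 * M.1 = (g * M * g⁻¹ * g).1
  rw [inv_mul_cancel_right]
  rfl

lemma conj_um_of_zero {W : SL F} (hW : W 0 0 = 0) (u : F) :
    W * um (-u) * W⁻¹ = lm (W 1 0 ^ 2 * u) := by
  have hd := sl_det W
  rw [hW] at hd
  apply sl_ext <;>
    simp only [mul00, mul01, mul10, mul11, um00, um01, um10, um11, lm00, lm01, lm10, lm11, inv00,
      inv01, inv10, inv11, hW]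
  · linear_combination hd
  · ring
  · ring
  · linear_combination hd

lemma conj_um_of_triangular {W : SL F} (hW : W 1 0 = 0) (u : F) :
    W * um u * W⁻¹ = um (W 0 0 ^ 2 * u) := by
  have hd := sl_det W
  rw [hW] at hd
  apply sl_ext <;>
    simp only [mul00, mul01, mul10, mul11, um00, um01, um10, um11, inv00, inv01, inv10, inv11, hW]
  · linear_combination hd
  · ring
  · ring
  · linear_combination hd

/-- A homomorphism from `SL₂` to `PSL₂` whose kernel is the centre is induced by a semilinear
map. -/
lemma exists_semilinear [Finite F] {p : ℕ} [Fact p.Prime] [CharP F p] (hp : p = 2 ∨ p = 3)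
    {f : SL F →* ProjectiveSpecialLinearGroup (Fin 2) F}
    (hf : ∀ A B, f A = f B → A = B ∨ A = -B) :
    ∃ (A : GL (Fin 2) F) (σ : RingAut F), ∀ M, f M = pr (cj A (fa σ M)) := by
  have push : ∀ (B : GL (Fin 2) F) (f' : SL F →* ProjectiveSpecialLinearGroup (Fin 2) F),
      (∀ M, f' M = descend (cj B) (f M)) → ∀ A B, f' A = f' B → A = B ∨ A = -B :=
    fun B f' h A C e => hf A C ((descend (cj B)).injective (by rw [← h, ← h, e]))
  have hpu : (um (1 : F)) ^ p = 1 := by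
    rw [um_pow, CharP.cast_eq_zero, zero_mul, um_zero]
  obtain ⟨Y, hY⟩ := pr_surjective (f (um 1))
  obtain ⟨A, hA⟩ := exists_cj_um (F := F) hp (Y := Y)
    (by
      intro h
      rw [hY, ← map_one f] at h
      have h := hf _ _ h
      rcases h with h | h <;> have := congrArg (fun M : SL F => M 0 1) h <;>
        simp [neg_app, one01] at this)
    (by rw [hY, ← map_pow, hpu, map_one])
  obtain ⟨C, hA1⟩ : ∃ C, descend (cj C) (f (um 1)) = pr (um 1) := by
    refine ⟨A⁻¹, ?_⟩
    rw [← hY, ← hA, descend_pr, ← MulAut.mul_apply, ← map_mul, inv_mul_cancel, map_one,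
      MulAut.one_apply]
  have h1 : ∀ s, ∃ a, descend (cj C) (f (um s)) = pr (um a) := by
    intro s
    obtain ⟨Z, hZ⟩ := pr_surjective (descend (cj C) (f (um s)))
    rw [← hZ]
    apply exists_um_of_commute hp
    rw [hZ, ← hA1, Commute, SemiconjBy]
    simp only [← map_mul, ← um_add, add_comm]
  choose a ha using h1
  have ha1 : a 1 = 1 := pr_um_inj (by rw [← ha, hA1])
  obtain ⟨W, hW⟩ := pr_surjective (descend (cj C) (f wl))
  have hW10 : W 1 0 ≠ 0 := by
    intro h
    have e : descend (cj C) (f (lm (-1))) = pr (um (W 0 0 ^ 2 * 1)) := by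
      rw [lm_eq]
      change descend (cj C) (f (wl * um (- -1) * wl⁻¹)) = _
      simp only [neg_neg, map_mul, map_inv]
      rw [← hW, ha, ha1, ← map_inv, ← map_mul, ← map_mul, conj_um_of_triangular h]
    have e2 : descend (cj C) (f (lm (-1) * um 1)) = descend (cj C) (f (um 1 * lm (-1))) := by
      simp only [map_mul]
      rw [e, hA1, ← map_mul, ← map_mul, ← um_add, ← um_add, add_comm]
    rcases hf _ _ ((descend (cj C)).injective e2) with h | h <;>
      have := congrArg (fun M : SL F => M 0 0) h <;> simp [neg_app, mul00] at this
  let U : SL F := um (-W 0 0 / W 1 0)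
  let B : GL (Fin 2) F := Matrix.SpecialLinearGroup.toGL U * C
  let f2 : SL F →* ProjectiveSpecialLinearGroup (Fin 2) F :=
    (descend (cj B)).toMonoidHom.comp f
  have hB : ∀ M, f2 M = pr U * descend (cj C) (f M) * (pr U)⁻¹ := by
    intro M
    obtain ⟨N, hN⟩ := pr_surjective (f M)
    change descend (cj B) (f M) = _
    rw [← hN, descend_pr, descend_pr, map_mul, MulAut.mul_apply, cj_coe, map_mul, map_mul]
    rfl
  have hu : ∀ s, f2 (um s) = pr (um (a s)) := by
    intro s
    rw [hB, ha, ← map_inv, ← map_mul, ← map_mul, ← um_neg, ← um_add, ← um_add]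
    congr 2
    ring
  set W' := U * W * U⁻¹ with hW'
  have hw : f2 wl = pr W' := by
    rw [hB, ← hW, ← map_inv, ← map_mul, ← map_mul]
  have hW0 : W' 0 0 = 0 := by
    simp only [hW', U, mul00, mul01, um00, um01, inv00, inv10, um10, um11]
    field_simp
    ring
  have hl : ∀ s, f2 (lm s) = pr (lm (W' 1 0 ^ 2 * a s)) := by
    intro s
    have hneg : pr (um (a (-s))) = pr (um (-a s)) := by
      rw [um_neg, map_inv, ← hu, ← hu, um_neg, map_inv]
    rw [lm_eq]
    change f2 (wl * um (-s) * wl⁻¹) = _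
    rw [map_mul, map_mul, map_inv, hw, hu, hneg, ← map_inv, ← map_mul, ← map_mul,
      conj_um_of_zero hW0]
  have hneg1 : a (-1) = -1 := by
    apply pr_um_inj
    rw [← hu, um_neg, map_inv, hu, ha1]
    rfl
  have hk : W' 1 0 ^ 2 = 1 := by
    have e := hw
    rw [wl_eq, map_mul, map_mul, hu, hl, ha1, hneg1, ← map_mul, ← map_mul, pr_eq_iff] at e
    have : (um 1 * lm (W' 1 0 ^ 2 * -1) * um 1 : SL F) 0 0 = 0 := by
      rcases e with e | e <;> have := congrArg (fun M : SL F => M 0 0) e <;>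
        simpa [neg_app, hW0] using this
    simp only [mul00, mul01, um00, um01, um10, lm00, lm01, lm10, lm11] at this
    linear_combination -this
  obtain ⟨σ, hσ⟩ := exists_ringAut hp (f := f2) (a := a) (fun s t h => by
      apply pr_um_inj
      exact pr_eq_iff.2 (push B f2 (fun _ => rfl) _ _ h)) ha1 hu
    (fun s => by rw [hl, hk, one_mul])
  refine ⟨B⁻¹, σ, fun M => (descend (cj B)).injective ?_⟩
  rw [descend_pr, ← MulAut.mul_apply, ← map_mul, mul_inv_cancel, map_one, MulAut.one_apply, ← hσ]
  rfl

end

section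

variable {F : Type*} [Field F]

section FieldAutomorphisms

lemma zmod_cases {p : ℕ} (hp : p = 2 ∨ p = 3) (y : ZMod p) : y = 0 ∨ y = 1 ∨ y = -1 := by
  rcases hp with rfl | rfl <;> revert y <;> decide

lemma exists_gal_hom (p : ℕ) [Algebra (ZMod p) F] :
    ∃ f : RingAut F →* (F ≃ₐ[ZMod p] F), ∀ σ x, f σ x = σ x := by
  have : SMulCommClass (RingAut F) (ZMod p) F := ⟨fun σ c x => by
    change σ (c • x) = c • σ x
    rw [Algebra.smul_def, Algebra.smul_def, map_mul]
    congr 1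
    exact DFunLike.congr_fun
      (Subsingleton.elim ((σ : F →+* F).comp (algebraMap (ZMod p) F)) (algebraMap (ZMod p) F)) c⟩
  exact ⟨MulSemiringAction.toAlgAut (RingAut F) (ZMod p) F, fun _ _ => rfl⟩

variable [Finite F] {p b : ℕ} [Fact p.Prime]

lemma card_gal (hc : Nat.card F = p ^ b) [Algebra (ZMod p) F] :
    Nat.card (F ≃ₐ[ZMod p] F) = b := by
  rw [IsGalois.card_aut_eq_finrank]
  have h := Module.natCard_eq_pow_finrank (K := ZMod p) (V := F)
  rw [hc, Nat.card_zmod] at h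
  exact (Nat.pow_right_injective (Fact.out : p.Prime).two_le h).symm

variable [CharP F p]

lemma ringAut_pow_eq_one (hc : Nat.card F = p ^ b) (σ : RingAut F) : σ ^ b = 1 := by
  let := ZMod.algebra F p
  obtain ⟨f, hf⟩ := exists_gal_hom (F := F) p
  have h : f σ ^ b = 1 := by rw [← card_gal (F := F) hc]; exact pow_card_eq_one'
  rw [← map_pow] at h
  refine RingEquiv.ext fun x => ?_
  rw [← hf, h]
  rfl

lemma fixed_of_orderOf (hp : p = 2 ∨ p = 3) (hc : Nat.card F = p ^ b) {σ : RingAut F}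
    (hσ : orderOf σ = b) {x : F} (hx : σ x = x) : x = 0 ∨ x = 1 ∨ x = -1 := by
  let := ZMod.algebra F p
  obtain ⟨f, hf⟩ := exists_gal_hom (F := F) p
  have hfi : Function.Injective f := fun σ τ h => RingEquiv.ext fun x => by rw [← hf, h, hf]
  have hmem : x ∈ (⊥ : IntermediateField (ZMod p) F) := by
    rw [IsGalois.mem_bot_iff_fixed]
    have htop : Subgroup.zpowers (f σ) = ⊤ := by
      apply Subgroup.eq_top_of_card_eq
      rw [Nat.card_zpowers, orderOf_injective f hfi, hσ, card_gal hc]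
    have hstab : Subgroup.zpowers (f σ) ≤ MulAction.stabilizer (F ≃ₐ[ZMod p] F) x := by
      rw [Subgroup.zpowers_le]
      exact (hf σ x).trans hx
    intro τ
    exact hstab (htop ▸ Subgroup.mem_top τ)
  obtain ⟨y, rfl⟩ := IntermediateField.mem_bot.1 hmem
  rcases zmod_cases hp y with rfl | rfl | rfl <;> simp

end FieldAutomorphisms

section Semilinear

/-- Field automorphisms acting entrywise on `GL₂`. -/
def fg : RingAut F →* MulAut (GL (Fin 2) F) where
  toFun σ := Units.mapEquiv σ.mapMatrix.toMulEquiv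
  map_one' := by ext; rfl
  map_mul' _ _ := by ext; rfl

/-- The action on `SL₂` of the semilinear group. -/
def sa : GL (Fin 2) F ⋊[fg] RingAut F →* MulAut (SL F) :=
  SemidirectProduct.lift cj fa fun σ => by
    ext A M : 2
    change cj (fg σ A) M = fa σ (cj A ((fa σ)⁻¹ M))
    rw [cj_eq_iff, coe_fa]
    obtain ⟨N, rfl⟩ := (fa σ).surjective M
    rw [MulAut.inv_apply_self, coe_fa]
    change A.1.map σ * N.1.map σ = (A.1 * N.1 * A⁻¹.1).map σ * A.1.map σ
    have hm : ∀ X Y : Matrix (Fin 2) (Fin 2) F, (X * Y).map σ = X.map σ * Y.map σ :=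
      fun X Y => Matrix.map_mul (f := (σ : F →+* F))
    rw [← hm, ← hm, mul_assoc, Units.inv_mul, mul_one]

/-- `descend` as a homomorphism. -/
def descendHom : MulAut (SL F) →* MulAut (ProjectiveSpecialLinearGroup (Fin 2) F) where
  toFun := descend
  map_one' := by
    ext g
    obtain ⟨M, rfl⟩ := pr_surjective g
    rfl
  map_mul' d e := by
    ext g
    obtain ⟨M, rfl⟩ := pr_surjective g
    rfl

lemma descendHom_pr (e : MulAut (SL F)) (M : SL F) : descendHom e (pr M) = pr (e M) := rfl

lemma exists_eq_smul_of_trivial {p : ℕ} [CharP F p] (hp : p = 2 ∨ p = 3) {N : GL (Fin 2) F}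
    (h : descendHom (cj N) = 1) : ∃ c : F, c ≠ 0 ∧ N.1 = c • (1 : Matrix (Fin 2) (Fin 2) F) := by
  have hdet : N.1 0 0 * N.1 1 1 - N.1 0 1 * N.1 1 0 ≠ 0 := by
    rw [← det_fin_two]
    exact ((isUnit_iff_isUnit_det _).1 N.isUnit).ne_zero
  have key : ∀ M : SL F, (∃ i j, (N.1 * M.1) i j ≠ -(M.1 * N.1) i j) ∨ (2 : F) = 0 →
      N.1 * M.1 = M.1 * N.1 := by
    intro M hM
    have h1 : pr (cj N M) = pr M := by rw [← descendHom_pr, h]; rfl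
    refine cj_eq_iff.1 (eq_of_pr_eq h1 ?_)
    rcases hM with ⟨i, j, hM⟩ | h2
    · right
      intro e
      apply hM
      rw [cj_eq_iff.1 e, ← neg_apply, ← neg_mul]
      rfl
    · exact Or.inl h2
  have hne : ∀ x : F, x = -x → (2 : F) ≠ 0 → x = 0 := fun x h h2 => by
    apply (mul_eq_zero.1 (?_ : 2 * x = 0)).resolve_left h2
    linear_combination h
  have hu : N.1 1 0 = 0 ∧ N.1 0 0 = N.1 1 1 := by
    have h := key (um 1) (by
      rcases two_eq_zero_or (F := F) hp with h2 | ⟨h2, -⟩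
      · exact Or.inr h2
      left
      by_contra! hh
      have h10 := hh 1 0
      have h00 := hh 0 0
      simp [mul_apply, Fin.sum_univ_two, um] at h00 h10
      have n10 : N.1 1 0 = 0 := hne _ h10 h2
      rw [n10, neg_zero, zero_add] at h00
      have n00 : N.1 0 0 = 0 := hne _ h00 h2
      simp [n10, n00] at hdet)
    have h00 := congrFun₂ h 0 0
    have h01 := congrFun₂ h 0 1
    simp [mul_apply, Fin.sum_univ_two, um] at h00 h01
    exact ⟨h00, by linear_combination h01⟩
  have hl : N.1 0 1 = 0 := by
    have h := key (lm 1) (by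
      rcases two_eq_zero_or (F := F) hp with h2 | ⟨h2, -⟩
      · exact Or.inr h2
      left
      by_contra! hh
      have h01 := hh 0 1
      have h00 := hh 0 0
      simp [mul_apply, Fin.sum_univ_two, lm] at h00 h01
      have n01 : N.1 0 1 = 0 := hne _ h01 h2
      rw [n01, add_zero] at h00
      have n00 : N.1 0 0 = 0 := hne _ h00 h2
      simp [n01, n00] at hdet)
    have h00 := congrFun₂ h 0 0
    simpa [mul_apply, Fin.sum_univ_two, lm] using h00
  refine ⟨N.1 0 0, ?_, ?_⟩
  · intro h0
    simp [h0, hl] at hdet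
  · ext i j
    fin_cases i <;> fin_cases j <;> simp [hu, hl]

end Semilinear

end

section

variable {F : Type*} [Field F] {p b : ℕ}

/-- The action of the semilinear group on `PSL₂`. -/
def psa : GL (Fin 2) F ⋊[fg] RingAut F →* MulAut (ProjectiveSpecialLinearGroup (Fin 2) F) :=
  descendHom.comp sa

lemma psa_pr (g : GL (Fin 2) F ⋊[fg] RingAut F) (M : SL F) :
    psa g (pr M) = pr (cj g.left (fa g.right M)) := rfl

lemma psa_inl (A : GL (Fin 2) F) : psa (SemidirectProduct.inl A) = descendHom (cj A) := by
  ext g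
  obtain ⟨M, rfl⟩ := pr_surjective g
  rfl

lemma psa_surjective [Finite F] [Fact p.Prime] [CharP F p] (hp : p = 2 ∨ p = 3) :
    Function.Surjective (psa (F := F)) := by
  intro φ
  obtain ⟨A, σ, h⟩ := exists_semilinear hp (f := φ.toMonoidHom.comp (pr (F := F)))
    (fun M N e => pr_eq_iff.1 (φ.injective e))
  refine ⟨⟨A, σ⟩, ?_⟩
  ext g
  obtain ⟨M, rfl⟩ := pr_surjective g
  exact (h M).symm

/-- The square of a projectivity of the line is inner on `PSL₂`. -/
lemma exists_cj_sq (B : GL (Fin 2) F) : ∃ S : SL F, cj (B * B) = MulAut.conj S := by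
  have hB : B.1.det ≠ 0 := ((isUnit_iff_isUnit_det _).1 B.isUnit).ne_zero
  let S : SL F := ⟨B.1.det⁻¹ • (B.1 * B.1), by
    rw [det_smul, det_mul, Fintype.card_fin]
    field_simp⟩
  have hS : (B * B).1 = B.1.det • S.1 := by
    change B.1 * B.1 = B.1.det • B.1.det⁻¹ • (B.1 * B.1)
    rw [smul_smul, mul_inv_cancel₀ hB, one_smul]
  refine ⟨S, ?_⟩
  ext M : 1
  rw [cj_eq_iff, MulAut.conj_apply, hS, smul_mul, Matrix.mul_smul]
  congr 1
  change (S * M).1 = (S * M * S⁻¹ * S).1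
  rw [inv_mul_cancel_right]

lemma cj_pow_eq_one (B : GL (Fin 2) F) :
    descendHom (cj B) ^ (2 * Nat.card (ProjectiveSpecialLinearGroup (Fin 2) F)) = 1 := by
  obtain ⟨S, hS⟩ := exists_cj_sq B
  have h : descendHom (cj B) ^ 2 = MulAut.conj (pr S) := by
    rw [sq, ← map_mul, ← map_mul, hS]
    ext g
    obtain ⟨M, rfl⟩ := pr_surjective g
    rfl
  rw [pow_mul, h, ← map_pow, pow_card_eq_one', map_one]

section Card

lemma orderOf_pr_wl : orderOf (pr (wl : SL F)) = 2 := by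
  apply orderOf_eq_prime
  · rw [← map_pow, pr_eq_one]
    right
    apply sl_ext <;> simp [neg_app, sq, wl, mul00, mul01, mul10, mul11]
  · intro h
    rcases pr_eq_one.1 h with h | h <;> have := congrArg (fun M : SL F => M 0 1) h <;>
      simp [wl, neg_app, one01] at this

lemma orderOf_pr_um [Fact p.Prime] [CharP F p] : orderOf (pr (um (1 : F))) = p := by
  apply orderOf_eq_prime
  · rw [← map_pow, um_pow, CharP.cast_eq_zero, zero_mul, um_zero, map_one]
  · intro h
    rcases pr_eq_one.1 h with h | h <;> have := congrArg (fun M : SL F => M 0 1) h <;>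
      simp [neg_app, one01] at this

lemma coprime_card_sl [Finite F] (h : Nat.Coprime b (Nat.card (ProjectiveSpecialLinearGroup (Fin 2) F)))
    (hodd : Odd b) : Nat.Coprime b (Nat.card (SL F)) := by
  rw [Subgroup.card_eq_card_quotient_mul_card_subgroup (Subgroup.center (SL F))]
  refine Nat.Coprime.mul_right h ?_
  have hle : Nat.card (Subgroup.center (SL F)) ≤ 2 := by
    have hs : (Subgroup.center (SL F) : Set (SL F)) ⊆ {1, -1} := by
      intro A hA
      exact pr_eq_one.1 ((QuotientGroup.eq_one_iff A).2 hA)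
    calc Nat.card (Subgroup.center (SL F)) = (Subgroup.center (SL F) : Set (SL F)).ncard := rfl
      _ ≤ ({1, -1} : Set (SL F)).ncard := Set.ncard_le_ncard hs
      _ ≤ ({-1} : Set (SL F)).ncard + 1 := Set.ncard_insert_le _ _
      _ = 2 := by rw [Set.ncard_singleton]
  have hpos : 0 < Nat.card (Subgroup.center (SL F)) := Nat.card_pos
  interval_cases Nat.card (Subgroup.center (SL F))
  · simp
  · exact (Nat.coprime_two_left.2 hodd).symm

lemma odd_of_coprime
    (h : Nat.Coprime b (Nat.card (ProjectiveSpecialLinearGroup (Fin 2) F))) : Odd b := by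
  have h2 : 2 ∣ Nat.card (ProjectiveSpecialLinearGroup (Fin 2) F) := by
    have := orderOf_dvd_natCard (pr (wl : SL F))
    rwa [orderOf_pr_wl] at this
  exact Nat.coprime_two_left.1 (h.coprime_dvd_right h2).symm

lemma not_dvd_of_coprime [Fact p.Prime] [CharP F p]
    (h : Nat.Coprime b (Nat.card (ProjectiveSpecialLinearGroup (Fin 2) F))) : ¬ p ∣ b := by
  have h2 : p ∣ Nat.card (ProjectiveSpecialLinearGroup (Fin 2) F) :=
    orderOf_pr_um (F := F) (p := p) ▸ orderOf_dvd_natCard _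
  exact ((Fact.out : p.Prime).coprime_iff_not_dvd).1 (h.coprime_dvd_right h2).symm

end Card

variable [Finite F] [Fact p.Prime] [CharP F p]

lemma orderOf_right (hc : Nat.card F = p ^ b)
    (hcop : Nat.Coprime b (Nat.card (ProjectiveSpecialLinearGroup (Fin 2) F)))
    {g : GL (Fin 2) F ⋊[fg] RingAut F} (hg : orderOf (psa g) = b) : orderOf g.right = b := by
  apply Nat.dvd_antisymm
  · exact orderOf_dvd_of_pow_eq_one (ringAut_pow_eq_one hc _)
  · set d := orderOf g.right with hd
    have h1 : g ^ d = SemidirectProduct.inl (g ^ d).left := by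
      ext
      · rfl
      · have : (g ^ d).right = 1 := by
          change SemidirectProduct.rightHom (g ^ d) = 1
          rw [map_pow]
          exact pow_orderOf_eq_one g.right
        rw [this]; rfl
    have h2 : psa g ^ (d * (2 * Nat.card (ProjectiveSpecialLinearGroup (Fin 2) F))) = 1 := by
      rw [pow_mul, ← map_pow, h1, psa_inl, cj_pow_eq_one]
    have h3 := orderOf_dvd_of_pow_eq_one h2
    rw [hg] at h3
    refine Nat.Coprime.dvd_of_dvd_mul_right (Nat.Coprime.mul_right ?_ hcop) h3
    exact (Nat.coprime_two_left.2 (odd_of_coprime hcop)).symm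

lemma exists_pow_eq_one (hp : p = 2 ∨ p = 3) (hc : Nat.card F = p ^ b)
    (hcop : Nat.Coprime b (Nat.card (ProjectiveSpecialLinearGroup (Fin 2) F)))
    {φ : MulAut (ProjectiveSpecialLinearGroup (Fin 2) F)} (hφ : orderOf φ = b) :
    ∃ g : GL (Fin 2) F ⋊[fg] RingAut F, psa g = φ ∧ orderOf g.right = b ∧ g ^ b = 1 := by
  obtain ⟨g, rfl⟩ := psa_surjective hp φ
  have ho := orderOf_right hc hcop hφ
  have hr : (g ^ b).right = 1 := by
    change SemidirectProduct.rightHom (g ^ b) = 1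
    rw [map_pow, ← ho]
    exact pow_orderOf_eq_one g.right
  have h1 : g ^ b = SemidirectProduct.inl (g ^ b).left := by
    ext
    · rfl
    · rw [hr]; rfl
  set N := (g ^ b).left with hN
  have hNt : descendHom (cj N) = 1 := by
    rw [← psa_inl, ← h1, map_pow, ← hφ, pow_orderOf_eq_one]
  obtain ⟨c, hc0, hNc⟩ := exists_eq_smul_of_trivial hp hNt
  have hcomm : fg g.right N = N := by
    have e : g * g ^ b = g ^ b * g := (Commute.self_pow g b).eq
    have e := congrArg SemidirectProduct.left e
    rw [h1, SemidirectProduct.mul_left, SemidirectProduct.mul_left, SemidirectProduct.left_inl,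
      SemidirectProduct.right_inl, map_one, MulAut.one_apply] at e
    have e2 : N * g.left = g.left * N := by
      apply Units.ext
      rw [Units.val_mul, Units.val_mul, hNc, smul_mul, Matrix.mul_smul, one_mul, mul_one]
    rw [e2] at e
    exact mul_left_cancel e
  have hcf : g.right c = c := by
    have e := congrArg (fun X : GL (Fin 2) F => X.1 0 0) hcomm
    change g.right (N.1 0 0) = N.1 0 0 at e
    simpa [hNc] using e
  rcases fixed_of_orderOf hp hc ho hcf with h | h | h
  · exact absurd h hc0
  · refine ⟨g, rfl, ho, ?_⟩
    have : N = 1 := by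
      apply Units.ext
      rw [hNc, h, one_smul]; rfl
    rw [h1, this, map_one]
  · have hN1 : N = -1 := by
      apply Units.ext
      rw [hNc, h, neg_smul, one_smul]; rfl
    have hf : ∀ σ : RingAut F, fg σ (-1) = -1 := by
      intro σ
      apply Units.ext
      change (-1 : Matrix (Fin 2) (Fin 2) F).map σ = -1
      ext i j
      fin_cases i <;> fin_cases j <;> simp
    refine ⟨SemidirectProduct.inl (-1) * g, ?_, ?_, ?_⟩
    · have : descendHom (cj (-1 : GL (Fin 2) F)) = 1 := by rw [← hN1, hNt]
      rw [map_mul, psa_inl, this, one_mul]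
    · simpa using ho
    · have hcm : Commute (SemidirectProduct.inl (-1)) g := by
        apply SemidirectProduct.ext
        · simp [hf]
        · simp
      rw [hcm.mul_pow, h1, hN1, ← map_pow, ← map_mul, (odd_of_coprime hcop).neg_one_pow]
      simp

end

section

variable {F : Type*} [Field F] {p b : ℕ}

lemma iterate_semilinear_gl (g : GL (Fin 2) F ⋊[fg] RingAut F) (i : ℕ) (v : F × F) :
    (fun v => ap g.left.1 (sg g.right v))^[i] v = ap (g ^ i).left.1 (sg (g ^ i).right v) := by
  induction i with
  | zero => simp [ap_one, sg_one]
  | succ i ih =>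
    rw [Function.iterate_succ_apply', ih, pow_succ', sg_ap, ← ap_mul, ← sg_mul]
    rfl

/-- An element of the semilinear group whose order equals that of its field automorphism is
conjugate to that automorphism. -/
lemma exists_conj_inr {g : GL (Fin 2) F ⋊[fg] RingAut F} (hb : 0 < b)
    (hg : orderOf g.right = b) (h1 : g ^ b = 1) :
    ∃ n : GL (Fin 2) F, g * SemidirectProduct.inl n =
      SemidirectProduct.inl n * SemidirectProduct.inr g.right := by
  obtain ⟨n, hn, hMn⟩ := exists_eq_cols hb hg g.left.1 (fun v => by
    rw [iterate_semilinear_gl, h1]; simp [ap_one, sg_one])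
  refine ⟨GeneralLinearGroup.mkOfDetNeZero n hn, SemidirectProduct.ext ?_ (by simp)⟩
  apply Units.ext
  change g.left.1 * n.map g.right = n * (1 : Matrix (Fin 2) (Fin 2) F).map id
  rw [hMn, Matrix.map_id, mul_one]

/-- An automorphism of `PSL₂` of order `b` coprime to the group order is conjugate to a field
automorphism. -/
lemma exists_conj_field [Finite F] [Fact p.Prime] [CharP F p] (hp : p = 2 ∨ p = 3)
    (hb2 : 2 ≤ b) (hc : Nat.card F = p ^ b)
    (hcop : Nat.Coprime b (Nat.card (ProjectiveSpecialLinearGroup (Fin 2) F)))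
    {φ : MulAut (ProjectiveSpecialLinearGroup (Fin 2) F)} (hφ : orderOf φ = b) :
    ∃ (σ : RingAut F) (θ : MulAut (ProjectiveSpecialLinearGroup (Fin 2) F)),
      Good p b σ ∧ ∀ M, φ (θ (pr M)) = θ (pr (fa σ M)) := by
  obtain ⟨g, rfl, ho, h1⟩ := exists_pow_eq_one hp hc hcop hφ
  obtain ⟨n, hn⟩ := exists_conj_inr (by lia) ho h1
  refine ⟨g.right, psa (SemidirectProduct.inl n),
    ⟨hp, inferInstance, hb2, odd_of_coprime hcop, ho, not_dvd_of_coprime (F := F) hcop,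
      coprime_card_sl hcop (odd_of_coprime hcop), fun x hx => fixed_of_orderOf hp hc ho hx⟩,
    fun M => ?_⟩
  rw [← MulAut.mul_apply, ← map_mul, hn, map_mul, MulAut.mul_apply, psa_pr (SemidirectProduct.inr _)]
  simp

/-- Every element of `PSL₂` is the product of a twisted coboundary and a translated one. -/
lemma exists_eq_twisted_prod [Finite F] [Fact p.Prime] [CharP F p] (hp : p = 2 ∨ p = 3)
    (hb2 : 2 ≤ b) (hc : Nat.card F = p ^ b)
    (hcop : Nat.Coprime b (Nat.card (ProjectiveSpecialLinearGroup (Fin 2) F)))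
    {φ : MulAut (ProjectiveSpecialLinearGroup (Fin 2) F)} (hφ : orderOf φ = b)
    (g : ProjectiveSpecialLinearGroup (Fin 2) F) :
    ∃ h k, g = h * (φ h)⁻¹ * φ (k * (φ k)⁻¹) := by
  classical
  cases nonempty_fintype F
  obtain ⟨σ, θ, hσ, hθ⟩ := exists_conj_field hp hb2 hc hcop hφ
  obtain ⟨M, hM⟩ := pr_surjective (θ⁻¹ g)
  obtain ⟨H, K, hHK⟩ := isProd_of_exists_elliptic hσ (exists_elliptic hσ) M
  have hpr : pr M = pr (H * (fa σ H)⁻¹ * (fa σ K * (fa (σ * σ) K)⁻¹)) := pr_eq_iff.2 hHK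
  refine ⟨θ (pr H), θ (pr K), ?_⟩
  have hg : g = θ (pr M) := by rw [hM, MulAut.apply_inv_self]
  rw [hg, hpr]
  simp only [map_mul, map_inv, MulAut.mul_apply, hθ]

/-- The square of the class of `x` in `G ⋊ ⟨x⟩` fills a coset as soon as every element of `G` is
the product of a twisted coboundary and a translated one. -/
lemma conj_prod_eq_coset {G : Type*} [Group G] (x : MulAut G)
    (hG : ∀ g, ∃ h k, g = h * (x h)⁻¹ * x (k * (x k)⁻¹))
    {ξ : G ⋊[(Subgroup.zpowers x).subtype] Subgroup.zpowers x}
    (hξ : ξ = SemidirectProduct.inr ⟨x, Subgroup.mem_zpowers x⟩) :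
    {z | ∃ u v, IsConj ξ u ∧ IsConj ξ v ∧ z = u * v} =
      {z | ∃ g : G, z = SemidirectProduct.inl g * ξ ^ 2} := by
  have hcomm : ∀ r t : Subgroup.zpowers x, r * t * r⁻¹ = t := by
    rintro ⟨_, i, rfl⟩ ⟨_, j, rfl⟩
    rw [mul_inv_eq_iff_eq_mul]
    exact Subtype.ext (zpow_mul_comm x i j)
  ext z
  constructor
  · rintro ⟨u, v, hu, hv, rfl⟩
    obtain ⟨c, rfl⟩ := isConj_iff.1 hu
    obtain ⟨d, rfl⟩ := isConj_iff.1 hv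
    refine ⟨(c * ξ * c⁻¹ * (d * ξ * d⁻¹) * (ξ ^ 2)⁻¹).left, ?_⟩
    rw [← mul_inv_eq_iff_eq_mul]
    refine SemidirectProduct.ext (by rw [SemidirectProduct.left_inl]) ?_
    rw [SemidirectProduct.right_inl, pow_two]
    simp only [SemidirectProduct.mul_right, SemidirectProduct.inv_right, hcomm, mul_inv_cancel]
  · rintro ⟨g, rfl⟩
    obtain ⟨h, k, rfl⟩ := hG g
    refine ⟨SemidirectProduct.inl h * ξ * (SemidirectProduct.inl h)⁻¹,
      SemidirectProduct.inl k * ξ * (SemidirectProduct.inl k)⁻¹,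
      isConj_iff.2 ⟨_, rfl⟩, isConj_iff.2 ⟨_, rfl⟩, ?_⟩
    subst hξ
    rw [pow_two]
    refine SemidirectProduct.ext ?_ ?_
    · simp [mul_assoc]
    · simp

end

end PSLTwist

/-- **Proposition 3.5** (for `PSL₂`).  Let `G = PSL₂(p^b)` with `p ∈ {2,3}` and
`x ∈ Aut(G)` of order `b` coprime to `|G|`.  If `L = G⟨x⟩` then `(x^L)² = x²G`. -/
theorem stmt14 (p b : ℕ) [Fact p.Prime] (hp : p = 2 ∨ p = 3) (hb : 0 < b)
    (hpb : 4 ≤ p ^ b)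
    (x : MulAut (Matrix.ProjectiveSpecialLinearGroup (Fin 2) (GaloisField p b)))
    (hx : orderOf x = b)
    (hcop : Nat.Coprime b
      (Nat.card (Matrix.ProjectiveSpecialLinearGroup (Fin 2) (GaloisField p b)))) :
    let L := SemidirectProduct (Matrix.ProjectiveSpecialLinearGroup (Fin 2) (GaloisField p b))
      (Subgroup.zpowers x) (Subgroup.zpowers x).subtype
    let ξ : L := SemidirectProduct.inr ⟨x, Subgroup.mem_zpowers x⟩
    {z : L | ∃ u v : L, IsConj ξ u ∧ IsConj ξ v ∧ z = u * v} =
      {z : L | ∃ g : Matrix.ProjectiveSpecialLinearGroup (Fin 2) (GaloisField p b),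
        z = SemidirectProduct.inl g * ξ ^ 2} := by
  intro L ξ
  have hb2 : 2 ≤ b := by
    by_contra! h
    obtain rfl : b = 1 := by lia
    lia
  exact PSLTwist.conj_prod_eq_coset x
    (PSLTwist.exists_eq_twisted_prod hp hb2 (GaloisField.card p b hb.ne') hcop hx) rfl
end
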